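/- Let d ≥ 3, k ≥ 0, R = ℤ[x_1,…,x_k], and let U be an ideal of finite index in R (i.e., R/U is finite). Then every matrix g ∈ SL_d(R) with g ≡ Id (mod U) can be written as g = h·u_1·u_2⋯u_m where h ∈ EL(d;U), each u_s is an elementary matrix E_{i_s j_s}(r_s) with r_s ∈ R, and m ≤ 18(k + 2). -/

import Mathlib

/-- The elementary matrix `E_{ij}(r)`: the identity matrix with the entry `r`
added in position `(i,j)`, as an element of `SL_d(A)`. -/
def elem {A : Type*} [CommRing A] {d : ℕ} (i j : Fin d) (h : i ≠ j) (r : A) :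
    Matrix.SpecialLinearGroup (Fin d) A :=
  ⟨Matrix.transvection i j r, Matrix.det_transvection_of_ne i j h r⟩

/-- A matrix in `SL_d(A)` is elementary if it is of the form `E_{ij}(r)` for some `i ≠ j`. -/
def IsElementary {A : Type*} [CommRing A] {d : ℕ}
    (g : Matrix.SpecialLinearGroup (Fin d) A) : Prop :=
  ∃ (i j : Fin d) (h : i ≠ j) (r : A), g = elem i j h r

/-- `EL(d;U)`: the normal subgroup of `SL_d(R)` generated by the elementary matrices
`E_{ij}(u)` with `u ∈ U`. -/
def EL {R : Type*} [CommRing R] (d : ℕ) (U : Ideal R) :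
    Subgroup (Matrix.SpecialLinearGroup (Fin d) R) :=
  Subgroup.normalClosure
    {g | ∃ (i j : Fin d) (h : i ≠ j) (u : R), u ∈ U ∧ g = elem i j h u}


namespace CSB
open Matrix
open scoped commutatorElement
set_option linter.all false

/-- there is always a third index -/
class Has3 (n : Type*) : Prop where
  third : ∀ i j : n, ∃ k, k ≠ i ∧ k ≠ j

section basic
variable {n : Type*} [Fintype n] [DecidableEq n] {K : Type*} [CommRing K]

/-- elementary matrix as a unit (junk value `1` if `i = j`) -/
def x (i j : n) (a : K) : GL n K :=
  if h : i ≠ j then ⟨transvection i j a, transvection i j (-a),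
    by rw [transvection_mul_transvection_same _ _ h]; simp,
    by rw [transvection_mul_transvection_same _ _ h]; simp⟩ else 1

theorem x_val {i j : n} (h : i ≠ j) (a : K) : (x i j a).val = 1 + single i j a := by
  simp [x, h, transvection]

theorem x_self (i : n) (a : K) : x i i a = 1 := by simp [x]

theorem x_add (i j : n) (a b : K) : x i j (a + b) = x i j a * x i j b := by
  by_cases h : i = j
  · subst h; simp [x_self]
  · ext1
    simp only [Units.val_mul, x_val h]
    have := transvection_mul_transvection_same i j h a b
    simp only [transvection] at this
    exact this.symm

theorem x_zero (i j : n) : x i j (0 : K) = 1 := by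
  have := x_add i j (0 : K) 0
  simpa using this

theorem x_neg (i j : n) (a : K) : x i j (-a) = (x i j a)⁻¹ := by
  have := x_add i j a (-a)
  rw [add_neg_cancel, x_zero] at this
  exact eq_inv_of_mul_eq_one_right this.symm

theorem x_inv_val {i j : n} (h : i ≠ j) (a : K) : (x i j a)⁻¹.val = 1 - single i j a := by
  rw [← x_neg, x_val h, sub_eq_add_neg]
  congr 1
  ext r c; simp [single_apply]; split_ifs <;> simp

theorem x_comm {i j k l : n} (hij : i ≠ j) (hkl : k ≠ l) (h1 : j ≠ k) (h2 : i ≠ l) (a b : K) :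
    x i j a * x k l b = x k l b * x i j a := by
  ext1
  simp only [Units.val_mul, x_val hij, x_val hkl, add_mul, mul_add, one_mul, mul_one,
    single_mul_single_of_ne _ _ _ _ h1, single_mul_single_of_ne _ _ _ _ h2.symm]
  abel

theorem x_mul {i j k : n} (hij : i ≠ j) (hjk : j ≠ k) (hik : i ≠ k) (a b : K) :
    x i j a * x j k b = x i k (a * b) * x j k b * x i j a := by
  ext1
  simp only [Units.val_mul, x_val hij, x_val hjk, x_val hik, add_mul, mul_add, one_mul, mul_one,
    single_mul_single_same, single_mul_single_of_ne _ _ _ _ hik.symm,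
    single_mul_single_of_ne _ _ _ _ hjk.symm, single_mul_single_of_ne _ _ _ _ hij.symm, zero_mul]
  abel

theorem x_comm3 {i j k : n} (hij : i ≠ j) (hjk : j ≠ k) (hik : i ≠ k) (a b : K) :
    x i k (a * b) = ⁅x i j a, x j k b⁆ := by
  rw [commutatorElement_def, x_mul hij hjk hik]; group

/-- elementary subgroup with entries in `I` -/
def El (n : Type*) [Fintype n] [DecidableEq n] {K : Type*} [CommRing K] (I : Set K) :
    Subgroup (GL n K) :=
  Subgroup.closure {g | ∃ i j : n, i ≠ j ∧ ∃ a ∈ I, g = x i j a}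

theorem x_mem {I : Set K} (i j : n) {a : K} (h : a ∈ I) : x i j a ∈ El n I := by
  by_cases hij : i = j
  · subst hij; rw [x_self]; exact one_mem _
  · exact Subgroup.subset_closure ⟨i, j, hij, a, h, rfl⟩

theorem El_le {I : Set K} {H : Subgroup (GL n K)} (h : ∀ i j : n, i ≠ j → ∀ a ∈ I, x i j a ∈ H) :
    El n I ≤ H := by
  rw [El, Subgroup.closure_le]
  rintro _ ⟨i, j, hij, a, ha, rfl⟩
  exact h i j hij a ha

theorem El_mono {I J : Set K} (h : I ⊆ J) : El n I ≤ El n J :=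
  El_le fun i j _ _ ha => x_mem i j (h ha)

abbrev mp (n : Type*) [Fintype n] [DecidableEq n] {A B : Type*} [CommRing A] [CommRing B]
    (f : A →+* B) : GL n A →* GL n B := Matrix.GeneralLinearGroup.map f

theorem mp_val {A B : Type*} [CommRing A] [CommRing B] (f : A →+* B) (g : GL n A) :
    (mp n f g).val = g.val.map f := rfl

theorem mp_x {A B : Type*} [CommRing A] [CommRing B] (f : A →+* B) (i j : n) (a : A) :
    mp n f (x i j a) = x i j (f a) := by
  by_cases h : i = j
  · subst h; simp [x_self]
  · ext r c
    rw [mp_val, x_val h, x_val h]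
    simp [single_apply, one_apply, apply_ite f]

theorem mp_El {A B : Type*} [CommRing A] [CommRing B] (f : A →+* B) (I : Set A) :
    (El n I).map (mp n f) = El n (f '' I) := by
  apply le_antisymm
  · rw [Subgroup.map_le_iff_le_comap]
    apply El_le
    intro i j h a ha
    rw [Subgroup.mem_comap, mp_x]
    exact x_mem i j ⟨a, ha, rfl⟩
  · apply El_le
    rintro i j h _ ⟨a, ha, rfl⟩
    exact ⟨x i j a, x_mem i j ha, mp_x f i j a⟩

theorem mp_mem {A B : Type*} [CommRing A] [CommRing B] (f : A →+* B) {I : Set A} {J : Set B}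
    (h : ∀ a ∈ I, f a ∈ J) {g : GL n A} (hg : g ∈ El n I) : mp n f g ∈ El n J := by
  have : mp n f g ∈ (El n I).map (mp n f) := ⟨g, hg, rfl⟩
  rw [mp_El] at this
  refine El_mono ?_ this
  rintro _ ⟨a, ha, rfl⟩; exact h a ha

theorem mp_memU {A B : Type*} [CommRing A] [CommRing B] (f : A →+* B)
    {g : GL n A} (hg : g ∈ El n (Set.univ : Set A)) : mp n f g ∈ El n (Set.univ : Set B) :=
  mp_mem f (fun _ _ => Set.mem_univ _) hg

theorem mp_inj {A B : Type*} [CommRing A] [CommRing B] (f : A →+* B) (hf : Function.Injective f) :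
    Function.Injective (mp n f) := by
  intro g h e
  ext i j
  apply hf
  have := congrArg (fun u : GL n B => u.val i j) e
  simpa [mp_val] using this

theorem mp_comp {A B C : Type*} [CommRing A] [CommRing B] [CommRing C] (f : A →+* B) (g : B →+* C)
    (u : GL n A) : mp n g (mp n f u) = mp n (g.comp f) u := by
  ext i j; rfl

theorem El_det {I : Set K} {g : GL n K} (hg : g ∈ El n I) : g.val.det = 1 := by
  have : El n I ≤ (Matrix.GeneralLinearGroup.det (n := n) (R := K)).ker := by
    apply El_le
    intro i j h a _
    rw [MonoidHom.mem_ker]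
    ext
    simp [x_val h]
    exact det_transvection_of_ne i j h a
  have := this hg
  rw [MonoidHom.mem_ker] at this
  exact congrArg Units.val this

/-- lifting an elementary matrix with entries in the range -/
theorem El_lift {A B : Type*} [CommRing A] [CommRing B] (f : A →+* B) {I : Set A} {J : Set B}
    (h : ∀ b ∈ J, ∃ a ∈ I, f a = b) {g : GL n B} (hg : g ∈ El n J) :
    ∃ g' ∈ El n I, mp n f g' = g := by
  have : g ∈ El n (f '' I) := El_mono (fun b hb => by
    obtain ⟨a, ha, rfl⟩ := h b hb; exact ⟨a, ha, rfl⟩) hg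
  rw [← mp_El] at this
  exact this

/-! rank one matrices -/
/-- `1 + v wᵀ` with `w·v = 0` -/
noncomputable def T (v w : n → K) : GL n K := open Classical in
  if h : w ⬝ᵥ v = 0 then ⟨1 + vecMulVec v w, 1 - vecMulVec v w, by
    simp [add_mul, mul_sub, vecMulVec_mul_vecMulVec, h], by
    simp [sub_mul, mul_add, vecMulVec_mul_vecMulVec, h]⟩ else 1

theorem T_val {v w : n → K} (h : w ⬝ᵥ v = 0) : (T v w).val = 1 + vecMulVec v w := by
  simp [T, h]
theorem T_inv_val {v w : n → K} (h : w ⬝ᵥ v = 0) : (T v w)⁻¹.val = 1 - vecMulVec v w := by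
  simp [T, h]

theorem T_add_left {v v' w : n → K} (h : w ⬝ᵥ v = 0) (h' : w ⬝ᵥ v' = 0) :
    T (v + v') w = T v w * T v' w := by
  ext1
  rw [Units.val_mul, T_val h, T_val h', T_val (by simp [h, h'])]
  simp [add_mul, mul_add, vecMulVec_mul_vecMulVec, h', add_vecMulVec, add_assoc]
  try abel

theorem T_add_right {v w w' : n → K} (h : w ⬝ᵥ v = 0) (h' : w' ⬝ᵥ v = 0) :
    T v (w + w') = T v w * T v w' := by
  ext1
  rw [Units.val_mul, T_val h, T_val h', T_val (by simp [h, h'])]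
  simp [add_mul, mul_add, vecMulVec_mul_vecMulVec, h, vecMulVec_add, add_assoc]

theorem T_single {i j : n} (h : i ≠ j) (a : K) :
    T (Pi.single i a) (Pi.single j 1) = x i j a := by
  ext r c
  rw [T_val (by simp [h.symm]), x_val h]
  simp [vecMulVec_apply, single_apply, Pi.single_apply]
  grind

theorem T_single' {i j : n} (h : i ≠ j) (a : K) :
    T (Pi.single i 1) (Pi.single j a) = x i j a := by
  ext r c
  rw [T_val (by simp [h.symm]), x_val h]
  simp [vecMulVec_apply, single_apply, Pi.single_apply]
  grind

theorem T_zero_left (w : n → K) : T 0 w = 1 := by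
  ext1; rw [T_val (by simp)]; simp
theorem T_zero_right (v : n → K) : T v 0 = 1 := by
  ext1; rw [T_val (by simp)]; simp

theorem T_sum_left {ι : Type*} (s : Finset ι) (f : ι → n → K) (w : n → K)
    (h : ∀ i ∈ s, w ⬝ᵥ f i = 0) (H : Subgroup (GL n K)) (hH : ∀ i ∈ s, T (f i) w ∈ H) :
    T (∑ i ∈ s, f i) w ∈ H := by
  classical
  induction s using Finset.induction_on with
  | empty => simp [T_zero_left, one_mem]
  | insert a s ha ih =>
    rw [Finset.sum_insert ha, T_add_left (h a (by simp))]
    · exact mul_mem (hH a (by simp)) (ih (fun i hi => h i (by simp [hi])) fun i hi => hH i (by simp [hi]))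
    · rw [dotProduct_sum]
      exact Finset.sum_eq_zero fun i hi => h i (by simp [hi])

theorem T_sum_right {ι : Type*} (s : Finset ι) (f : ι → n → K) (v : n → K)
    (h : ∀ i ∈ s, f i ⬝ᵥ v = 0) (H : Subgroup (GL n K)) (hH : ∀ i ∈ s, T v (f i) ∈ H) :
    T v (∑ i ∈ s, f i) ∈ H := by
  classical
  induction s using Finset.induction_on with
  | empty => simp [T_zero_right, one_mem]
  | insert a s ha ih =>
    rw [Finset.sum_insert ha, T_add_right (h a (by simp))]
    · exact mul_mem (hH a (by simp)) (ih (fun i hi => h i (by simp [hi])) fun i hi => hH i (by simp [hi]))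
    · rw [sum_dotProduct]
      exact Finset.sum_eq_zero fun i hi => h i (by simp [hi])

/-- columns: `T v e_q ∈ H` if all `x i q (v i) ∈ H` -/
theorem T_col_mem {v : n → K} {q : n} (hv : v q = 0) (H : Subgroup (GL n K))
    (hH : ∀ i, i ≠ q → x i q (v i) ∈ H) : T v (Pi.single q 1) ∈ H := by
  have : v = ∑ i, Pi.single i (v i) := (Finset.univ_sum_single v).symm
  rw [this]
  apply T_sum_left
  · intro i _
    by_cases h : i = q
    · subst h; simp [hv]
    · simp [Pi.single_apply, Ne.symm h]
  · intro i _
    by_cases h : i = q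
    · subst h; simp [hv, T_zero_left, one_mem]
    · rw [T_single h]; exact hH i h

theorem T_row_mem {w : n → K} {q : n} (hw : w q = 0) (H : Subgroup (GL n K))
    (hH : ∀ i, i ≠ q → x q i (w i) ∈ H) : T (Pi.single q 1) w ∈ H := by
  have : w = ∑ i, Pi.single i (w i) := (Finset.univ_sum_single w).symm
  rw [this]
  apply T_sum_right
  · intro i _
    by_cases h : i = q
    · subst h; simp [hw]
    · simp [Pi.single_apply, h]
  · intro i _
    by_cases h : i = q
    · subst h; simp [hw, T_zero_right, one_mem]
    · rw [T_single' (Ne.symm h)]; exact hH i h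

theorem T_comm {v w : n → K} {q : n} (hv : v q = 0) (hw : w q = 0) (h : w ⬝ᵥ v = 0) :
    T v w = ⁅T v (Pi.single q 1), T (Pi.single q 1) w⁆ := by
  rw [commutatorElement_def, eq_mul_inv_iff_mul_eq, eq_mul_inv_iff_mul_eq]
  ext1
  simp only [Units.val_mul]
  rw [T_val h, T_val (by simp [hv, hw]), T_val (by simp [hv, hw])]
  simp [add_mul, mul_add, vecMulVec_mul_vecMulVec, h, hv, hw]
  abel

/-- conjugation of T -/
theorem conj_T (g : GL n K) {v w : n → K} (h : w ⬝ᵥ v = 0) :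
    g * T v w * g⁻¹ = T (g.val *ᵥ v) (w ᵥ* g⁻¹.val) := by
  ext1
  have h2 : (w ᵥ* g⁻¹.val) ⬝ᵥ (g.val *ᵥ v) = 0 := by
    rw [dotProduct_mulVec, vecMul_vecMul, ← Units.val_mul]; simp [h]
  rw [Units.val_mul, Units.val_mul, T_val h, T_val h2, mul_add, add_mul, mul_one,
    ← Units.val_mul, mul_inv_cancel, mul_vecMulVec, vecMulVec_mul, Units.val_one]

/-- split lemma -/
theorem split_lemma (I : Set K) (hsub : ∀ a ∈ I, ∀ b ∈ I, a - b ∈ I)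
    (e : K →+* K) (heI : ∀ a ∈ I, e a ∈ I) (hee : ∀ a, e (e a) = e a)
    {g : GL n K} (hg : g ∈ El n I) :
    g * (mp n e g)⁻¹ ∈ Subgroup.closure
      {y | ∃ γ ∈ (El n I).map (mp n e), ∃ i j : n, i ≠ j ∧ ∃ a ∈ I, e a = 0 ∧
        y = γ * x i j a * γ⁻¹} := by
  set C := Subgroup.closure
      {y | ∃ γ ∈ (El n I).map (mp n e), ∃ i j : n, i ≠ j ∧ ∃ a ∈ I, e a = 0 ∧
        y = γ * x i j a * γ⁻¹} with hC
  have conjC : ∀ γ ∈ (El n I).map (mp n e), ∀ y ∈ C, γ * y * γ⁻¹ ∈ C := by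
    intro γ hγ y hy
    induction hy using Subgroup.closure_induction with
    | mem y hy =>
      obtain ⟨γ', hγ', i, j, hij, a, ha, h0, rfl⟩ := hy
      apply Subgroup.subset_closure
      exact ⟨γ * γ', mul_mem hγ hγ', i, j, hij, a, ha, h0, by group⟩
    | one => simp [one_mem]
    | mul y z _ _ h1 h2 =>
      have : γ * (y * z) * γ⁻¹ = (γ * y * γ⁻¹) * (γ * z * γ⁻¹) := by group
      rw [this]; exact mul_mem h1 h2
    | inv y _ h1 =>
      have : γ * y⁻¹ * γ⁻¹ = (γ * y * γ⁻¹)⁻¹ := by group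
      rw [this]; exact inv_mem h1
  have main : El n I ≤ Subgroup.closure {g | ∃ i j : n, i ≠ j ∧ ∃ a ∈ I, g = x i j a} := le_rfl
  have key : ∀ g ∈ El n I, g * (mp n e g)⁻¹ ∈ C := by
    intro g hg
    induction hg using Subgroup.closure_induction with
    | mem y hy =>
      obtain ⟨i, j, hij, a, ha, rfl⟩ := hy
      rw [mp_x, ← x_neg, ← x_add]
      apply Subgroup.subset_closure
      exact ⟨1, one_mem _, i, j, hij, a + -e a, by rw [← sub_eq_add_neg]; exact hsub _ ha _ (heI _ ha),
        by simp [hee], by simp⟩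
    | one => simp [one_mem]
    | mul y z hy hz h1 h2 =>
      have : (y * z) * (mp n e (y * z))⁻¹ =
        (y * (mp n e y)⁻¹) * (mp n e y * (z * (mp n e z)⁻¹) * (mp n e y)⁻¹) := by
        rw [map_mul]; group
      rw [this]; exact mul_mem h1 (conjC _ ⟨y, hy, rfl⟩ _ h2)
    | inv y hy h1 =>
      have : y⁻¹ * (mp n e y⁻¹)⁻¹ =
        (mp n e y⁻¹ * (y * (mp n e y)⁻¹) * (mp n e y⁻¹)⁻¹)⁻¹ := by
        rw [map_inv]; group
      rw [this]; exact inv_mem (conjC _ ⟨y⁻¹, inv_mem hy, rfl⟩ _ h1)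
  exact key g hg

end basic
end CSB

namespace CSB
open Matrix
open scoped commutatorElement
set_option linter.all false

section L1
variable {n : Type*} [Fintype n] [DecidableEq n] {K : Type*} [CommRing K]

/-- elementary subgroup supported on a finite set of indices -/
def ElB (K : Type*) [CommRing K] (B : Finset n) : Subgroup (GL n K) :=
  Subgroup.closure {g | ∃ i j : n, i ≠ j ∧ i ∈ B ∧ j ∈ B ∧ ∃ a : K, g = x i j a}

theorem ElB_le (B : Finset n) : ElB K B ≤ El n (Set.univ : Set K) := by
  rw [ElB, Subgroup.closure_le]
  rintro _ ⟨i, j, hij, _, _, a, rfl⟩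
  exact x_mem i j (Set.mem_univ a)

theorem x_memB {B : Finset n} {i j : n} (hi : i ∈ B) (hj : j ∈ B) (a : K) : x i j a ∈ ElB K B := by
  by_cases h : i = j
  · subst h; rw [x_self]; exact one_mem _
  · exact Subgroup.subset_closure ⟨i, j, h, hi, hj, a, rfl⟩

/-- identity outside `B` -/
def Out (B : Finset n) (M : Matrix n n K) : Prop :=
  ∀ i j, (i ∉ B ∨ j ∉ B) → M i j = (1 : Matrix n n K) i j

theorem Out_mul {B : Finset n} {M N : Matrix n n K} (hM : Out B M) (hN : Out B N) :
    Out B (M * N) := by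
  rintro i j (h | h)
  · rw [mul_apply, Finset.sum_eq_single i]
    · rw [hM i i (Or.inl h), hN i j (Or.inl h)]; simp
    · intro k _ hk; rw [hM i k (Or.inl h), one_apply_ne hk.symm, zero_mul]
    · simp
  · rw [mul_apply, Finset.sum_eq_single j]
    · rw [hM i j (Or.inr h), hN j j (Or.inr h)]; simp
    · intro k _ hk; rw [hN k j (Or.inr h), one_apply_ne hk, mul_zero]
    · simp

theorem Out_ElB {B : Finset n} {g : GL n K} (hg : g ∈ ElB K B) : Out B g.val := by
  have hx : ∀ i j : n, i ≠ j → i ∈ B → j ∈ B → ∀ a : K, Out B (x i j a).val := by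
    intro i j hij hi hj a r c h
    rw [x_val hij, Matrix.add_apply, single_apply, if_neg, add_zero]
    rintro ⟨rfl, rfl⟩; tauto
  have : ∀ g ∈ ElB K B, Out B g.val ∧ Out B (g⁻¹).val := by
    intro g hg
    induction hg using Subgroup.closure_induction with
    | mem y hy =>
      obtain ⟨i, j, hij, hi, hj, a, rfl⟩ := hy
      exact ⟨hx _ _ hij hi hj a, by rw [← x_neg]; exact hx _ _ hij hi hj _⟩
    | one => simp [Out]
    | mul y z _ _ h1 h2 => 
      rw [_root_.mul_inv_rev]; simp only [Units.val_mul]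
      exact ⟨Out_mul h1.1 h2.1, Out_mul h2.2 h1.2⟩
    | inv y _ h1 => rw [inv_inv]; exact h1.symm
  exact (this g hg).1

theorem x_mulVec {i j : n} (h : i ≠ j) (a : K) (v : n → K) (r : n) :
    ((x i j a).val *ᵥ v) r = v r + if r = i then a * v j else 0 := by
  rw [x_val h, add_mulVec, one_mulVec, Pi.add_apply]
  congr 1
  by_cases hr : r = i
  · subst hr; simp [mulVec, dotProduct, single_apply]
  · simp [mulVec, dotProduct, single_apply, hr, Ne.symm hr]

/-- unimodular vectors supported on B can be transformed to have a unit entry -/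
def ColRed (n : Type*) [Fintype n] [DecidableEq n] (K : Type*) [CommRing K] : Prop :=
  ∀ (B : Finset n) (v : n → K), B.Nonempty → (∃ w : n → K, ∑ i ∈ B, w i * v i = 1) →
    ∃ e ∈ ElB K B, ∃ i ∈ B, IsUnit ((e.val *ᵥ v) i)

theorem col_unit {B : Finset n} {v : n → K} {i p : n} (hi : i ∈ B) (hp : p ∈ B) (hip : i ≠ p)
    (hu : IsUnit (v i)) : ∃ e ∈ ElB K B, (e.val *ᵥ v) p = 1 := by
  obtain ⟨u, hu⟩ := hu
  refine ⟨x p i ((1 - v p) * (u⁻¹ : Kˣ)), x_memB hp hi _, ?_⟩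
  rw [x_mulVec hip.symm]; simp [← hu]

theorem col_clear {B : Finset n} {v : n → K} {p : n} (hp : p ∈ B) (hv : v p = 1) :
    ∃ e ∈ ElB K B, (e.val *ᵥ v) p = 1 ∧ ∀ i ∈ B, i ≠ p → (e.val *ᵥ v) i = 0 := by
  set w : n → K := fun i => if i ∈ B ∧ i ≠ p then - v i else 0 with hw
  refine ⟨T w (Pi.single p 1), ?_, ?_⟩
  · apply T_col_mem (by simp [hw])
    intro i hi
    by_cases h : i ∈ B
    · exact x_memB h hp _
    · simp [hw, h, x_zero, one_mem]
  · rw [T_val (by simp [hw])]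
    have : ∀ i, ((1 + vecMulVec w (Pi.single p 1)) *ᵥ v) i = v i + w i := by
      intro i
      simp [add_mulVec, vecMulVec_mulVec, hv]
    simp only [this]
    exact ⟨by simp [hw, hv], fun i hi hip => by simp [hw, hi, hip]⟩

theorem col_full (hK : ColRed n K) {B : Finset n} {p : n} (hp : p ∈ B) (hB : ∃ q ∈ B, q ≠ p)
    {v : n → K} (hv : ∃ w : n → K, ∑ i ∈ B, w i * v i = 1) :
    ∃ e ∈ ElB K B, (e.val *ᵥ v) p = 1 ∧ ∀ i ∈ B, i ≠ p → (e.val *ᵥ v) i = 0 := by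
  obtain ⟨e, he, i, hi, hu⟩ := hK B v ⟨p, hp⟩ hv
  have h2 : ∃ e ∈ ElB K B, (e.val *ᵥ v) p = 1 := by
    by_cases hip : i = p
    · subst hip
      obtain ⟨q, hq, hqi⟩ := hB
      obtain ⟨e', he', h⟩ := col_unit hp hq hqi.symm hu
      obtain ⟨e'', he'', h'⟩ := col_unit (v := e'.val *ᵥ e.val *ᵥ v) hq hp hqi (by rw [h]; exact isUnit_one)
      refine ⟨e'' * e' * e, mul_mem (mul_mem he'' he') he, ?_⟩
      simpa [mul_assoc] using h'
    · obtain ⟨e', he', h⟩ := col_unit hi hp hip hu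
      refine ⟨e' * e, mul_mem he' he, ?_⟩
      simpa [mul_assoc] using h
  obtain ⟨e, he, h⟩ := h2
  obtain ⟨e', he', h'⟩ := col_clear hp h
  refine ⟨e' * e, mul_mem he' he, ?_⟩
  simpa [mul_assoc] using h'

/-- `SL_n(K) = E_n(K)` -/
def SLE (n : Type*) [Fintype n] [DecidableEq n] (K : Type*) [CommRing K] : Prop :=
  ∀ g : GL n K, g.val.det = 1 → g ∈ El n (Set.univ : Set K)

theorem sle_of_colRed (hK : ColRed n K) : SLE n K := by
  have main : ∀ (B : Finset n) (g : GL n K), Out B g.val → g.val.det = 1 →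
      g ∈ El n (Set.univ : Set K) := by
    intro B
    induction B using Finset.strongInduction with
    | H B ih =>
    intro g hg hdet
    rcases B.eq_empty_or_nonempty with rfl | ⟨p, hp⟩
    · have : g = 1 := by
        ext i j; exact hg i j (by simp)
      rw [this]; exact one_mem _
    by_cases hB : ∃ q ∈ B, q ≠ p
    · have hv : ∃ w : n → K, ∑ i ∈ B, w i * g.val i p = 1 := by
        refine ⟨fun i => g⁻¹.val p i, ?_⟩
        have : (g⁻¹ * g).val p p = 1 := by simp
        rw [Units.val_mul, mul_apply] at this
        rw [← this]
        apply Finset.sum_subset (Finset.subset_univ _)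
        intro i _ hi
        rw [hg i p (Or.inl hi), one_apply_ne, mul_zero]
        rintro rfl; exact hi hp
      obtain ⟨e, he, h1, h2⟩ := col_full hK hp hB (v := fun i => g.val i p) hv
      have hcol : ∀ i, (e.val *ᵥ fun i => g.val i p) i = (e * g).val i p := by
        intro i; rw [Units.val_mul, mul_apply]; rfl
      simp only [hcol] at h1 h2
      have hout : Out B (e * g).val := by
        rw [Units.val_mul]; exact Out_mul (Out_ElB he) hg
      set g' := e * g with hg'
      have hcolp : ∀ i, g'.val i p = if i = p then 1 else 0 := by
        intro i
        by_cases hi : i ∈ B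
        · split_ifs with hip
          · rw [hip, h1]
          · exact h2 i hi hip
        · rw [hout i p (Or.inl hi), one_apply]
      set w : n → K := fun j => if j = p then 0 else - g'.val p j with hw
      have hy : T (Pi.single p 1) w ∈ El n (Set.univ : Set K) :=
        T_row_mem (by simp [hw]) _ fun i _ => x_mem _ _ (Set.mem_univ _)
      have hgy : ∀ i j, (g' * T (Pi.single p 1) w).val i j =
          g'.val i j + (if i = p then 1 else 0) * w j := by
        intro i j
        rw [Units.val_mul, T_val (by simp [hw]), mul_add, mul_one, mul_vecMulVec, Matrix.add_apply,
          vecMulVec_apply]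
        congr 2
        rw [mulVec_single_one]; exact hcolp i
      have h3 := ih (B.erase p) (Finset.erase_ssubset hp) (g' * T (Pi.single p 1) w) ?_ ?_
      · have : g = e⁻¹ * (g' * T (Pi.single p 1) w) * (T (Pi.single p 1) w)⁻¹ := by
          rw [hg']; group
        rw [this]
        exact mul_mem (mul_mem (inv_mem (ElB_le _ he)) h3) (inv_mem hy)
      · intro i j hij
        rw [hgy]
        by_cases hip : i = p
        · subst hip
          by_cases hj : j = i
          · subst hj; simp [hw, hcolp]
          · simp [hw, hj, Ne.symm hj]
        · by_cases hj : j = p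
          · subst hj; simp [hcolp, hip]
          · simp [hip]
            apply hout
            simp [hip, hj] at hij
            tauto
      · rw [Units.val_mul, det_mul, El_det hy, mul_one, hg', Units.val_mul, det_mul, hdet,
          El_det (ElB_le _ he), mul_one]
    · push Not at hB
      have hBp : B = {p} := by
        ext q; constructor
        · intro hq; simp [hB q hq]
        · intro hq; rw [Finset.mem_singleton.1 hq]; exact hp
      have hd : g.val = diagonal (fun i => if i = p then g.val p p else 1) := by
        ext i j
        by_cases h : i = p ∧ j = p
        · obtain ⟨rfl, rfl⟩ := h; simp
        · rw [hg i j (by rw [hBp]; simp; tauto)]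
          simp [diagonal_apply, one_apply]
          grind
      have : g = 1 := by
        have h1 : g.val p p = 1 := by
          rw [hd, det_diagonal, Finset.prod_ite_eq'] at hdet
          simpa using hdet
        ext1; rw [hd, h1]; simp
      rw [this]; exact one_mem _
  intro g hg
  exact main Finset.univ g (by intro i j h; simp at h) hg

theorem colRed_local [IsLocalRing K] : ColRed n K := by
  intro B v _ ⟨w, hw⟩
  refine ⟨1, one_mem _, ?_⟩
  by_contra hcon
  push Not at hcon
  have : ∑ i ∈ B, w i * v i ∈ IsLocalRing.maximalIdeal K := by
    apply Ideal.sum_mem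
    intro i hi
    apply Ideal.mul_mem_left
    have := hcon i hi
    simpa using this
  rw [hw] at this
  exact (Ideal.ne_top_iff_one _).1 (IsLocalRing.maximalIdeal.isMaximal K).ne_top this

theorem sle_local [IsLocalRing K] : SLE n K := sle_of_colRed colRed_local

/-- reachability of pairs by elementary operations -/
inductive PRed : K → K → Prop
  | zero (c : K) : PRed c 0
  | left (a b r : K) : PRed (a + r * b) b → PRed a b
  | right (a b r : K) : PRed a (b + r * a) → PRed a b

/-- pairs are reducible -/
def PRing (K : Type*) [CommRing K] : Prop := ∀ a b : K, PRed a b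

theorem pred_vec {a b : K} (h : PRed a b) {B : Finset n} {p q : n} (hp : p ∈ B) (hq : q ∈ B)
    (hpq : p ≠ q) (v : n → K) (hvp : v p = a) (hvq : v q = b) :
    ∃ e ∈ ElB K B, (e.val *ᵥ v) q = 0 ∧ ∀ i, i ≠ p → i ≠ q → (e.val *ᵥ v) i = v i := by
  induction h generalizing v with
  | zero c => exact ⟨1, one_mem _, by simp [hvq], by simp⟩
  | left a b r _ ih =>
    obtain ⟨e, he, h1, h2⟩ := ih ((x p q r).val *ᵥ v) (by simp [x_mulVec hpq, hvp, hvq])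
      (by simp [x_mulVec hpq, hpq.symm, hvq])
    refine ⟨e * x p q r, mul_mem he (x_memB hp hq r), by simpa using h1, ?_⟩
    intro i hi hi'
    have := h2 i hi hi'
    rw [x_mulVec hpq] at this
    simpa [hi] using this
  | right a b r _ ih =>
    obtain ⟨e, he, h1, h2⟩ := ih ((x q p r).val *ᵥ v) (by simp [x_mulVec hpq.symm, hvp, hpq])
      (by simp [x_mulVec hpq.symm, hvq, hvp])
    refine ⟨e * x q p r, mul_mem he (x_memB hq hp r), by simpa using h1, ?_⟩
    intro i hi hi'
    have := h2 i hi hi'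
    rw [x_mulVec hpq.symm] at this
    simpa [hi'] using this

theorem colRed_PRing (hP : PRing K) : ColRed n K := by
  intro B v ⟨p, hp⟩ hw
  · have key : ∀ C : Finset n, C ⊆ B.erase p → ∃ e ∈ ElB K B, ∀ i ∈ C, (e.val *ᵥ v) i = 0 := by
      intro C
      induction C using Finset.induction_on with
      | empty => intro _; exact ⟨1, one_mem _, by simp⟩
      | insert q C hq ih =>
        intro hC
        obtain ⟨e, he, h⟩ := ih (fun i hi => hC (by simp [hi]))
        have hqB := hC (Finset.mem_insert_self q C)
        rw [Finset.mem_erase] at hqB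
        obtain ⟨e', he', h1, h2⟩ := pred_vec (hP _ _) hp hqB.2 hqB.1.symm (e.val *ᵥ v) rfl rfl
        refine ⟨e' * e, mul_mem he' he, ?_⟩
        intro i hi
        rw [Finset.mem_insert] at hi
        rw [Units.val_mul, ← mulVec_mulVec]
        by_cases hiq : i = q
        · rw [hiq, h1]
        · have hi := hi.resolve_left hiq
          have := hC (Finset.mem_insert_of_mem hi)
          rw [Finset.mem_erase] at this
          rw [h2 i this.1 hiq, h i hi]
    obtain ⟨e, he, h⟩ := key _ subset_rfl
    refine ⟨e, he, p, hp, ?_⟩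
    obtain ⟨w, hw⟩ := hw
    set w' : n → K := fun i => if i ∈ B then w i else 0
    have h1 : (w' ᵥ* e⁻¹.val) ⬝ᵥ (e.val *ᵥ v) = 1 := by
      rw [dotProduct_mulVec, vecMul_vecMul, ← Units.val_mul]
      simp [dotProduct, w', hw]
    have hout := Out_ElB he
    have houti := Out_ElB (inv_mem he)
    rw [dotProduct, Finset.sum_eq_single p] at h1
    · exact IsUnit.of_mul_eq_one _ (by rw [mul_comm]; exact h1)
    · intro i _ hip
      by_cases hi : i ∈ B
      · rw [h i (by simp [hi, hip]), mul_zero]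
      · have : (w' ᵥ* e⁻¹.val) i = 0 := by
          rw [vecMul, dotProduct]
          apply Finset.sum_eq_zero
          intro j _
          rw [houti j i (Or.inr hi), one_apply]
          split_ifs with hji
          · simp [w', hji, hi]
          · simp
        rw [this, zero_mul]
    · simp

theorem sle_PRing (hP : PRing K) : SLE n K := sle_of_colRed (colRed_PRing hP)

theorem PRing_int : PRing ℤ := by
  have : ∀ N : ℕ, ∀ a b : ℤ, b.natAbs = N → PRed a b := by
    intro N
    induction N using Nat.strong_induction_on with
    | _ N ih =>
    intro a b hb
    by_cases h0 : b = 0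
    · subst h0; exact PRed.zero a
    have hlt : (-(a % b)).natAbs < N := by
      have h1 := Int.emod_nonneg a h0
      have h2 := Int.emod_lt_abs a h0
      rw [Int.abs_eq_natAbs] at h2
      omega
    have h := ih _ hlt b _ rfl
    apply PRed.left a b (-(a / b))
    have e : a + -(a / b) * b = a % b := by
      have := Int.emod_add_mul_ediv a b
      linarith
    rw [e]
    apply PRed.left _ _ 1
    apply PRed.right _ _ (-1)
    apply PRed.left _ _ 1
    convert h using 1 <;> ring
  intro a b
  exact this _ a b rfl

end L1
end CSB

namespace CSB
open Matrix
open scoped commutatorElement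
set_option linter.all false

section C
variable {n : Type*} [Fintype n] [DecidableEq n] {A : Type*} [CommRing A]

theorem T_two_mem [Has3 n] {v w : n → A} (h : w ⬝ᵥ v = 0) {k l : n} (hkl : k ≠ l)
    (hw : ∀ i, i ≠ k → i ≠ l → w i = 0) : T v w ∈ El n (Set.univ : Set A) := by
  set v1 : n → A := fun i => if i = k ∨ i = l then v i else 0 with hv1
  set v2 : n → A := fun i => if i = k ∨ i = l then 0 else v i with hv2
  have hv : v = v1 + v2 := by
    ext i; simp [hv1, hv2]; split_ifs <;> simp
  have hww : w = Pi.single k (w k) + Pi.single l (w l) := by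
    ext i
    by_cases h1 : i = k
    · subst h1; simp [hkl]
    · by_cases h2 : i = l
      · subst h2; simp [h1]
      · simp [h1, h2, hw]
  have h2 : w ⬝ᵥ v2 = 0 := by
    rw [hww]; simp [hv2, add_dotProduct]
  have h1 : w ⬝ᵥ v1 = 0 := by
    rw [hv, dotProduct_add, h2, add_zero] at h; exact h
  have key : ∀ m, v2 m = 0 → T v2 (Pi.single m (w m)) ∈ El n (Set.univ : Set A) := by
    intro m hm
    have : T v2 (Pi.single m (w m)) = T (w m • v2) (Pi.single m 1) := by
      ext1
      rw [T_val (by simp [hm]), T_val (by simp [hm])]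
      congr 1
      ext r c; simp [vecMulVec_apply, Pi.single_apply]; split_ifs <;> ring
    rw [this]
    exact T_col_mem (by simp [hm]) _ fun i _ => x_mem _ _ (Set.mem_univ _)
  rw [hv, T_add_left h1 h2]
  refine mul_mem ?_ ?_
  · obtain ⟨q, hqk, hql⟩ := Has3.third k l
    rw [T_comm (q := q) (by simp [hv1, hqk, hql]) (hw q hqk hql) h1, commutatorElement_def]
    have e1 := T_col_mem (v := v1) (q := q) (by simp [hv1, hqk, hql]) (El n (Set.univ : Set A))
      fun i _ => x_mem _ _ (Set.mem_univ _)
    have e2 := T_row_mem (w := w) (q := q) (hw q hqk hql) (El n (Set.univ : Set A))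
      fun i _ => x_mem _ _ (Set.mem_univ _)
    exact mul_mem (mul_mem (mul_mem e1 e2) (inv_mem e1)) (inv_mem e2)
  · rw [hww, T_add_right]
    · exact mul_mem (key k (by simp [hv2])) (key l (by simp [hv2]))
    · simp [hv2]
    · simp [hv2]

open Polynomial

/-- diagonal entries of `D` -/
def dg (p : n) (t : A) (i : n) : A := if i = p then t else 1

/-- The set of `g` such that `D⁻¹ g D` is elementary. -/
def DD (p : n) (t : A) : Subgroup (GL n A) where
  carrier := {g | ∃ g' ∈ El n (Set.univ : Set A),
    diagonal (dg p t) * g'.val = g.val * diagonal (dg p t)}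
  one_mem' := ⟨1, one_mem _, by simp⟩
  mul_mem' := by
    rintro a b ⟨a', ha, ha'⟩ ⟨b', hb, hb'⟩
    refine ⟨a' * b', mul_mem ha hb, ?_⟩
    rw [Units.val_mul, Units.val_mul, ← mul_assoc, ha', mul_assoc, hb', mul_assoc]
  inv_mem' := by
    rintro a ⟨a', ha, ha'⟩
    refine ⟨a'⁻¹, inv_mem ha, ?_⟩
    have : a.val * (diagonal (dg p t) * a'⁻¹.val) = a.val * (a⁻¹.val * diagonal (dg p t)) := by
      rw [← mul_assoc, ← ha', mul_assoc, ← mul_assoc a.val, ← Units.val_mul, ← Units.val_mul]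
      simp
    have := congrArg (fun M => a⁻¹.val * M) this
    simpa only [← mul_assoc, ← Units.val_mul, inv_mul_cancel, one_mul, Units.val_one] using this

theorem x_mem_DD {p : n} {t : A} {i j : n} (hij : i ≠ j) {c c' : A}
    (h : dg p t i * c' = c * dg p t j) : x i j c ∈ DD p t := by
  refine ⟨x i j c', x_mem _ _ (Set.mem_univ _), ?_⟩
  rw [x_val hij, x_val hij, mul_add, add_mul, mul_one, one_mul]
  congr 1
  ext r s
  simp only [diagonal_mul, mul_diagonal, single_apply]
  split_ifs with h1
  · obtain ⟨rfl, rfl⟩ := h1; exact h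
  · simp

theorem T_mem_DD [Has3 n] {p : n} {t : A} {v w : n → A} (h : w ⬝ᵥ v = 0) {k l : n} (hkl : k ≠ l)
    (hw : ∀ i, i ≠ k → i ≠ l → w i = 0) : T v (t • w) ∈ DD p t := by
  set v' : n → A := fun i => if i = p then v i else t * v i with hv'
  set w' : n → A := fun i => w i * dg p t i with hw'
  have hz : w' ⬝ᵥ v' = 0 := by
    have : w' ⬝ᵥ v' = t * (w ⬝ᵥ v) := by
      simp only [dotProduct, Finset.mul_sum]
      apply Finset.sum_congr rfl
      intro i _
      simp only [hv', hw', dg]; split_ifs <;> ring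
    rw [this, h, mul_zero]
  refine ⟨T v' w', T_two_mem hz hkl (fun i h1 h2 => by simp [hw', hw i h1 h2]), ?_⟩
  rw [T_val hz, T_val (by simp [h]), mul_add, add_mul, mul_one, one_mul]
  congr 1
  ext r s
  simp only [diagonal_mul, mul_diagonal, vecMulVec_apply, hv', hw', dg, Pi.smul_apply, smul_eq_mul]
  split_ifs <;> ring

theorem conj_mem_DD [Has3 n] {p : n} {t : A} (γ : GL n A) {i j : n} (hij : i ≠ j) (c : A) :
    γ * x i j (t * c) * γ⁻¹ ∈ DD p t := by
  rw [← T_single' hij, conj_T _ (by simp [hij.symm])]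
  set v := γ.val *ᵥ Pi.single i 1 with hv
  set w := (Pi.single j 1 : n → A) ᵥ* γ⁻¹.val with hw
  set z := (Pi.single i 1 : n → A) ᵥ* γ⁻¹.val with hz
  have hwv : w ⬝ᵥ v = 0 := by
    rw [hv, hw, dotProduct_mulVec, vecMul_vecMul, ← Units.val_mul]; simp [hij.symm]
  have hzv : z ⬝ᵥ v = 1 := by
    rw [hv, hz, dotProduct_mulVec, vecMul_vecMul, ← Units.val_mul]; simp
  have e1 : (Pi.single j (t * c) : n → A) ᵥ* γ⁻¹.val = t • (c • w) := by
    rw [hw, smul_smul, ← smul_vecMul]; congr 1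
    ext r; simp [Pi.single_apply]
  have e2 : (Pi.single j (t * c) : n → A) ᵥ* γ⁻¹.val = ∑ kl : n × n,
      t • ((c * z kl.1 * w kl.2) • (v kl.1 • (Pi.single kl.2 1 : n → A) - v kl.2 • Pi.single kl.1 1)) := by
    rw [e1]
    ext m
    simp only [Fintype.sum_prod_type, Finset.sum_apply, Pi.smul_apply, Pi.sub_apply, smul_eq_mul,
      Pi.single_apply, mul_ite, mul_one, mul_zero]
    have : ∀ a b : n, t * (c * z a * w b * ((if m = b then v a else 0) - if m = a then v b else 0)) =
      (if m = b then t * c * w m * (z a * v a) else 0) - (if m = a then t * c * z m * (w b * v b) else 0) := by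
      intro a b; split_ifs with h1 h2 h2 <;> subst_vars <;> ring
    simp only [this, Finset.sum_sub_distrib]
    have s1 : ∀ a, (∑ b, if m = b then t * c * w m * (z a * v a) else 0) = t * c * w m * (z a * v a) := by
      intro a; simp
    have s2 : (∑ a, ∑ b, if m = a then t * c * z m * (w b * v b) else 0) = t * c * z m * (w ⬝ᵥ v) := by
      rw [Finset.sum_comm]; simp [dotProduct, Finset.mul_sum]
    rw [s2, hwv]
    simp only [s1, ← Finset.mul_sum]
    have : ∑ a, z a * v a = 1 := hzv
    rw [this]; ring
  rw [e2]
  have hy : ∀ kl : n × n, ((c * z kl.1 * w kl.2) • (v kl.1 • (Pi.single kl.2 1 : n → A) - v kl.2 • Pi.single kl.1 1)) ⬝ᵥ v = 0 := by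
    intro kl
    simp [sub_dotProduct, mul_comm]
  apply T_sum_right
  · intro kl _
    rw [smul_dotProduct, hy, smul_zero]
  · intro kl _
    by_cases hkl : kl.1 = kl.2
    · rw [hkl]; simp [T_zero_right, one_mem]
    · exact T_mem_DD (hy kl) hkl (fun i h1 h2 => by simp [h1, h2])

theorem claimC [Has3 n] (hA : SLE n A) (p : n) {g : GL n A[X]} (hg : g ∈ El n (Set.univ : Set A[X]))
    (hrow : ∀ j, j ≠ p → (g.val p j).eval 0 = 0) :
    ∃ g' ∈ El n (Set.univ : Set A[X]),
      diagonal (dg p (X : A[X])) * g'.val = g.val * diagonal (dg p X) := by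
  change g ∈ DD p (X : A[X])
  set e : A[X] →+* A[X] := C.comp (evalRingHom 0) with he
  have h1 := split_lemma (n := n) Set.univ (fun _ _ _ _ => Set.mem_univ _) e
    (fun _ _ => Set.mem_univ _) (by intro a; simp [he]) hg
  have h2 : g * (mp n e g)⁻¹ ∈ DD p (X : A[X]) := by
    refine (Subgroup.closure_le _).2 ?_ h1
    rintro _ ⟨γ, _, i, j, hij, a, _, h0, rfl⟩
    have : a = X * a.divX := by
      have := a.X_mul_divX_add
      have h : a.coeff 0 = 0 := by
        simpa [he, coeff_zero_eq_eval_zero] using h0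
      rw [h] at this; simpa using this.symm
    rw [this]
    exact conj_mem_DD γ hij _
  suffices h3 : mp n e g ∈ DD p (X : A[X]) by
    have := mul_mem h2 h3
    simpa using this
  set h := mp n (evalRingHom (0 : A)) g with hh
  have hrow' : ∀ j, j ≠ p → h.val p j = 0 := by
    intro j hj; rw [hh, mp_val]; exact hrow j hj
  have hu : h.val p p * h⁻¹.val p p = 1 := by
    have : (h * h⁻¹).val p p = 1 := by simp
    rw [Units.val_mul, mul_apply, Finset.sum_eq_single p] at this
    · exact this
    · intro j _ hj; rw [hrow' j hj, zero_mul]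
    · simp
  set s : n → A := fun i => if i = p then 0 else - (h⁻¹.val p p * h.val i p) with hs
  have hTs : T s (Pi.single p 1) ∈ El n (Set.univ : Set A) :=
    T_col_mem (by simp [hs]) _ fun i _ => x_mem _ _ (Set.mem_univ _)
  set h' := T s (Pi.single p 1) * h with hh'
  have hdet : h.val.det = 1 := El_det (mp_memU _ hg)
  have hE : h' ∈ El n (Set.univ : Set A) := by
    apply hA
    rw [hh', Units.val_mul, det_mul, El_det hTs, hdet, one_mul]
  have hval : ∀ i j, h'.val i j = h.val i j + s i * h.val p j := by
    intro i j
    rw [hh', Units.val_mul, T_val (by simp [hs]), add_mul, one_mul, vecMulVec_mul, Matrix.add_apply,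
      vecMulVec_apply]
    simp
  have hoff : ∀ i j, (i = p ↔ j ≠ p) → h'.val i j = 0 := by
    intro i j hij
    rw [hval]
    by_cases hi : i = p
    · rw [hi, hrow' j (hij.1 hi)]; simp
    · have : j = p := by tauto
      subst this
      simp only [hs, if_neg hi]
      linear_combination (- h.val i j) * hu
  have hCE : mp n (C : A →+* A[X]) h' ∈ DD p (X : A[X]) := by
    refine ⟨mp n C h', mp_memU _ hE, ?_⟩
    ext1 i j
    rw [diagonal_mul, mul_diagonal, mp_val, map_apply]
    by_cases hij : (i = p ↔ j ≠ p)
    · rw [hoff i j hij]; simp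
    · have : (i = p ↔ j = p) := by tauto
      simp only [dg, this]; ring
  have hCT : mp n (C : A →+* A[X]) (T s (Pi.single p 1)) ∈ DD p (X : A[X]) := by
    have : T s (Pi.single p 1) ∈ (DD p (X : A[X])).comap (mp n C) := by
      apply T_col_mem (by simp [hs])
      intro i hi
      rw [Subgroup.mem_comap, mp_x]
      exact x_mem_DD (c' := C (s i) * X) hi (by simp [dg, hi])
    exact this
  have : mp n e g = (mp n C (T s (Pi.single p 1)))⁻¹ * mp n C h' := by
    rw [hh', map_mul, he, ← mp_comp]; simp [hh]
  rw [this]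
  exact mul_mem (inv_mem hCT) hCE

/-- transpose -/
def tr (g : GL n A) : GL n A := ⟨g.valᵀ, g⁻¹.valᵀ, by
  rw [← transpose_mul, ← Units.val_mul]; simp, by
  rw [← transpose_mul, ← Units.val_mul]; simp⟩

theorem tr_val (g : GL n A) : (tr g).val = g.valᵀ := rfl
theorem tr_mul (g h : GL n A) : tr (g * h) = tr h * tr g := by
  ext1; simp [tr_val]
theorem tr_one : tr (1 : GL n A) = 1 := by ext1; simp [tr_val]
theorem tr_inv (g : GL n A) : tr g⁻¹ = (tr g)⁻¹ := by
  rw [eq_inv_iff_mul_eq_one, ← tr_mul]; simp [tr_one]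
theorem tr_tr (g : GL n A) : tr (tr g) = g := by ext1; simp [tr_val]
theorem tr_x (i j : n) (a : A) : tr (x i j a) = x j i a := by
  by_cases h : i = j
  · subst h; simp [x_self, tr_one]
  · ext1; rw [tr_val, x_val h, x_val (Ne.symm h)]; simp

theorem tr_mem {I : Set A} {g : GL n A} (hg : g ∈ El n I) : tr g ∈ El n I := by
  have : ∀ g ∈ El n I, tr g ∈ El n I := by
    intro g hg
    induction hg using Subgroup.closure_induction with
    | mem y hy =>
      obtain ⟨i, j, hij, a, ha, rfl⟩ := hy
      rw [tr_x]; exact x_mem _ _ ha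
    | one => rw [tr_one]; exact one_mem _
    | mul y z _ _ h1 h2 => rw [tr_mul]; exact mul_mem h2 h1
    | inv y _ h1 => rw [tr_inv]; exact inv_mem h1
  exact this g hg

theorem claimC' [Has3 n] (hA : SLE n A) (p : n) {g : GL n A[X]} (hg : g ∈ El n (Set.univ : Set A[X]))
    (hcol : ∀ j, j ≠ p → (g.val j p).eval 0 = 0) :
    ∃ g' ∈ El n (Set.univ : Set A[X]),
      g'.val * diagonal (dg p (X : A[X])) = diagonal (dg p X) * g.val := by
  obtain ⟨g', hg', h⟩ := claimC hA p (tr_mem hg) (fun j hj => hcol j hj)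
  refine ⟨tr g', tr_mem hg', ?_⟩
  have := congrArg transpose h
  simpa [tr_val] using this

end C
end CSB

namespace CSB
open Matrix Polynomial
open scoped commutatorElement
set_option linter.all false

section L3
variable {n : Type*} [Fintype n] [DecidableEq n] {A : Type*} [CommRing A]
variable {L : Type*} [CommRing L] (c : A →+* L) (t : Lˣ)

/-- `diag(t^{s_i})` -/
def tau (n : Type*) [Fintype n] [DecidableEq n] {L : Type*} [CommRing L] (t : Lˣ) (s : n → ℤ) :
    GL n L :=
  ⟨diagonal fun i => ((t ^ s i : Lˣ) : L), diagonal fun i => ((t ^ (- s i) : Lˣ) : L),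
    by rw [diagonal_mul_diagonal, ← diagonal_one]; congr; ext i; rw [← Units.val_mul, ← _root_.zpow_add]; simp,
    by rw [diagonal_mul_diagonal, ← diagonal_one]; congr; ext i; rw [← Units.val_mul, ← _root_.zpow_add]; simp⟩

theorem tau_val (s : n → ℤ) : (tau n t s).val = diagonal fun i => ((t ^ s i : Lˣ) : L) := rfl

theorem tau_add (s s' : n → ℤ) : tau n t (s + s') = tau n t s * tau n t s' := by
  ext1
  rw [Units.val_mul, tau_val, tau_val, tau_val, diagonal_mul_diagonal]
  congr; ext i; rw [← Units.val_mul, ← _root_.zpow_add]; rfl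

theorem tau_zero : tau n t 0 = 1 := by
  ext1; rw [tau_val]; simp

theorem tau_neg (s : n → ℤ) : tau n t (-s) = (tau n t s)⁻¹ := by
  rw [eq_inv_iff_mul_eq_one, ← tau_add]; simp [tau_zero]

theorem tau_x (s : n → ℤ) (i j : n) (a : L) :
    tau n t s * x i j a * (tau n t s)⁻¹ = x i j (((t ^ (s i - s j) : Lˣ) : L) * a) := by
  by_cases h : i = j
  · subst h; simp [x_self]
  rw [mul_inv_eq_iff_eq_mul]
  ext1
  rw [Units.val_mul, Units.val_mul, tau_val, x_val h, x_val h, mul_add, add_mul, mul_one, one_mul]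
  congr 1
  ext r d
  rw [diagonal_mul, mul_diagonal]
  simp only [single_apply]
  split_ifs with hh
  · obtain ⟨rfl, rfl⟩ := hh
    rw [mul_right_comm, ← Units.val_mul, ← _root_.zpow_add]; simp
  · simp

theorem tau_const (k : ℤ) (g : GL n L) : tau n t (fun _ => k) * g = g * tau n t (fun _ => k) := by
  ext i j
  rw [Units.val_mul, Units.val_mul, tau_val, diagonal_mul, mul_diagonal, mul_comm]

theorem tau_single_val (p : n) : (tau n t (Pi.single p 1)).val = diagonal (dg p (t : L)) := by
  rw [tau_val]; congr; ext i; simp only [dg, Pi.single_apply]; split_ifs <;> simp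

theorem tau_single_neg_val (p : n) :
    (tau n t (-Pi.single p 1)).val = diagonal (dg p ((t⁻¹ : Lˣ) : L)) := by
  rw [tau_val]; congr; ext i; simp only [dg, Pi.single_apply, Pi.neg_apply]; split_ifs <;> simp

/-- a property of exponent vectors closed under addition -/
theorem exp_induction (Q : (n → ℤ) → Prop) (h0 : Q 0) (hadd : ∀ s s', Q s → Q s' → Q (s + s'))
    (h1 : ∀ p, Q (Pi.single p 1)) (hc : Q (fun _ => -1)) (s : n → ℤ) : Q s := by
  have hsum : ∀ (B : Finset n) (f : n → n → ℤ), (∀ i ∈ B, Q (f i)) → Q (∑ i ∈ B, f i) := by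
    intro B f
    induction B using Finset.induction_on with
    | empty => intro _; simpa using h0
    | insert a B ha ih =>
      intro h; rw [Finset.sum_insert ha]
      exact hadd _ _ (h a (by simp)) (ih fun i hi => h i (by simp [hi]))
  have hneg : ∀ p, Q (-Pi.single p 1) := by
    intro p
    have : (-Pi.single p 1 : n → ℤ) = (fun _ => -1) + ∑ q ∈ Finset.univ.erase p, Pi.single q 1 := by
      have h2 : ∑ q, (Pi.single q 1 : n → ℤ) = fun _ => 1 := by
        ext i; simp [Finset.sum_apply, Pi.single_apply]
      rw [← Finset.add_sum_erase _ _ (Finset.mem_univ p)] at h2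
      rw [eq_sub_of_add_eq' h2]
      ext i; simp only [Pi.add_apply, Pi.sub_apply, Pi.neg_apply]; ring
    rw [this]
    exact hadd _ _ hc (hsum _ _ fun i _ => h1 i)
  have hmul : ∀ v : n → ℤ, Q v → ∀ k : ℕ, Q (k • v) := by
    intro v hv k
    induction k with
    | zero => simpa using h0
    | succ k ih => rw [succ_nsmul]; exact hadd _ _ ih hv
  rw [← Finset.univ_sum_single s]
  apply hsum
  intro i _
  obtain ⟨k, hk | hk⟩ := Int.eq_nat_or_neg (s i)
  · have := hmul _ (h1 i) k
    convert this using 1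
    ext j; simp [hk, Pi.single_apply]
  · have := hmul _ (hneg i) k
    convert this using 1
    ext j; simp [hk, Pi.single_apply]; split_ifs <;> simp

/-- the two evaluation maps -/
noncomputable def ip : A[X] →+* L := eval₂RingHom c t
noncomputable def im : A[X] →+* L := eval₂RingHom c ((t⁻¹ : Lˣ) : L)

theorem ip_C (g : GL n A) : mp n (ip c t) (mp n C g) = mp n c g := by
  rw [mp_comp]; congr 1; ext a; simp [ip]
theorem im_C (g : GL n A) : mp n (im c t) (mp n C g) = mp n c g := by
  rw [mp_comp]; congr 1; ext a; simp [im]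

theorem dg_map {A B : Type*} [CommRing A] [CommRing B] (f : A →+* B) (p : n) (a : A) :
    (diagonal (dg p a)).map f = diagonal (dg p (f a)) := by
  rw [diagonal_map (map_zero f)]; congr; ext i; simp only [dg, Function.comp]; split_ifs <;> simp

theorem ip_conj {p : n} {g g' : GL n A[X]}
    (h : diagonal (dg p (X : A[X])) * g'.val = g.val * diagonal (dg p X)) :
    tau n t (Pi.single p 1) * mp n (ip c t) g' = mp n (ip c t) g * tau n t (Pi.single p 1) := by
  ext1
  rw [Units.val_mul, Units.val_mul, tau_single_val, mp_val, mp_val]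
  have := congrArg (fun M => M.map (ip c t)) h
  simp only [Matrix.map_mul, dg_map] at this
  simpa [ip] using this

theorem im_conj {p : n} {g g' : GL n A[X]}
    (h : g'.val * diagonal (dg p (X : A[X])) = diagonal (dg p X) * g.val) :
    tau n t (Pi.single p 1) * mp n (im c t) g' = mp n (im c t) g * tau n t (Pi.single p 1) := by
  have : mp n (im c t) g' * tau n t (-Pi.single p 1) = tau n t (-Pi.single p 1) * mp n (im c t) g := by
    ext1
    rw [Units.val_mul, Units.val_mul, tau_single_neg_val, mp_val, mp_val]
    have := congrArg (fun M => M.map (im c t)) h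
    simp only [Matrix.map_mul, dg_map] at this
    simpa [im] using this
  rw [tau_neg, mul_inv_eq_iff_eq_mul] at this
  rw [this]; group

variable [IsLocalRing A]
open IsLocalRing

/-- elementary matrices over `A[X]` congruent to 1 -/
noncomputable def NP (n : Type*) [Fintype n] [DecidableEq n] (A : Type*) [CommRing A] [IsLocalRing A] :
    Subgroup (GL n A[X]) :=
  El n (Set.univ : Set A[X]) ⊓ (mp n (mapRingHom (residue A))).ker

theorem mem_NP {g : GL n A[X]} : g ∈ NP n A ↔ g ∈ El n (Set.univ : Set A[X]) ∧
    mp n (mapRingHom (residue A)) g = 1 := Iff.rfl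

theorem NP_conj {g γ : GL n A[X]} (hg : g ∈ NP n A) (hγ : γ ∈ El n (Set.univ : Set A[X])) :
    γ * g * γ⁻¹ ∈ NP n A := by
  refine mem_NP.2 ⟨mul_mem (mul_mem hγ (mem_NP.1 hg).1) (inv_mem hγ), ?_⟩
  have := (mem_NP.1 hg).2
  rw [map_mul, map_mul, this]; simp

theorem NP_x {i j : n} {a : A} (ha : a ∈ maximalIdeal A) : x i j (C a) ∈ NP n A := by
  refine mem_NP.2 ⟨x_mem _ _ (Set.mem_univ _), ?_⟩
  rw [mp_x]
  have : residue A a = 0 := (residue_eq_zero_iff a).2 ha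
  simp [this, x_zero]

theorem NP_coeff {g : GL n A[X]} (hg : g ∈ NP n A) (i j : n) :
    (g.val i j).map (residue A) = (1 : Matrix n n (ResidueField A)[X]) i j := by
  have := (mem_NP.1 hg).2
  have := congrArg (fun u : GL n _ => u.val i j) this
  simpa [mp_val] using this

theorem NP_eval0 {g : GL n A[X]} (hg : g ∈ NP n A) (i j : n) :
    residue A ((g.val i j).eval 0) = (1 : Matrix n n (ResidueField A)) i j := by
  have := congrArg (fun f => f.eval 0) (NP_coeff hg i j)
  simp only [eval_zero_map] at this
  rw [this]
  simp only [one_apply]; split_ifs <;> simp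

theorem NP_eval0_diag {g : GL n A[X]} (hg : g ∈ NP n A) (i : n) :
    IsUnit ((g.val i i).eval 0) := by
  have := NP_eval0 hg i i
  by_contra h
  have h2 : (g.val i i).eval 0 ∈ maximalIdeal A := h
  rw [(residue_eq_zero_iff _).2 h2] at this
  simp at this

theorem NP_eval0_off {g : GL n A[X]} (hg : g ∈ NP n A) {i j : n} (hij : i ≠ j) :
    ((g.val i j).eval 0) ∈ maximalIdeal A := by
  have := NP_eval0 hg i j
  rw [one_apply_ne hij] at this
  exact (residue_eq_zero_iff _).1 this

/-- congruence is preserved by conjugation with D -/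
theorem NP_D {p : n} {g g' : GL n A[X]} (hg : g ∈ NP n A) (hg' : g' ∈ El n (Set.univ : Set A[X]))
    (h : diagonal (dg p (X : A[X])) * g'.val = g.val * diagonal (dg p X)) : g' ∈ NP n A := by
  refine mem_NP.2 ⟨hg', ?_⟩
  have := (mem_NP.1 hg).2
  ext1
  rw [mp_val]
  have h2 := congrArg (fun M => M.map (mapRingHom (residue A))) h
  simp only [Matrix.map_mul, dg_map] at h2
  rw [← mp_val, ← mp_val, this] at h2
  rw [← mp_val]
  ext1 i j
  have h3 := congrFun (congrFun h2 i) j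
  simp only [Units.val_one, one_mul, diagonal_mul] at h3
  have hX : IsLeftCancelMulZero (ResidueField A)[X] := inferInstance
  have hne : dg p ((mapRingHom (residue A)) X) i ≠ 0 := by
    simp only [dg]; split_ifs <;> simp
  apply mul_left_cancel₀ hne
  rw [h3, Units.val_one, diagonal_apply, one_apply]
  split_ifs <;> simp

theorem NP_D' {p : n} {g g' : GL n A[X]} (hg : g ∈ NP n A) (hg' : g' ∈ El n (Set.univ : Set A[X]))
    (h : g'.val * diagonal (dg p (X : A[X])) = diagonal (dg p X) * g.val) : g' ∈ NP n A := by
  refine mem_NP.2 ⟨hg', ?_⟩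
  have := (mem_NP.1 hg).2
  ext1
  have h2 := congrArg (fun M => M.map (mapRingHom (residue A))) h
  simp only [Matrix.map_mul, dg_map] at h2
  rw [← mp_val, ← mp_val, this] at h2
  ext1 i j
  have h3 := congrFun (congrFun h2 i) j
  simp only [Units.val_one, mul_one, mul_diagonal] at h3
  have hne : dg p ((mapRingHom (residue A)) X) j ≠ 0 := by
    simp only [dg]; split_ifs <;> simp
  apply mul_right_cancel₀ hne
  rw [h3, Units.val_one, diagonal_apply, one_apply]
  split_ifs with h
  · subst h; simp
  · simp

/-- The set `P = N⁺N⁻` -/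
def PP (n : Type*) [Fintype n] [DecidableEq n] (c : A →+* L) (t : Lˣ) : Set (GL n L) :=
  {y | ∃ g ∈ NP n A, ∃ h ∈ NP n A, y = mp n (ip c t) g * mp n (im c t) h}

theorem PP_delta [Has3 n] (p : n) {y : GL n L} (hy : y ∈ PP n c t) :
    (tau n t (Pi.single p 1))⁻¹ * y * tau n t (Pi.single p 1) ∈ PP n c t := by
  obtain ⟨g, hg, h, hh, rfl⟩ := hy
  -- first correction
  obtain ⟨u, hu⟩ := NP_eval0_diag hh p
  set s : n → A := fun i => if i = p then 0 else - ((h.val i p).eval 0 * (u⁻¹ : Aˣ)) with hs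
  have hsm : ∀ i, s i ∈ maximalIdeal A := by
    intro i
    simp only [hs]; split_ifs with hip
    · exact zero_mem _
    · exact neg_mem (Ideal.mul_mem_right _ _ (NP_eval0_off hh hip))
  set U := mp n (C : A →+* A[X]) (T s (Pi.single p 1)) with hU
  have hUN : U ∈ NP n A := by
    have : T s (Pi.single p 1) ∈ (NP n A).comap (mp n C) := by
      apply T_col_mem (by simp [hs])
      intro i _
      rw [Subgroup.mem_comap, mp_x]; exact NP_x (hsm i)
    exact this
  have hUval : ∀ i j, (U * h).val i j = h.val i j + C (s i) * h.val p j := by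
    intro i j
    rw [hU, Units.val_mul, mp_val, T_val (by simp [hs]), Matrix.map_add _ (by simp), add_mul,
      Matrix.add_apply]
    congr 1
    · rw [Matrix.map_one _ (by simp) (by simp), one_mul]
    · rw [mul_apply, Finset.sum_eq_single p]
      · simp [vecMulVec_apply]
      · intro k _ hk; simp [vecMulVec_apply, hk]
      · simp
  have hcol : ∀ i, i ≠ p → ((U * h).val i p).eval 0 = 0 := by
    intro i hi
    rw [hUval]
    simp only [hs, if_neg hi, eval_add, eval_mul, eval_C, ← hu]
    rw [neg_mul, mul_assoc, Units.inv_mul]; ring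
  set g1 := g * U⁻¹ with hg1
  have hg1N : g1 ∈ NP n A := mul_mem hg (inv_mem hUN)
  obtain ⟨v, hv⟩ := NP_eval0_diag hg1N p
  set r : n → A := fun j => if j = p then 0 else - ((g1.val p j).eval 0 * (v⁻¹ : Aˣ)) with hr
  have hrm : ∀ i, r i ∈ maximalIdeal A := by
    intro i
    simp only [hr]; split_ifs with hip
    · exact zero_mem _
    · exact neg_mem (Ideal.mul_mem_right _ _ (NP_eval0_off hg1N (Ne.symm hip)))
  set W := mp n (C : A →+* A[X]) (T (Pi.single p 1) r) with hW
  have hWN : W ∈ NP n A := by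
    have : T (Pi.single p 1) r ∈ (NP n A).comap (mp n C) := by
      apply T_row_mem (by simp [hr])
      intro i _
      rw [Subgroup.mem_comap, mp_x]; exact NP_x (hrm i)
    exact this
  have hWval : ∀ i j, (g1 * W).val i j = g1.val i j + g1.val i p * C (r j) := by
    intro i j
    rw [hW, Units.val_mul, mp_val, T_val (by simp [hr]), Matrix.map_add _ (by simp), mul_add,
      Matrix.add_apply]
    congr 1
    · rw [Matrix.map_one _ (by simp) (by simp), mul_one]
    · rw [mul_apply, Finset.sum_eq_single p]
      · simp [vecMulVec_apply]
      · intro k _ hk; simp [vecMulVec_apply, hk]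
      · simp
  have hWval' : ∀ i j, i ≠ p → (W⁻¹ * (U * h)).val i j = (U * h).val i j := by
    intro i j hi
    rw [hW, ← map_inv, Units.val_mul, mp_val, T_inv_val (by simp [hr]), mul_apply,
      Finset.sum_eq_single i]
    · simp [vecMulVec_apply, hi]
    · intro k _ hk; simp [vecMulVec_apply, hi, hk.symm]
    · simp
  obtain ⟨g', hg', eg⟩ := claimC (sle_local (n := n) (K := A)) p (mul_mem hg1N hWN).1 (by
    intro j hj
    rw [hWval]
    simp only [hr, if_neg hj, eval_add, eval_mul, eval_C, ← hv]
    rw [mul_neg, mul_left_comm, Units.mul_inv]; ring)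
  obtain ⟨h', hh', eh⟩ := claimC' (sle_local (n := n) (K := A)) p
    (mul_mem (inv_mem hWN) (mul_mem hUN hh)).1 (by
    intro j hj
    rw [hWval' _ _ hj]; exact hcol j hj)
  refine ⟨g', NP_D (mul_mem hg1N hWN) hg' eg, h',
    NP_D' (mul_mem (inv_mem hWN) (mul_mem hUN hh)) hh' eh, ?_⟩
  have e1 := ip_conj c t eg
  have e2 := im_conj c t eh
  have hUU : mp n (ip c t) U = mp n (im c t) U := by rw [hU, ip_C, im_C]
  have hWW : mp n (ip c t) W = mp n (im c t) W := by rw [hW, ip_C, im_C]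
  have e3 : mp n (ip c t) g * mp n (im c t) h =
      mp n (ip c t) (g1 * W) * mp n (im c t) (W⁻¹ * (U * h)) := by
    simp only [hg1, map_mul, map_inv, hUU, hWW]; group
  rw [e3]
  rw [mul_assoc _ _ (tau n t _), mul_assoc _ _ (tau n t _), ← e2, ← mul_assoc (mp n (ip c t) _), ← e1]
  group

/-- conjugation invariance -/
def Inv (n : Type*) [Fintype n] [DecidableEq n] (c : A →+* L) (t : Lˣ) (γ : GL n L) : Prop :=
  ∀ y ∈ PP n c t, γ * y * γ⁻¹ ∈ PP n c t

theorem Inv_tau [Has3 n] (s : n → ℤ) : Inv n c t (tau n t s) := by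
  have : ∀ s : n → ℤ, Inv n c t (tau n t s)⁻¹ := by
    apply exp_induction
    · intro y hy; simpa [tau_zero] using hy
    · intro s s' h h' y hy
      have := h' _ (h y hy)
      rw [tau_add]
      simpa [mul_assoc] using this
    · intro p y hy
      have := PP_delta c t p hy
      simpa using this
    · intro y hy
      rw [mul_assoc, inv_inv, ← tau_const]
      simpa using hy
  have := this (-s)
  rwa [tau_neg, inv_inv] at this

theorem Inv_El {γ : GL n A} (hγ : γ ∈ El n (Set.univ : Set A)) : Inv n c t (mp n c γ) := by
  rintro _ ⟨g, hg, h, hh, rfl⟩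
  have hC := mp_memU (C : A →+* A[X]) hγ
  refine ⟨_, NP_conj hg hC, _, NP_conj hh hC, ?_⟩
  simp only [map_mul, map_inv, ip_C, im_C]
  group

/-- the big group -/
def Gt (n : Type*) [Fintype n] [DecidableEq n] (c : A →+* L) (t : Lˣ) : Subgroup (GL n L) :=
  Subgroup.closure ({y | ∃ γ ∈ El n (Set.univ : Set A), y = mp n c γ} ∪ Set.range (tau n t))

theorem Inv_Gt [Has3 n] {γ : GL n L} (hγ : γ ∈ Gt n c t) : Inv n c t γ := by
  have : ∀ γ ∈ Gt n c t, Inv n c t γ ∧ Inv n c t γ⁻¹ := by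
    intro γ hγ
    induction hγ using Subgroup.closure_induction with
    | mem y hy =>
      rcases hy with ⟨γ, hγ, rfl⟩ | ⟨s, rfl⟩
      · exact ⟨Inv_El c t hγ, by rw [← map_inv]; exact Inv_El c t (inv_mem hγ)⟩
      · exact ⟨Inv_tau c t s, by rw [← tau_neg]; exact Inv_tau c t _⟩
    | one => exact ⟨fun y hy => by simpa using hy, fun y hy => by simpa using hy⟩
    | mul y z _ _ h1 h2 =>
      constructor
      · intro w hw
        simpa [mul_assoc] using h1.1 _ (h2.1 w hw)
      · intro w hw
        simpa [mul_assoc] using h2.2 _ (h1.2 w hw)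
    | inv y _ h => exact ⟨h.2, by rw [inv_inv]; exact h.1⟩
  exact (this γ hγ).1

/-- the normal subgroup `N` -/
def NN (n : Type*) [Fintype n] [DecidableEq n] (c : A →+* L) (t : Lˣ) : Subgroup (GL n L) :=
  Subgroup.closure {y | ∃ γ ∈ Gt n c t, ∃ i j : n, ∃ a ∈ maximalIdeal A,
    y = γ * x i j (c a) * γ⁻¹}

theorem NN_conj {γ : GL n L} (hγ : γ ∈ Gt n c t) {y : GL n L} (hy : y ∈ NN n c t) :
    γ * y * γ⁻¹ ∈ NN n c t := by
  have : NN n c t ≤ (NN n c t).comap (MulAut.conj γ).toMonoidHom := by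
    conv_lhs => rw [NN]
    rw [Subgroup.closure_le]
    rintro _ ⟨γ', hγ', i, j, a, ha, rfl⟩
    apply Subgroup.subset_closure
    refine ⟨γ * γ', mul_mem hγ hγ', i, j, a, ha, ?_⟩
    simp [mul_assoc]
  exact this hy

theorem NN_x {i j : n} {a : A} (ha : a ∈ maximalIdeal A) : x i j (c a) ∈ NN n c t :=
  Subgroup.subset_closure ⟨1, one_mem _, i, j, a, ha, by simp⟩

theorem NN_le_PP [Has3 n] {y : GL n L} (hy : y ∈ NN n c t) : y ∈ PP n c t := by
  have gen : ∀ γ ∈ Gt n c t, ∀ (i j : n), ∀ a ∈ maximalIdeal A, ∀ y ∈ PP n c t,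
      γ * x i j (c a) * γ⁻¹ * y ∈ PP n c t := by
    intro γ hγ i j a ha y hy
    have h1 := Inv_Gt c t (inv_mem hγ) y hy
    have h2 : x i j (c a) * (γ⁻¹ * y * γ⁻¹⁻¹) ∈ PP n c t := by
      obtain ⟨g, hg, h, hh, e⟩ := h1
      refine ⟨x i j (C a) * g, mul_mem (NP_x ha) hg, h, hh, ?_⟩
      rw [e, map_mul, mp_x, mul_assoc]; simp [ip]
    have h3 := Inv_Gt c t hγ _ h2
    convert h3 using 1; group
  have : ∀ y ∈ NN n c t, ∀ z ∈ PP n c t, y * z ∈ PP n c t ∧ y⁻¹ * z ∈ PP n c t := by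
    intro y hy
    induction hy using Subgroup.closure_induction with
    | mem y hy =>
      obtain ⟨γ, hγ, i, j, a, ha, rfl⟩ := hy
      intro z hz
      refine ⟨gen γ hγ i j a ha z hz, ?_⟩
      convert gen γ hγ i j (-a) (neg_mem ha) z hz using 1
      rw [map_neg, x_neg]; group
    | one => intro z hz; simpa using hz
    | mul y y' _ _ h1 h2 =>
      intro z hz
      refine ⟨?_, ?_⟩
      · rw [mul_assoc]; exact (h1 _ (h2 z hz).1).1
      · rw [_root_.mul_inv_rev, mul_assoc]; exact (h2 _ (h1 z hz).2).2
    | inv y _ h => intro z hz; rw [inv_inv]; exact (h z hz).symm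
  have h1 : (1 : GL n L) ∈ PP n c t := ⟨1, one_mem _, 1, one_mem _, by simp⟩
  simpa using (this y hy 1 h1).1

end L3
end CSB

namespace CSB
open Matrix Polynomial
open scoped commutatorElement
set_option linter.all false

section L4
variable {n : Type*} [Fintype n] [DecidableEq n] {A : Type*} [CommRing A]
variable {L : Type*} [CommRing L] (c : A →+* L) (t : Lˣ)
variable [IsLocalRing A]
open IsLocalRing

theorem mem_Gt_El {γ : GL n A} (h : γ ∈ El n (Set.univ : Set A)) : mp n c γ ∈ Gt n c t :=
  Subgroup.subset_closure (Or.inl ⟨γ, h, rfl⟩)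
theorem mem_Gt_tau (s : n → ℤ) : tau n t s ∈ Gt n c t :=
  Subgroup.subset_closure (Or.inr ⟨s, rfl⟩)

/-- The big set. -/
def Om (n : Type*) [Fintype n] [DecidableEq n] (c : A →+* L) (t : Lˣ) : Set (GL n L) :=
  {y | ∃ a ∈ El n (Set.univ : Set A[X]), ∃ s : n → ℤ, ∃ η ∈ NN n c t,
    ∃ b ∈ El n (Set.univ : Set A[X]), y = mp n (ip c t) a * tau n t s * η * mp n (im c t) b}

theorem Om_El {γ : GL n A} (h : γ ∈ El n (Set.univ : Set A)) {y : GL n L} (hy : y ∈ Om n c t) :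
    y * mp n c γ ∈ Om n c t := by
  obtain ⟨a, ha, s, η, hη, b, hb, rfl⟩ := hy
  refine ⟨a, ha, s, η, hη, b * mp n C γ, mul_mem hb (mp_memU _ h), ?_⟩
  rw [map_mul, im_C]; group

/-- signed swap -/
theorem exists_swap (r p : n) : ∃ w ∈ El n (Set.univ : Set A), (∀ v : n → A, (∀ i, i ≠ r → v i = 0) →
    ∀ i, i ≠ p → (w.val *ᵥ v) i = 0) ∧
    tau n t (Pi.single r 1) * (mp n c w)⁻¹ = (mp n c w)⁻¹ * tau n t (Pi.single p 1) := by
  by_cases h : r = p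
  · subst h
    exact ⟨1, one_mem _, by intro v hv i hi; simpa using hv i hi, by simp⟩
  · refine ⟨x p r 1 * x r p (-1) * x p r 1, mul_mem (mul_mem (x_mem _ _ (Set.mem_univ _))
      (x_mem _ _ (Set.mem_univ _))) (x_mem _ _ (Set.mem_univ _)), ?_, ?_⟩
    · intro v hv i hi
      rw [Units.val_mul, Units.val_mul, ← mulVec_mulVec, ← mulVec_mulVec]
      simp only [x_mulVec h, x_mulVec (Ne.symm h), hv p (Ne.symm h), if_neg hi]
      by_cases hir : i = r
      · subst hir; simp [hi, h, Ne.symm h, hv p (Ne.symm h)]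
      · simp [hir, hi, h, Ne.symm h, hv i hir]
    · set δr := tau n t (Pi.single r 1) with hr
      set δp := tau n t (Pi.single p 1) with hp
      suffices hh : mp n c (x p r 1 * x r p (-1) * x p r 1) * δr =
          δp * mp n c (x p r 1 * x r p (-1) * x p r 1) by
        rw [eq_inv_mul_iff_mul_eq, ← mul_assoc, hh]; group
      simp only [map_mul, mp_x, map_one, map_neg]
      -- explicit matrix
      have hw : (x p r (1 : L) * x r p (-1) * x p r 1).val =
          1 + single p r 1 - single r p 1 - single p p 1 - single r r 1 := by
        simp only [Units.val_mul, x_val h, x_val (Ne.symm h)]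
        have hn : (single r p (-1) : Matrix n n L) = - single r p 1 := by
          ext i j; simp [single_apply]; split_ifs <;> simp
        rw [hn]
        simp only [add_mul, mul_add, mul_one, one_mul, mul_neg, neg_mul, single_mul_single_same,
          single_mul_single_of_ne _ _ _ _ h, single_mul_single_of_ne _ _ _ _ (Ne.symm h), zero_mul]
        abel
      generalize x p r (1 : L) * x r p (-1) * x p r 1 = W at hw ⊢
      ext i j
      rw [Units.val_mul, Units.val_mul, hr, hp, tau_single_val, tau_single_val, mul_diagonal,
        diagonal_mul, hw]
      simp only [Matrix.add_apply, Matrix.sub_apply, one_apply, single_apply, dg]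
      by_cases h1 : i = p
      · subst h1
        by_cases h3 : j = r
        · subst h3; simp [h, Ne.symm h]
        · by_cases h4 : i = j
          · subst h4; simp [h, Ne.symm h]
          · simp [h, Ne.symm h, h3, h4, Ne.symm h3]
      · by_cases h2 : i = r
        · subst h2
          by_cases h3 : j = i
          · subst h3; simp [h, Ne.symm h]
          · by_cases h4 : p = j
            · subst h4; simp [h, Ne.symm h]
            · simp [h, Ne.symm h, h3, h4, Ne.symm h3, Ne.symm h4]
        · by_cases h3 : i = j
          · subst h3; simp [h1, h2, Ne.symm h1, Ne.symm h2]
          · simp [h1, h2, Ne.symm h1, Ne.symm h2, h3]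

theorem Om_delta [Has3 n] (p : n) {y : GL n L} (hy : y ∈ Om n c t) :
    y * tau n t (Pi.single p 1) ∈ Om n c t := by
  obtain ⟨a, ha, s, η, hη, h, hh, rfl⟩ := hy
  -- column
  set h0 := mp n (evalRingHom (0 : A)) h with hh0
  have hex : ∃ r, IsUnit (h0.val r p) := by
    by_contra hcon
    push Not at hcon
    have : (h0⁻¹ * h0).val p p = 1 := by simp
    rw [Units.val_mul, mul_apply] at this
    have h2 : ∑ j, h0⁻¹.val p j * h0.val j p ∈ maximalIdeal A :=
      Ideal.sum_mem _ fun j _ => Ideal.mul_mem_left _ _ (hcon j)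
    rw [this] at h2
    exact (Ideal.ne_top_iff_one _).1 (maximalIdeal.isMaximal A).ne_top h2
  obtain ⟨r, hr, hmin⟩ : ∃ r, IsUnit (h0.val r p) ∧ ∀ j, IsUnit (h0.val j p) → s r ≤ s j := by
    classical
    obtain ⟨r, hr, hm⟩ := (Finset.univ.filter fun r => IsUnit (h0.val r p)).exists_min_image s
      (by obtain ⟨r, hr⟩ := hex; exact ⟨r, by simp [hr]⟩)
    simp at hr hm
    exact ⟨r, hr, hm⟩
  obtain ⟨u, hu⟩ := hr
  set yv : n → A := fun j => if j = r then 0 else h0.val j p * (u⁻¹ : Aˣ) with hyv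
  set y1 : n → A := fun j => if s r ≤ s j then yv j else 0 with hy1
  set y2 : n → A := fun j => if s r ≤ s j then 0 else yv j with hy2
  have hy12 : yv = y1 + y2 := by
    ext j; simp only [hy1, hy2, Pi.add_apply]; split_ifs <;> simp
  have hyr : yv r = 0 := by simp [hyv]
  have hy1r : y1 r = 0 := by simp [hy1, hyr]
  have hy2r : y2 r = 0 := by simp [hy2]
  set Y := T yv (Pi.single r 1) with hY
  set Y1 := T y1 (Pi.single r 1) with hY1
  set Y2 := T y2 (Pi.single r 1) with hY2
  have hYY : Y = Y1 * Y2 := by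
    rw [hY, hy12, T_add_left (by simp [hy1r]) (by simp [hy2r])]
  have hYE : Y ∈ El n (Set.univ : Set A) := T_col_mem hyr _ fun i _ => x_mem _ _ (Set.mem_univ _)
  have hY1E : Y1 ∈ El n (Set.univ : Set A) := T_col_mem hy1r _ fun i _ => x_mem _ _ (Set.mem_univ _)
  have hY2N : mp n c Y2 ∈ NN n c t := by
    have : Y2 ∈ (NN n c t).comap (mp n c) := by
      apply T_col_mem hy2r
      intro i hi
      rw [Subgroup.mem_comap, mp_x]
      apply NN_x
      simp only [hy2, hyv, if_neg hi]
      split_ifs with hs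
      · exact zero_mem _
      · apply Ideal.mul_mem_right
        by_contra hcon
        exact hs (hmin i (by simpa using hcon))
    exact this
  have hY1p : ∃ q ∈ El n (Set.univ : Set A[X]),
      tau n t s * mp n c Y1 * (tau n t s)⁻¹ = mp n (ip c t) q := by
    have : Y1 ∈ ((((El n (Set.univ : Set A[X])).map (mp n (ip c t))).comap
        (MulAut.conj (tau n t s)).toMonoidHom).comap (mp n c)) := by
      apply T_col_mem hy1r
      intro i hi
      rw [Subgroup.mem_comap, Subgroup.mem_comap, mp_x]
      simp only [MulEquiv.toMonoidHom_eq_coe, MonoidHom.coe_coe, MulAut.conj_apply, tau_x]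
      simp only [hy1]
      split_ifs with hs
      · obtain ⟨k, hk⟩ := Int.le.dest hs
        refine ⟨x i r (X ^ k * C (yv i)), x_mem _ _ (Set.mem_univ _), ?_⟩
        rw [mp_x]
        have : s i - s r = k := by omega
        rw [this]; simp [ip]; rw [mul_comm]
      · simp [x_zero, one_mem]
    obtain ⟨q, hq, e⟩ := this
    exact ⟨q, hq, by simpa using e.symm⟩
  obtain ⟨q, hq, eq⟩ := hY1p
  obtain ⟨w, hw, hwcol, hwδ⟩ := exists_swap (A := A) c t r p
  set h2 := mp n C (w * Y⁻¹) * h with hh2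
  have hcol : ∀ i, i ≠ p → (h2.val i p).eval 0 = 0 := by
    intro i hi
    have e1 : (h2.val i p).eval 0 = (mp n (evalRingHom (0:A)) h2).val i p := rfl
    rw [e1, hh2, map_mul, mp_comp]
    have e2 : (evalRingHom (0:A)).comp C = RingHom.id A := by ext; simp
    have e3 : ∀ g : GL n A, mp n (RingHom.id A) g = g := fun g => by ext; rfl
    rw [e2, e3, ← hh0]
    have e4 : (w * Y⁻¹ * h0).val i p = (w.val *ᵥ (Y⁻¹.val *ᵥ fun j => h0.val j p)) i := by
      rw [mulVec_mulVec, ← Units.val_mul, Units.val_mul, mul_apply]; rfl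
    rw [e4]
    apply hwcol _ _ i hi
    intro j hj
    rw [hY, T_inv_val (by simp [hyr]), sub_mulVec, one_mulVec, vecMulVec_mulVec]
    simp [hyv, hj, ← hu]
    rw [mul_left_comm, Units.mul_inv, mul_one, sub_self]
  obtain ⟨h', hh', eh⟩ := claimC' (sle_local (n := n) (K := A)) p
    (mul_mem (mp_memU C (mul_mem hw (inv_mem hYE))) hh) hcol
  have e2 := im_conj c t eh
  -- assemble
  have hYG := mem_Gt_El c t hY1E
  have hδG := mem_Gt_tau (n := n) c t (Pi.single r 1)
  refine ⟨a * q, mul_mem ha hq, s + Pi.single r 1,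
    (tau n t (Pi.single r 1))⁻¹ * ((mp n c Y1)⁻¹ * η * (mp n c Y1)⁻¹⁻¹ * mp n c Y2) * (tau n t (Pi.single r 1))⁻¹⁻¹,
    NN_conj c t (inv_mem hδG) (mul_mem (NN_conj c t (inv_mem hYG) hη) hY2N),
    mp n C w⁻¹ * h', mul_mem (mp_memU _ (inv_mem hw)) hh', ?_⟩
  rw [map_mul, ← eq, tau_add, map_mul (mp n (im c t)), im_C, map_inv]
  have e5 : mp n (im c t) h = mp n c Y * (mp n c w)⁻¹ * mp n (im c t) h2 := by
    rw [hh2, map_mul, im_C, map_mul, map_inv]; group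
  rw [e5]
  have e6 : mp n (im c t) h2 * tau n t (Pi.single p 1) = tau n t (Pi.single p 1) * mp n (im c t) h' := e2.symm
  have e7 : tau n t (Pi.single p 1) = mp n c w * (tau n t (Pi.single r 1) * (mp n c w)⁻¹) := by
    rw [hwδ]; group
  rw [mul_assoc _ _ (tau n t (Pi.single p 1)), mul_assoc _ _ (tau n t (Pi.single p 1)), e6, e7,
    hYY, map_mul]
  group

theorem Om_tau [Has3 n] (s : n → ℤ) : ∀ y ∈ Om n c t, y * tau n t s ∈ Om n c t := by
  apply exp_induction (fun s => ∀ y ∈ Om n c t, y * tau n t s ∈ Om n c t)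
  · intro y hy; simpa [tau_zero] using hy
  · intro s s' h h' y hy
    rw [tau_add, ← mul_assoc]; exact h' _ (h y hy)
  · intro p y hy; exact Om_delta c t p hy
  · rintro _ ⟨a, ha, s, η, hη, b, hb, rfl⟩
    refine ⟨a, ha, s + fun _ => -1, η, hη, b, hb, ?_⟩
    rw [tau_add, mul_assoc _ _ (tau n t fun _ => -1), ← tau_const]
    simp only [mul_assoc]
    rw [← mul_assoc η, ← tau_const, mul_assoc]

theorem El_Om [Has3 n] (hL : ∀ l : L, l ∈ AddSubmonoid.closure {l | ∃ (a : A) (k : ℤ), l = ((t ^ k : Lˣ) : L) * c a})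
    {g : GL n L} (hg : g ∈ El n (Set.univ : Set L)) : g ∈ Om n c t := by
  have hx : ∀ (i j : n) (l : L), ∀ y ∈ Om n c t, y * x i j l ∈ Om n c t := by
    intro i j l
    induction hL l using AddSubmonoid.closure_induction with
    | mem l hl =>
      obtain ⟨a, k, rfl⟩ := hl
      by_cases hij : i = j
      · subst hij; intro y hy; simpa [x_self] using hy
      intro y hy
      have e := tau_x t (k • Pi.single i 1) i j (c a)
      have e2 : (k • Pi.single i 1 : n → ℤ) i - (k • Pi.single i 1 : n → ℤ) j = k := by
        simp [Ne.symm hij]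
      rw [e2] at e
      rw [← e, ← tau_neg, ← mul_assoc, ← mul_assoc, ← mp_x]
      exact Om_tau c t _ _ (Om_El c t (x_mem i j (Set.mem_univ a)) (Om_tau c t _ _ hy))
    | zero => intro y hy; simpa [x_zero] using hy
    | add l l' _ _ h h' => intro y hy; rw [x_add, ← mul_assoc]; exact h' _ (h y hy)
  have : ∀ g ∈ El n (Set.univ : Set L), ∀ y ∈ Om n c t, y * g ∈ Om n c t ∧ y * g⁻¹ ∈ Om n c t := by
    intro g hg
    induction hg using Subgroup.closure_induction with
    | mem g hg =>
      obtain ⟨i, j, _, l, _, rfl⟩ := hg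
      intro y hy
      exact ⟨hx i j l y hy, by rw [← x_neg]; exact hx i j _ y hy⟩
    | one => intro y hy; simpa using hy
    | mul g g' _ _ h h' =>
      intro y hy
      refine ⟨by rw [← mul_assoc]; exact (h' _ (h y hy).1).1, ?_⟩
      rw [_root_.mul_inv_rev, ← mul_assoc]; exact (h _ (h' y hy).2).2
    | inv g _ h => intro y hy; rw [inv_inv]; exact (h y hy).symm
  have h1 : (1 : GL n L) ∈ Om n c t := ⟨1, one_mem _, 0, 1, one_mem _, 1, one_mem _, by simp [tau_zero]⟩
  simpa using (this g hg 1 h1).1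

end L4

section LC
variable {n : Type*} [Fintype n] [DecidableEq n] {A : Type*} [CommRing A]
open LaurentPolynomial IsLocalRing

/-- the variable as a unit -/
noncomputable def tL (A : Type*) [CommRing A] : (LaurentPolynomial A)ˣ :=
  ⟨LaurentPolynomial.T 1, LaurentPolynomial.T (-1), by rw [← LaurentPolynomial.T_add]; simp,
    by rw [← LaurentPolynomial.T_add]; simp⟩

theorem tL_zpow (k : ℤ) : ((tL A ^ k : (LaurentPolynomial A)ˣ) : LaurentPolynomial A) = LaurentPolynomial.T k := by
  obtain ⟨m, rfl | rfl⟩ := Int.eq_nat_or_neg k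
  · simp [tL]
  · rw [_root_.zpow_neg, zpow_natCast, ← inv_pow, Units.val_pow_eq_pow_val]
    have : ((tL A)⁻¹ : (LaurentPolynomial A)ˣ).val = LaurentPolynomial.T (-1) := rfl
    rw [this]; simp

noncomputable abbrev lp (A : Type*) [CommRing A] : A[X] →+* LaurentPolynomial A := ip LaurentPolynomial.C (tL A)
noncomputable abbrev lm (A : Type*) [CommRing A] : A[X] →+* LaurentPolynomial A := im LaurentPolynomial.C (tL A)

theorem lp_eq (f : A[X]) : lp A f = toLaurent f := by
  have : lp A = (toLaurent : A[X] →+* _) := by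
    ext <;> simp [lp, ip, tL]
  rw [this]

theorem lm_eq (f : A[X]) : lm A f = invert (toLaurent f) := by
  have : lm A = (invert (R := A)).toRingEquiv.toRingHom.comp (toLaurent : A[X] →+* _) := by
    apply Polynomial.ringHom_ext
    · intro a; simp [lm, im, invert_C]
    · simp [lm, im]; rfl
  rw [this]; rfl

theorem lp_coeff_nat (f : A[X]) (k : ℕ) : (lp A f).coeff k = f.coeff k := by
  rw [lp_eq]
  induction f using Polynomial.induction_on' with
  | add p q hp hq => rw [map_add]; simp only [AddMonoidAlgebra.coeff_add, Finsupp.add_apply, hp, hq, Polynomial.coeff_add, add_zero]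
  | monomial m a => simp [← single_eq_C_mul_T, coeff_monomial, Finsupp.single_apply]

theorem lp_coeff_neg (f : A[X]) (k : ℤ) (hk : k < 0) : (lp A f).coeff k = 0 := by
  rw [lp_eq]
  induction f using Polynomial.induction_on' with
  | add p q hp hq => rw [map_add]; simp only [AddMonoidAlgebra.coeff_add, Finsupp.add_apply, hp, hq, Polynomial.coeff_add, add_zero]
  | monomial m a =>
    simp [← single_eq_C_mul_T, Finsupp.single_apply]; omega

theorem lm_coeff_pos (f : A[X]) (k : ℤ) (hk : 0 < k) : (lm A f).coeff k = 0 := by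
  rw [lm_eq]
  simp only [invert_apply]
  rw [← lp_eq]; exact lp_coeff_neg f _ (by omega)

theorem laurent_gen (l : LaurentPolynomial A) : l ∈ AddSubmonoid.closure
    {l | ∃ (a : A) (k : ℤ), l = ((tL A ^ k : (LaurentPolynomial A)ˣ) : LaurentPolynomial A) * LaurentPolynomial.C a} := by
  induction l using LaurentPolynomial.induction_on' with
  | add p q hp hq => exact add_mem hp hq
  | C_mul_T k a => exact AddSubmonoid.subset_closure ⟨a, k, by rw [tL_zpow]; ring⟩

/-- reduction of Laurent polynomials -/
noncomputable def rho {A B : Type*} [CommRing A] [CommRing B] (f : A →+* B) :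
    LaurentPolynomial A →+* LaurentPolynomial B :=
  LaurentPolynomial.eval₂ ((LaurentPolynomial.C).comp f) (tL B)

theorem rho_lp {B : Type*} [CommRing B] (f : A →+* B) (p : A[X]) : rho f (lp A p) = lp B (p.map f) := by
  rw [lp_eq, rho, LaurentPolynomial.eval₂_toLaurent]
  simp [lp, ip, Polynomial.eval₂_map]

theorem rho_lm {B : Type*} [CommRing B] (f : A →+* B) (p : A[X]) : rho f (lm A p) = lm B (p.map f) := by
  have : (rho f).comp (lm A) = (lm B).comp (mapRingHom f) := by
    apply Polynomial.ringHom_ext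
    · intro a; simp [lm, im, rho]
    · simp [lm, im, rho]
      have : ((tL A)⁻¹ : (LaurentPolynomial A)ˣ).val = LaurentPolynomial.T (-1) := rfl
      rw [this, LaurentPolynomial.eval₂_T]; simp
  exact congrArg (fun g => g p) this

theorem rho_tau {B : Type*} [CommRing B] (f : A →+* B) (s : n → ℤ) :
    mp n (rho f) (tau n (tL A) s) = tau n (tL B) s := by
  ext1
  rw [mp_val, tau_val, tau_val, diagonal_map (map_zero _)]
  congr; ext i : 1
  simp only [Function.comp, tL_zpow, rho, LaurentPolynomial.eval₂_T]

theorem local_conclusion [Has3 n] [IsLocalRing A] {α β : GL n A[X]} (hα : α.val.det = 1)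
    (hβ : β.val.det = 1) {ε : GL n (LaurentPolynomial A)}
    (hε : ε ∈ El n (Set.univ : Set (LaurentPolynomial A)))
    (h : mp n (lp A) α = ε * mp n (lm A) β) : α ∈ El n (Set.univ : Set A[X]) := by
  obtain ⟨a, ha, s, η, hη, b, hb, rfl⟩ := El_Om LaurentPolynomial.C (tL A) laurent_gen hε
  have hη' := NN_conj LaurentPolynomial.C (tL A) (mem_Gt_tau (n := n) LaurentPolynomial.C (tL A) s) hη
  obtain ⟨e, he, e', he', hee⟩ := NN_le_PP _ _ hη'
  obtain ⟨α', hα'⟩ : ∃ α', α' = (a * e)⁻¹ * α := ⟨_, rfl⟩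
  obtain ⟨β', hβ'⟩ : ∃ β', β' = b * β := ⟨_, rfl⟩
  have hdα : α'.val.det = 1 := by
    rw [hα', Units.val_mul, det_mul, hα, mul_one]
    exact El_det (inv_mem (mul_mem ha (mem_NP.1 he).1))
  have hdβ : β'.val.det = 1 := by
    rw [hβ', Units.val_mul, det_mul, hβ, mul_one]; exact El_det hb
  have h1 : mp n (lp A) α' = mp n (lm A) e' * tau n (tL A) s * mp n (lm A) β' := by
    have : tau n (tL A) s * η = mp n (lp A) e * mp n (lm A) e' * tau n (tL A) s := by
      rw [← hee]; group
    rw [hα', hβ', map_mul, h, map_inv, map_mul, map_mul]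
    rw [mul_assoc _ (tau n (tL A) s) η, this]; group
  have hs0 : ∀ i, 0 ≤ s i := by
    intro i
    by_contra hcon
    push Not at hcon
    have h2 := congrArg (mp n (rho (residue A))) h1
    have hp : ∀ g : GL n A[X], mp n (rho (residue A)) (mp n (lp A) g) =
        mp n (lp (ResidueField A)) (mp n (mapRingHom (residue A)) g) := by
      intro g; ext1; rw [mp_val, mp_val, mp_val, mp_val]; ext1 i j; exact rho_lp _ _
    have hm : ∀ g : GL n A[X], mp n (rho (residue A)) (mp n (lm A) g) =
        mp n (lm (ResidueField A)) (mp n (mapRingHom (residue A)) g) := by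
      intro g; ext1; rw [mp_val, mp_val, mp_val, mp_val]; ext1 i j; exact rho_lm _ _
    rw [hp, map_mul, map_mul, hm, hm, rho_tau, (mem_NP.1 he').2, map_one, one_mul] at h2
    have hz : ∀ j, (mp n (mapRingHom (residue A)) α').val i j = 0 := by
      intro j
      have h3 := congrArg (fun u : GL n _ => u.val i j) h2
      simp only [Units.val_mul, tau_val, diagonal_mul, tL_zpow] at h3
      ext k
      rw [← lp_coeff_nat]
      have h4 : lp (ResidueField A) ((mp n (mapRingHom (residue A)) α').val i j) = _ := h3
      rw [h4]
      rw [mp_val, map_apply, LaurentPolynomial.T, AddMonoidAlgebra.coeff_single_mul_apply,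
        lm_coeff_pos]
      · simp
      · omega
    have hd : (mp n (mapRingHom (residue A)) α').val.det = 1 := by
      rw [mp_val]
      have := RingHom.map_det (mapRingHom (residue A)) α'.val
      rw [hdα, map_one] at this
      exact this.symm
    rw [det_eq_zero_of_row_eq_zero i hz] at hd
    exact zero_ne_one hd
  have hsum : ∑ i, s i = 0 := by
    have h2 := congrArg (fun u : GL n _ => u.val.det) h1
    have hmd : ∀ (f : A[X] →+* LaurentPolynomial A) (g : GL n A[X]), g.val.det = 1 → (mp n f g).val.det = 1 := by
      intro f g hg
      rw [mp_val]
      have := RingHom.map_det f g.val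
      rw [hg, map_one] at this
      exact this.symm
    simp only [Units.val_mul, det_mul, hmd _ _ hdα, hmd _ _ hdβ, hmd _ _ (El_det (mem_NP.1 he').1),
      tau_val, det_diagonal, one_mul, mul_one, tL_zpow] at h2
    have h3 : ∀ B : Finset n, ∏ i ∈ B, (LaurentPolynomial.T (s i) : LaurentPolynomial A) = LaurentPolynomial.T (∑ i ∈ B, s i) := by
      intro B
      induction B using Finset.induction_on with
      | empty => simp
      | insert i B hi ih => rw [Finset.prod_insert hi, Finset.sum_insert hi, ih, LaurentPolynomial.T_add]
    rw [h3] at h2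
    have h4 := congrArg (fun f => f.coeff 0) h2
    rw [← LaurentPolynomial.T_zero] at h4
    simp only [LaurentPolynomial.T_apply] at h4
    by_contra hne
    simp [hne] at h4
  have hs : s = 0 := by
    ext i
    exact (Finset.sum_eq_zero_iff_of_nonneg fun i _ => hs0 i).1 hsum i (Finset.mem_univ i)
  rw [hs, tau_zero, mul_one, ← map_mul] at h1
  have hconst : ∀ i j, α'.val i j = Polynomial.C ((α'.val i j).coeff 0) := by
    intro i j
    ext k
    rw [coeff_C]
    split_ifs with hk
    · rw [hk]
    · have h3 := congrArg (fun u : GL n _ => u.val i j) h1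
      have h4 : lp A (α'.val i j) = lm A ((e' * β').val i j) := h3
      rw [← lp_coeff_nat, h4, lm_coeff_pos]
      omega
  have hα'E : α' ∈ El n (Set.univ : Set A[X]) := by
    have : α' = mp n Polynomial.C (mp n (evalRingHom (0:A)) α') := by
      ext1; ext1 i j
      rw [mp_val, mp_val, map_apply, map_apply, coe_evalRingHom, ← coeff_zero_eq_eval_zero]
      exact hconst i j
    rw [this]
    apply mp_memU
    apply sle_local
    rw [mp_val]
    have := RingHom.map_det (evalRingHom (0:A)) α'.val
    rw [hdα, map_one] at this
    exact this.symm
  have : α = (a * e) * α' := by rw [hα']; group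
  rw [this]
  exact mul_mem (mul_mem ha (mem_NP.1 he).1) hα'E

end LC
end CSB

namespace CSB
open Matrix Polynomial
open scoped commutatorElement
set_option linter.all false

section LemK
variable {n : Type*} [Fintype n] [DecidableEq n] {K : Type*} [CommRing K]

/-- multiples of `s ^ M` -/
def Ks (s : K) (D : Subring K) (M : ℕ) : Set K := {a | ∃ c ∈ D, a = s ^ M * c}

theorem x_conj_left {k l j : n} (hkl : k ≠ l) (hlj : l ≠ j) (hkj : k ≠ j) (c b : K) :
    x k l c * x l j b * (x k l c)⁻¹ = x k j (c * b) * x l j b := by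
  rw [x_mul hkl hlj hkj]; group

theorem x_conj_right {i k l : n} (hkl : k ≠ l) (hik : i ≠ k) (hil : i ≠ l) (c b : K) :
    x k l c * x i k b * (x k l c)⁻¹ = x i l (-(b * c)) * x i k b := by
  rw [x_neg, mul_inv_eq_iff_eq_mul, mul_assoc, x_mul hik hkl hil]; group

theorem conj_gen (s : K) (D : Subring K) (hs : s ∈ D) {k l : n} (hkl : k ≠ l) {c : K} {r : ℕ}
    (hc : s ^ r * c ∈ D) (M : ℕ) {i j : n} (hij : i ≠ j) (hne : ¬ (i = l ∧ j = k)) {d : K} (hd : d ∈ D) :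
    x k l c * x i j (s ^ (M + r) * d) * (x k l c)⁻¹ ∈ El n (Ks s D M) := by
  have hmem : s ^ (M + r) * d ∈ Ks s D M := ⟨s ^ r * d, mul_mem (pow_mem hs _) hd, by ring⟩
  by_cases h1 : l = i
  · subst h1
    have h2 : k ≠ j := fun h => hne ⟨rfl, h.symm⟩
    rw [x_conj_left hkl hij h2]
    exact mul_mem (x_mem _ _ ⟨s ^ r * c * d, mul_mem hc hd, by ring⟩) (x_mem _ _ hmem)
  · by_cases h2 : k = j
    · subst h2
      rw [x_conj_right hkl hij (Ne.symm h1)]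
      exact mul_mem (x_mem _ _ ⟨-(s ^ r * c * d), neg_mem (mul_mem hc hd), by ring⟩) (x_mem _ _ hmem)
    · rw [x_comm hkl hij h1 h2, mul_inv_cancel_right]
      exact x_mem _ _ hmem

theorem lemK [Has3 n] (s : K) (D : Subring K) (hs : s ∈ D) {γ : GL n K}
    (hγ : γ ∈ El n {c : K | ∃ r : ℕ, s ^ r * c ∈ D}) :
    ∀ M, ∃ N, ∀ y ∈ El n (Ks s D N), γ * y * γ⁻¹ ∈ El n (Ks s D M) := by
  have red : ∀ (γ : GL n K) (M N : ℕ), (∀ i j : n, i ≠ j → ∀ d ∈ D,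
      γ * x i j (s ^ N * d) * γ⁻¹ ∈ El n (Ks s D M)) →
      ∀ y ∈ El n (Ks s D N), γ * y * γ⁻¹ ∈ El n (Ks s D M) := by
    intro γ M N h y hy
    have : El n (Ks s D N) ≤ (El n (Ks s D M)).comap (MulAut.conj γ).toMonoidHom := by
      apply El_le
      rintro i j hij _ ⟨d, hd, rfl⟩
      exact h i j hij d hd
    exact this hy
  have gen : ∀ (k l : n), k ≠ l → ∀ c : K, (∃ r : ℕ, s ^ r * c ∈ D) → ∀ M, ∃ N, ∀ y ∈ El n (Ks s D N),
      x k l c * y * (x k l c)⁻¹ ∈ El n (Ks s D M) := by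
    rintro k l hkl c ⟨r, hc⟩ M
    refine ⟨(M + r) + (M + r), red _ _ _ ?_⟩
    intro i j hij d hd
    by_cases hne : i = l ∧ j = k
    · obtain ⟨rfl, rfl⟩ := hne
      obtain ⟨p, hp1, hp2⟩ := Has3.third i j
      have e : s ^ ((M + r) + (M + r)) * d = (s ^ (M + r) * 1) * (s ^ (M + r) * d) := by ring
      rw [e, x_comm3 (Ne.symm hp1) hp2 hij, commutatorElement_def]
      have a1 := conj_gen s D hs hkl hc M (Ne.symm hp1) (by tauto) (one_mem D)
      have a2 := conj_gen s D hs hkl hc M hp2 (by tauto) hd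
      have := mul_mem (mul_mem (mul_mem a1 a2) (inv_mem a1)) (inv_mem a2)
      convert this using 1
      group
    · have := conj_gen s D hs hkl hc M hij hne (d := s ^ (M + r) * d) (mul_mem (pow_mem hs _) hd)
      rwa [← mul_assoc, ← pow_add] at this
  have main : ∀ γ ∈ El n {c : K | ∃ r : ℕ, s ^ r * c ∈ D},
    (∀ M, ∃ N, ∀ y ∈ El n (Ks s D N), γ * y * γ⁻¹ ∈ El n (Ks s D M)) ∧
    (∀ M, ∃ N, ∀ y ∈ El n (Ks s D N), γ⁻¹ * y * γ⁻¹⁻¹ ∈ El n (Ks s D M)) := by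
    intro γ hγ
    induction hγ using Subgroup.closure_induction with
    | mem y hy =>
      obtain ⟨i, j, hij, c, hc, rfl⟩ := hy
      refine ⟨gen i j hij c hc, ?_⟩
      rw [← x_neg]
      refine gen i j hij (-c) ?_
      obtain ⟨r, hr⟩ := hc
      exact ⟨r, by rw [mul_neg]; exact neg_mem hr⟩
    | one => exact ⟨fun M => ⟨M, by simp⟩, fun M => ⟨M, by simp⟩⟩
    | mul g h _ _ hg hh =>
      constructor
      · intro M
        obtain ⟨N1, h1⟩ := hg.1 M
        obtain ⟨N2, h2⟩ := hh.1 N1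
        refine ⟨N2, fun y hy => ?_⟩
        have := h1 _ (h2 y hy)
        convert this using 1; group
      · intro M
        obtain ⟨N1, h1⟩ := hh.2 M
        obtain ⟨N2, h2⟩ := hg.2 N1
        refine ⟨N2, fun y hy => ?_⟩
        have := h1 _ (h2 y hy)
        convert this using 1; group
    | inv g _ hg => exact ⟨hg.2, by rw [inv_inv]; exact hg.1⟩
  exact (main γ hγ).1

end LemK

section Monic
variable {n : Type*} [Fintype n] [DecidableEq n] {A : Type*} [CommRing A]
variable {K : Type*} [Field K] (j : A[X] →+* K)

/-- fractions with monic denominator -/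
def Fm : Set K := {c | ∃ f g : A[X], f.Monic ∧ j f * c = j g}

/-- the unit j X -/
noncomputable def jU [Nontrivial A] (hj : Function.Injective j) : Kˣ :=
  Units.mk0 (j X) (by rw [Ne, map_eq_zero_iff j hj]; exact X_ne_zero)

variable [Nontrivial A] (hj : Function.Injective j)

noncomputable def jm : A[X] →+* K := eval₂RingHom (j.comp Polynomial.C) ((jU j hj)⁻¹ : Kˣ).val
noncomputable def jl : LaurentPolynomial A →+* K := LaurentPolynomial.eval₂ (j.comp Polynomial.C) (jU j hj)

theorem jl_lp (f : A[X]) : jl j hj (lp A f) = j f := by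
  rw [lp_eq, jl, LaurentPolynomial.eval₂_toLaurent]
  have : eval₂RingHom (j.comp Polynomial.C) (jU j hj).val = j := by
    ext <;> simp [jU]
  exact congrArg (fun g => g f) this

theorem jl_lm (f : A[X]) : jl j hj (lm A f) = jm j hj f := by
  have : (jl j hj).comp (lm A) = jm j hj := by
    apply Polynomial.ringHom_ext
    · intro a; simp [lm, im, jl, jm]
    · simp [lm, im, jl, jm]
      have : (tL A).val = LaurentPolynomial.T 1 := rfl
      rw [this, LaurentPolynomial.eval₂_T]; simp
  exact congrArg (fun g => g f) this

theorem jl_T (k : ℤ) : jl j hj (LaurentPolynomial.T k) = ((jU j hj ^ k : Kˣ) : K) := by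
  simp [jl, LaurentPolynomial.eval₂_T]

theorem laurent_mul (l : LaurentPolynomial A) : ∃ (k : ℕ) (f : A[X]), lp A f = l * LaurentPolynomial.T k := by
  obtain ⟨k, f, h⟩ := LaurentPolynomial.exists_T_pow l
  exact ⟨k, f, by rw [lp_eq, h]⟩

theorem lp_inj : Function.Injective (lp A) := by
  intro f g h
  ext k; rw [← lp_coeff_nat, ← lp_coeff_nat, h]

theorem lm_inj : Function.Injective (lm A) := by
  intro f g h
  rw [lm_eq, lm_eq, ← lp_eq, ← lp_eq] at h
  exact lp_inj (LaurentPolynomial.invert.injective h)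

theorem jl_inj : Function.Injective (jl j hj) := by
  rw [injective_iff_map_eq_zero]
  intro l hl
  obtain ⟨k, f, h⟩ := laurent_mul l
  have h2 := congrArg (jl j hj) h
  rw [map_mul, hl, zero_mul, jl_lp, map_eq_zero_iff j hj] at h2
  rw [h2, map_zero] at h
  have h3 : l * LaurentPolynomial.T k * LaurentPolynomial.T (-k) = 0 := by rw [← h, zero_mul]
  rwa [mul_assoc, ← LaurentPolynomial.T_add, add_neg_cancel, LaurentPolynomial.T_zero, mul_one] at h3

theorem jm_inj : Function.Injective (jm j hj) := by
  intro f g h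
  rw [← jl_lm, ← jl_lm] at h
  exact lm_inj (jl_inj j hj h)

noncomputable def Dr : Subring K where
  carrier := {d | ∃ w p : A[X], w.coeff 0 = 1 ∧ jm j hj w * d = jm j hj p}
  zero_mem' := ⟨1, 0, by simp, by simp⟩
  one_mem' := ⟨1, 1, by simp, by simp⟩
  add_mem' := by
    rintro a b ⟨w, p, hw, h⟩ ⟨w', p', hw', h'⟩
    refine ⟨w * w', w' * p + w * p', by simp [mul_coeff_zero, hw, hw'], ?_⟩
    simp only [map_mul, map_add, ← h, ← h']; ring
  neg_mem' := by
    rintro a ⟨w, p, hw, h⟩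
    exact ⟨w, -p, hw, by rw [map_neg, ← h]; ring⟩
  mul_mem' := by
    rintro a b ⟨w, p, hw, h⟩ ⟨w', p', hw', h'⟩
    refine ⟨w * w', p * p', by simp [mul_coeff_zero, hw, hw'], ?_⟩
    simp only [map_mul, ← h, ← h']; ring

theorem mem_Dr {d : K} : d ∈ Dr j hj ↔ ∃ w p : A[X], w.coeff 0 = 1 ∧ jm j hj w * d = jm j hj p := Iff.rfl

theorem jm_mem (p : A[X]) : jm j hj p ∈ Dr j hj := ⟨1, p, by simp, by simp⟩

theorem jm_X : jm j hj X = ((jU j hj)⁻¹ : Kˣ).val := by simp [jm]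

theorem Dr_step {d : K} (hd : d ∈ Dr j hj) : ∃ a : A, ∃ d' ∈ Dr j hj, d = jm j hj (Polynomial.C a) + jm j hj X * d' := by
  obtain ⟨w, p, hw, h⟩ := hd
  have hX : jm j hj X ≠ 0 := by rw [jm_X]; exact Units.ne_zero _
  obtain ⟨q, hq⟩ : X ∣ p - w * Polynomial.C (p.coeff 0) := by
    rw [X_dvd_iff]; simp [mul_coeff_zero, hw]
  have hw0 : jm j hj w ≠ 0 := by
    rw [Ne, map_eq_zero_iff _ (jm_inj j hj)]; intro h0; simp [h0] at hw
  refine ⟨p.coeff 0, (jm j hj X)⁻¹ * (d - jm j hj (Polynomial.C (p.coeff 0))), ⟨w, q, hw, ?_⟩, ?_⟩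
  · have h2 := congrArg (jm j hj) hq
    simp only [map_sub, map_mul, ← h] at h2
    field_simp
    linear_combination h2
  · field_simp; ring

theorem Dr_approx {d : K} (hd : d ∈ Dr j hj) (N : ℕ) : ∃ p : A[X], ∃ d' ∈ Dr j hj, d = jm j hj p + jm j hj X ^ N * d' := by
  induction N with
  | zero => exact ⟨0, d, hd, by simp⟩
  | succ N ih =>
    obtain ⟨p, d', hd', e⟩ := ih
    obtain ⟨a, d'', hd'', e'⟩ := Dr_step j hj hd'
    refine ⟨p + X ^ N * Polynomial.C a, d'', hd'', ?_⟩
    rw [e, e']; simp only [map_add, map_mul, map_pow]; ring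

theorem jm_reverse (f : A[X]) : jm j hj f.reverse = jm j hj X ^ f.natDegree * j f := by
  letI : Invertible (jU j hj).val := (jU j hj).invertible
  have h := eval₂_reverse_mul_pow (j.comp Polynomial.C) (jU j hj).val f
  have e1 : eval₂ (j.comp Polynomial.C) (jU j hj).val f = j f := by
    rw [← jl_lp j hj, lp_eq, jl, LaurentPolynomial.eval₂_toLaurent]
  rw [← e1, ← h, jm_X, mul_left_comm, ← mul_pow]
  simp [jm]

theorem Fm_pow {c : K} (hc : c ∈ Fm j) : ∃ r : ℕ, jm j hj X ^ r * c ∈ Dr j hj := by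
  obtain ⟨f, g, hf, h⟩ := hc
  refine ⟨g.natDegree, f.reverse, X ^ f.natDegree * g.reverse, ?_, ?_⟩
  · rw [coeff_zero_reverse]; exact hf
  · rw [map_mul, map_pow, jm_reverse, jm_reverse, ← h]; ring

theorem jX_jm : j X * jm j hj X = 1 := by
  rw [jm_X]; exact (jU j hj).mul_inv

theorem Fm_approx {c : K} (hc : c ∈ Fm j) (N : ℕ) : ∃ l : LaurentPolynomial A, ∃ d ∈ Dr j hj,
    c = jl j hj l + jm j hj X ^ N * d := by
  obtain ⟨r, hr⟩ := Fm_pow j hj hc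
  obtain ⟨p, d', hd', e⟩ := Dr_approx j hj hr (r + N)
  refine ⟨lp A (X ^ r) * lm A p, d', hd', ?_⟩
  rw [map_mul, jl_lp, jl_lm, map_pow]
  have h1 : (j X) ^ r * (jm j hj X) ^ r = 1 := by rw [← mul_pow, jX_jm, one_pow]
  calc c = ((j X) ^ r * (jm j hj X) ^ r) * c := by rw [h1, one_mul]
    _ = (j X) ^ r * (jm j hj X ^ r * c) := by ring
    _ = (j X) ^ r * jm j hj p + ((j X) ^ r * (jm j hj X) ^ r) * (jm j hj X ^ N * d') := by rw [e]; ring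
    _ = _ := by rw [h1, one_mul]

theorem jl_Fm (l : LaurentPolynomial A) : jl j hj l ∈ Fm j := by
  obtain ⟨k, f, h⟩ := laurent_mul l
  refine ⟨X ^ k, f, monic_X_pow k, ?_⟩
  rw [← jl_lp j hj f, h, map_mul, jl_T, mul_comm, map_pow, zpow_natCast, Units.val_pow_eq_pow_val]; rfl

theorem jl_Dr {l : LaurentPolynomial A} (hl : jl j hj l ∈ Dr j hj) : ∃ p, l = lm A p := by
  obtain ⟨w, p, hw, h⟩ := hl
  rw [← jl_lm, ← jl_lm, ← map_mul] at h
  have h := jl_inj j hj h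
  rw [lm_eq, lm_eq] at h
  have h2 := congrArg LaurentPolynomial.invert h
  rw [map_mul] at h2
  have hinv : ∀ z : LaurentPolynomial A, LaurentPolynomial.invert (LaurentPolynomial.invert z) = z := by
    intro z; ext k; simp
  rw [hinv, hinv, ← lp_eq, ← lp_eq] at h2
  obtain ⟨k, f, hf⟩ := laurent_mul (LaurentPolynomial.invert l)
  have hX : lp A (X ^ k) = LaurentPolynomial.T k := by rw [lp_eq]; simp
  have h3 : w * f = X ^ k * p := by
    apply lp_inj
    rw [map_mul, map_mul, hX, hf, ← h2]; ring
  have hco : IsCoprime (X ^ k) w := by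
    apply IsCoprime.pow_left
    obtain ⟨q, hq⟩ : X ∣ w - 1 := by rw [X_dvd_iff]; simp [hw]
    exact ⟨-q, 1, by linear_combination hq⟩
  obtain ⟨f', rfl⟩ : X ^ k ∣ f := hco.dvd_of_dvd_mul_left ⟨p, h3⟩
  refine ⟨f', ?_⟩
  rw [map_mul, hX] at hf
  have h4 : LaurentPolynomial.invert l = lp A f' := by
    have := congrArg (fun z => z * LaurentPolynomial.T (-k)) hf
    simp only [mul_assoc, ← LaurentPolynomial.T_add, add_neg_cancel, LaurentPolynomial.T_zero, mul_one] at this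
    rw [← this, mul_comm, mul_assoc, ← LaurentPolynomial.T_add]; simp
  rw [lm_eq, ← lp_eq, ← h4, hinv]

theorem Fm_factor [Has3 n] {γ : GL n K} (hγ : γ ∈ El n (Fm j)) :
    ∃ ε ∈ El n (Set.univ : Set (LaurentPolynomial A)), ∃ δ ∈ El n (Dr j hj : Set K), γ = mp n (jl j hj) ε * δ := by
  have hX : jm j hj X ∈ Dr j hj := jm_mem j hj X
  have gen : ∀ (a b : n), a ≠ b → ∀ c ∈ Fm j, ∀ γ : GL n K,
      (∃ ε ∈ El n (Set.univ : Set (LaurentPolynomial A)), ∃ δ ∈ El n (Dr j hj : Set K), γ = mp n (jl j hj) ε * δ) →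
      ∃ ε ∈ El n (Set.univ : Set (LaurentPolynomial A)), ∃ δ ∈ El n (Dr j hj : Set K), x a b c * γ = mp n (jl j hj) ε * δ := by
    rintro a b hab c hc _ ⟨ε, hε, δ, hδ, rfl⟩
    have h1 : (mp n (jl j hj) ε)⁻¹ ∈ El n {c : K | ∃ r : ℕ, jm j hj X ^ r * c ∈ Dr j hj} := by
      apply inv_mem
      exact mp_mem _ (fun l _ => Fm_pow j hj (jl_Fm j hj l)) hε
    obtain ⟨N, hN⟩ := lemK (jm j hj X) (Dr j hj) hX h1 0
    obtain ⟨l, d, hd, rfl⟩ := Fm_approx j hj hc N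
    have h2 := hN _ (x_mem a b (⟨d, hd, rfl⟩ : jm j hj X ^ N * d ∈ Ks (jm j hj X) (Dr j hj) N))
    have h3 : El n (Ks (jm j hj X) (Dr j hj) 0) ≤ El n (Dr j hj : Set K) := El_mono (by
      rintro _ ⟨c, hc, rfl⟩; simpa using hc)
    refine ⟨x a b l * ε, mul_mem (x_mem _ _ (Set.mem_univ _)) hε, _, mul_mem (h3 h2) hδ, ?_⟩
    rw [map_mul, mp_x, x_add]; group
  have main : ∀ g ∈ El n (Fm j), ∀ γ : GL n K,
      (∃ ε ∈ El n (Set.univ : Set (LaurentPolynomial A)), ∃ δ ∈ El n (Dr j hj : Set K), γ = mp n (jl j hj) ε * δ) →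
      (∃ ε ∈ El n (Set.univ : Set (LaurentPolynomial A)), ∃ δ ∈ El n (Dr j hj : Set K), g * γ = mp n (jl j hj) ε * δ)
      ∧ ∃ ε ∈ El n (Set.univ : Set (LaurentPolynomial A)), ∃ δ ∈ El n (Dr j hj : Set K), g⁻¹ * γ = mp n (jl j hj) ε * δ := by
    intro g hg
    induction hg using Subgroup.closure_induction with
    | mem g hg =>
      obtain ⟨a, b, hab, c, hc, rfl⟩ := hg
      intro γ h
      refine ⟨gen a b hab c hc γ h, ?_⟩
      rw [← x_neg]
      refine gen a b hab _ ?_ γ h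
      obtain ⟨f, g, hf, e⟩ := hc
      exact ⟨f, -g, hf, by rw [map_neg, ← e]; ring⟩
    | one => intro γ h; simpa using h
    | mul g g' _ _ h h' =>
      intro γ hγ
      refine ⟨by rw [mul_assoc]; exact (h _ (h' γ hγ).1).1, ?_⟩
      rw [_root_.mul_inv_rev, mul_assoc]; exact (h' _ (h γ hγ).2).2
    | inv g _ h => intro γ hγ; rw [inv_inv]; exact (h γ hγ).symm
  simpa using (main γ hγ 1 ⟨1, one_mem _, 1, one_mem _, by simp⟩).1

theorem El_entries {D : Subring K} {g : GL n K} (hg : g ∈ El n (D : Set K)) : ∀ a b, g.val a b ∈ D := by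
  obtain ⟨g', _, rfl⟩ := El_lift (n := n) D.subtype (I := Set.univ) (J := (D : Set K))
    (fun b hb => ⟨⟨b, hb⟩, Set.mem_univ _, rfl⟩) hg
  intro a b
  exact (g'.val a b).2

/-- **L5**: monic inversion over a local ring. -/
theorem monic_inversion (hj : Function.Injective j) [Has3 n] [IsLocalRing A] {α : GL n A[X]} (hα : α.val.det = 1)
    (h : mp n j α ∈ El n (Fm j)) : α ∈ El n (Set.univ : Set A[X]) := by
  obtain ⟨ε, hε, δ, hδ, e⟩ := Fm_factor j hj h
  have e1 : δ = mp n (jl j hj) (ε⁻¹ * mp n (lp A) α) := by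
    rw [map_mul, map_inv, mp_comp]
    have : (jl j hj).comp (lp A) = j := RingHom.ext fun f => jl_lp j hj f
    rw [this, e]; group
  have h2 := El_entries hδ
  have h3 : ∀ a b, ∃ p, (ε⁻¹ * mp n (lp A) α).val a b = lm A p := by
    intro a b
    apply jl_Dr j hj
    have := h2 a b
    rw [e1] at this
    exact this
  choose p hp using h3
  have hdet : det (Matrix.of p) = 1 := by
    apply lm_inj
    rw [RingHom.map_det, map_one]
    have : (lm A).mapMatrix (Matrix.of p) = (ε⁻¹ * mp n (lp A) α).val := by
      ext1 a b; exact (hp a b).symm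
    rw [this, Units.val_mul, det_mul, El_det (inv_mem hε), one_mul]
    rw [mp_val]
    have := RingHom.map_det (lp A) α.val
    rw [hα, map_one] at this
    exact this.symm
  let β : GL n A[X] := Matrix.nonsingInvUnit (Matrix.of p) (by rw [hdet]; exact isUnit_one)
  have hβ : mp n (lm A) β = ε⁻¹ * mp n (lp A) α := by
    ext1; ext1 a b; exact (hp a b).symm
  exact local_conclusion (β := β) hα hdet hε (by rw [hβ]; group)

end Monic
end CSB

namespace CSB
open Matrix Polynomial
open scoped commutatorElement
set_option linter.all false

section LG
variable {n : Type*} [Fintype n] [DecidableEq n] {A : Type*} [CommRing A]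
variable {K0 : Type*} [Field K0] (c : A →+* K0)

def Is (s : A) : Set K0[X] := {p | ∃ (r : ℕ) (q : A[X]), C (c s) ^ r * p = q.map c}

theorem Is_mono (s s' : A) : Is c s ⊆ Is c (s * s') := by
  rintro p ⟨r, q, h⟩
  refine ⟨r, C s' ^ r * q, ?_⟩
  rw [Polynomial.map_mul, ← h]; simp [mul_pow]; ring

theorem exists_s (m : Ideal A) [hm : m.IsPrime] {g : GL n K0[X]}
    (hg : g ∈ El n {p : K0[X] | ∃ s ∉ m, ∃ q : A[X], C (c s) * p = q.map c}) :
    ∃ s ∉ m, g ∈ El n (Is c s) := by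
  induction hg using Subgroup.closure_induction with
  | mem g hg =>
    obtain ⟨i, j, _, p, ⟨s, hs, q, h⟩, rfl⟩ := hg
    exact ⟨s, hs, x_mem i j ⟨1, q, by simpa using h⟩⟩
  | one => exact ⟨1, fun h => hm.ne_top ((Ideal.eq_top_iff_one _).2 h), one_mem _⟩
  | mul g g' _ _ h h' =>
    obtain ⟨s, hs, h1⟩ := h
    obtain ⟨s', hs', h2⟩ := h'
    refine ⟨s * s', fun h => (hm.mem_or_mem h).elim hs hs', mul_mem (El_mono (Is_mono c s s') h1) ?_⟩
    rw [mul_comm s s']; exact El_mono (Is_mono c s' s) h2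
  | inv g _ h =>
    obtain ⟨s, hs, h1⟩ := h
    exact ⟨s, hs, inv_mem h1⟩

/-- X + Y -/
noncomputable def shift (A : Type*) [CommRing A] : A[X] →+* A[X][X] := eval₂RingHom (C.comp C) (C X + X)
/-- rescale Y -/
noncomputable def sigma {A : Type*} [CommRing A] (s : A) : A[X][X] →+* A[X][X] := eval₂RingHom C (C (C s) * X)
noncomputable def scl {A : Type*} [CommRing A] (b : A) : A[X] →+* A[X] := eval₂RingHom C (C b * X)
noncomputable def ez (A : Type*) [CommRing A] : A[X] →+* A[X] := C.comp (evalRingHom 0)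

noncomputable def big : A[X][X] →+* K0[X][X] := mapRingHom (mapRingHom c)

def Js (s : A) : Set K0[X][X] := {P | ∃ r : ℕ, (C (C (c s)) : K0[X][X]) ^ r * P ∈ (big c).range}

theorem big_inj (hc : Function.Injective c) : Function.Injective (big c) :=
  Polynomial.map_injective _ (Polynomial.map_injective _ hc)

theorem big_shift : (big c).comp (shift A) = (shift K0).comp (mapRingHom c) := by
  apply Polynomial.ringHom_ext
  · intro a; simp [big, shift]
  · simp [big, shift]

theorem big_sigma (s : A) : (big c).comp (sigma s) = (sigma (c s)).comp (big c) := by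
  apply Polynomial.ringHom_ext
  · intro a; simp [big, sigma]
  · simp [big, sigma]

theorem big_ez : (big c).comp (ez A[X]) = (ez K0[X]).comp (big c) := by
  apply Polynomial.ringHom_ext
  · intro a; simp [big, ez]
  · simp [big, ez]

theorem theta_mem [Has3 n] (hc : Function.Injective c) {α : GL n A[X]} {s : A}
    (hα : mp n (mapRingHom c) α ∈ El n (Is c s)) :
    ∃ N : ℕ, mp n (sigma (s ^ N)) (mp n (shift A) α * (mp n C α)⁻¹) ∈ El n (Set.univ : Set A[X][X]) := by
  set S : K0[X][X] := C (C (c s)) with hS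
  have hSD : S ∈ (big c).range := ⟨C (C s), by simp [big, hS]⟩
  set g := mp n (shift K0) (mp n (mapRingHom c) α) with hg
  have hgJ : g ∈ El n (Js c s) := by
    refine mp_mem _ ?_ hα
    rintro p ⟨r, q, h⟩
    refine ⟨r, shift A q, ?_⟩
    have h1 := congrArg (fun f => f q) (big_shift c)
    simp only [RingHom.comp_apply, coe_mapRingHom] at h1
    rw [h1, ← h, map_mul, map_pow]; simp [shift]
  set e := ez K0[X] with he
  have heJ : ∀ a ∈ Js c s, e a ∈ Js c s := by
    rintro a ⟨r, q, h⟩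
    refine ⟨r, ez A[X] q, ?_⟩
    have h1 := congrArg (fun f => f q) (big_ez c)
    simp only [RingHom.comp_apply] at h1
    rw [h1, h, map_mul, map_pow, ← he]; congr 2; simp [he, ez]
  have h1 := split_lemma (n := n) (Js c s) ?_ e heJ ?_ hgJ
  rotate_left
  · rintro a ⟨r, ha⟩ b ⟨r', hb⟩
    refine ⟨r + r', ?_⟩
    have : S ^ (r + r') * (a - b) = S ^ r' * (S ^ r * a) - S ^ r * (S ^ r' * b) := by ring
    rw [← hS, this]
    exact sub_mem (mul_mem (pow_mem hSD _) ha) (mul_mem (pow_mem hSD _) hb)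
  · intro a; simp [he, ez]
  have heg : mp n e g = mp n C (mp n (mapRingHom c) α) := by
    rw [hg, mp_comp]
    congr 2
    apply Polynomial.ringHom_ext
    · intro a; simp [he, ez, shift]
    · simp [he, ez, shift]
  rw [heg] at h1
  have h2 : ∀ y ∈ Subgroup.closure
      {y : GL n K0[X][X] | ∃ γ ∈ (El n (Js c s)).map (mp n e), ∃ i j : n, i ≠ j ∧ ∃ a ∈ Js c s, e a = 0 ∧
        y = γ * x i j a * γ⁻¹}, ∃ N0 : ℕ, ∀ N, N0 ≤ N →
          mp n (sigma (c s ^ N)) y ∈ El n ((big c).range : Set K0[X][X]) := by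
    intro y hy
    induction hy using Subgroup.closure_induction with
    | mem y hy =>
      obtain ⟨γ, ⟨γ', hγ', rfl⟩, i, j, hij, a, ⟨r, ha⟩, hea, rfl⟩ := hy
      have hγ : mp n e γ' ∈ El n (Js c s) := mp_mem e heJ hγ'
      obtain ⟨N1, hN1⟩ := lemK S (big c).range hSD hγ 0
      refine ⟨N1 + r, fun N hN => ?_⟩
      obtain ⟨M, rfl⟩ := Nat.exists_eq_add_of_le hN
      have e1 : mp n (sigma (c s ^ (N1 + r + M))) (mp n e γ') = mp n e γ' := by
        rw [mp_comp]; congr 2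
        apply Polynomial.ringHom_ext
        · intro a; simp [he, ez, sigma]
        · simp [he, ez, sigma]
      rw [map_mul, map_mul, map_inv, e1, mp_x]
      obtain ⟨a', rfl⟩ : X ∣ a := by
        rw [X_dvd_iff]
        have : C (a.eval 0) = (0 : K0[X][X]) := hea
        rw [C_eq_zero] at this
        rw [coeff_zero_eq_eval_zero]; exact this
      have ha' : S ^ r * a' ∈ (big c).range := by
        obtain ⟨q, hq⟩ := ha
        have : X ∣ q := by
          rw [X_dvd_iff]
          have h3 := congrArg (fun f => f.coeff 0) hq
          simp only [big, coe_mapRingHom, coeff_map, mul_coeff_zero, coeff_X_zero, zero_mul, mul_zero] at h3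
          exact (Polynomial.map_eq_zero_iff hc).1 h3
        obtain ⟨q', rfl⟩ := this
        refine ⟨q', ?_⟩
        have hX : big c X = X := by simp [big]
        rw [map_mul, hX] at hq
        apply mul_left_cancel₀ (X_ne_zero (R := K0[X]))
        rw [hq]; ring
      obtain ⟨q, hq⟩ := ha'
      have e2 : sigma (c s ^ (N1 + r + M)) (X * a') = S ^ N1 * (S ^ M * X * sigma (c s ^ (N1 + r + M)) (S ^ r * a')) := by
        have e3 : sigma (c s ^ (N1 + r + M)) S = S := by simp [sigma, hS]
        have e4 : sigma (c s ^ (N1 + r + M)) X = S ^ (N1 + r + M) * X := by simp [sigma, hS]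
        rw [map_mul, map_mul, map_pow, e3, e4]; ring
      rw [e2]
      have h3 := hN1 (x i j (S ^ N1 * (S ^ M * X * sigma (c s ^ (N1 + r + M)) (S ^ r * a')))) (x_mem _ _ ⟨_, ?_, rfl⟩)
      · refine El_mono ?_ h3
        rintro _ ⟨d, hd, rfl⟩
        simpa using hd
      · refine mul_mem (mul_mem (pow_mem hSD _) ⟨X, by simp [big]⟩) ?_
        rw [← hq]
        refine ⟨sigma (s ^ (N1 + r + M)) q, ?_⟩
        have h1 := congrArg (fun f => f q) (big_sigma c (s ^ (N1 + r + M)))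
        simp only [RingHom.comp_apply, map_pow] at h1
        exact h1
    | one => exact ⟨0, fun N _ => by rw [map_one]; exact one_mem _⟩
    | mul y z _ _ h h' =>
      obtain ⟨N, h⟩ := h
      obtain ⟨N', h'⟩ := h'
      refine ⟨max N N', fun M hM => ?_⟩
      rw [map_mul]
      exact mul_mem (h M (le_trans (le_max_left _ _) hM)) (h' M (le_trans (le_max_right _ _) hM))
    | inv y _ h =>
      obtain ⟨N, h⟩ := h
      exact ⟨N, fun M hM => by rw [map_inv]; exact inv_mem (h M hM)⟩
  obtain ⟨N, hN⟩ := h2 _ h1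
  refine ⟨N, ?_⟩
  have h3 := hN N le_rfl
  obtain ⟨z, hz, ez⟩ := El_lift (n := n) (big c) (I := Set.univ) (J := ((big c).range : Set K0[X][X]))
    (by rintro _ ⟨a, rfl⟩; exact ⟨a, Set.mem_univ _, rfl⟩) h3
  have : z = mp n (sigma (s ^ N)) (mp n (shift A) α * (mp n C α)⁻¹) := by
    apply mp_inj (big c) (big_inj c hc)
    have e9 : (big c).comp C = C.comp (mapRingHom c) := by
      exact RingHom.ext fun a => by simp [big]
    rw [ez, mp_comp (sigma (s ^ N)) (big c), big_sigma, ← mp_comp (big c), map_pow, map_mul (mp n (big c)),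
      map_inv (mp n (big c)), mp_comp (shift A) (big c), mp_comp C (big c),
      big_shift, e9, ← mp_comp _ (shift K0), ← mp_comp _ C]
  rw [← this]; exact hz

/-- the patching ideal -/
noncomputable def patch (α : GL n A[X]) : Ideal A where
  carrier := {s | ∀ b d : A, mp n (scl (b + s * d)) α * (mp n (scl b) α)⁻¹ ∈ El n (Set.univ : Set A[X])}
  zero_mem' := by intro b d; simp [one_mem]
  add_mem' := by
    intro s s' h h' b d
    have := mul_mem (h' (b + s * d) d) (h b d)
    rw [inv_mul_cancel_right_aux] at this
    convert this using 5
    ring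
  smul_mem' := by
    intro r s h b d
    have := h b (r * d)
    convert this using 5
    simp; ring
where
  inv_mul_cancel_right_aux {G : Type _} [Group G] {a b c : G} : a * b⁻¹ * (b * c⁻¹) = a * c⁻¹ := by group

theorem local_global [Has3 n] (hc : Function.Injective c) {α : GL n A[X]}
    (h : ∀ m : Ideal A, m.IsMaximal → mp n (mapRingHom c) α ∈
      El n {p : K0[X] | ∃ s ∉ m, ∃ q : A[X], C (c s) * p = q.map c}) :
    α * (mp n C (mp n (evalRingHom 0) α))⁻¹ ∈ El n (Set.univ : Set A[X]) := by
  have htop : patch α = ⊤ := by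
    by_contra hne
    obtain ⟨m, hm, hle⟩ := Ideal.exists_le_maximal _ hne
    have hp := hm.isPrime
    obtain ⟨s, hs, hg⟩ := exists_s c m (h m hm)
    obtain ⟨N, hN⟩ := theta_mem c hc hg
    apply hs
    apply hp.mem_of_pow_mem N
    apply hle
    intro b d
    generalize s ^ N = z at hN ⊢
    have h2 := mp_memU (eval₂RingHom (scl b) (C d * X)) hN
    convert h2 using 1
    rw [map_mul, map_mul, map_inv, map_inv, mp_comp, mp_comp, mp_comp, mp_comp]
    congr 2
    · congr 1
      apply Polynomial.ringHom_ext
      · intro a; simp [scl, sigma, shift]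
      · simp [scl, sigma, shift]; ring
    · congr 2
      apply Polynomial.ringHom_ext
      · intro a; simp [scl, sigma, shift]
      · simp [scl, sigma, shift]
  have h1 : (1 : A) ∈ patch α := by rw [htop]; trivial
  have h2 := h1 0 1
  convert h2 using 2
  · have : (scl ((0:A) + 1 * 1)) = RingHom.id _ := by
      apply Polynomial.ringHom_ext
      · intro a; simp [scl]
      · simp [scl]
    rw [this]; ext1; rfl
  · rw [mp_comp]; congr 3
    apply Polynomial.ringHom_ext
    · intro a; simp [scl]
    · simp [scl]

end LG
end CSB

namespace CSB
open Matrix Polynomial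
open scoped commutatorElement
set_option linter.all false

section PR
variable {K : Type*} [CommRing K]

theorem PRed.scale {a b : K} (h : PRed a b) : ∀ u v : Kˣ, PRed ((u : K) * a) ((v : K) * b) := by
  induction h with
  | zero c => intro u v; rw [mul_zero]; exact PRed.zero _
  | left a b r _ ih =>
    intro u v
    apply PRed.left _ _ ((u : K) * r * (v⁻¹ : Kˣ))
    have := ih u v
    convert this using 1
    have := v.inv_mul
    linear_combination (u * r * b) * this
  | right a b r _ ih =>
    intro u v
    apply PRed.right _ _ ((v : K) * r * (u⁻¹ : Kˣ))
    have := ih u v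
    convert this using 1
    have := u.inv_mul
    linear_combination (v * r * a) * this

theorem PRed.of_scale {a b : K} (u v : Kˣ) (h : PRed ((u : K) * a) ((v : K) * b)) : PRed a b := by
  have := h.scale u⁻¹ v⁻¹
  simpa [← mul_assoc] using this

theorem PRed.zero_left (b : K) : PRed 0 b := by
  apply PRed.left _ _ 1
  apply PRed.right _ _ (-1)
  have : b + -1 * (0 + 1 * b) = 0 := by ring
  rw [this]; exact PRed.zero _

theorem PRed.of_dvd {a b : K} (h : a ∣ b) : PRed a b := by
  obtain ⟨c, rfl⟩ := h
  apply PRed.right _ _ (-c)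
  have : a * c + -c * a = 0 := by ring
  rw [this]; exact PRed.zero _

variable {B : Type*} [CommRing B] (τ : B[X] →+* K)

theorem PRed.lift {g b0 : B} (h : PRed g b0) : ∀ a b : B[X], a.coeff 0 = g → b.coeff 0 = b0 →
    (∀ a' b' : B[X], Ideal.span {a'.coeff 0} = Ideal.span {g, b0} → PRed (τ a') (τ b')) →
    PRed (τ a) (τ b) := by
  induction h with
  | zero c =>
    intro a b ha hb H
    apply H
    rw [ha, Ideal.span_insert]; simp
  | left g b0 r _ ih =>
    intro a b ha hb H
    apply PRed.left _ _ (τ (C r))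
    rw [← map_mul, ← map_add]
    apply ih _ _ (by simp [ha, hb]) hb
    intro a' b' h
    apply H
    rw [h]
    apply le_antisymm
    · rw [Ideal.span_le]
      rintro z (rfl | rfl)
      · exact Ideal.add_mem _ (Ideal.subset_span (by simp)) (Ideal.mul_mem_left _ _ (Ideal.subset_span (by simp)))
      · exact Ideal.subset_span (by simp)
    · rw [Ideal.span_le]
      rintro z (rfl | rfl)
      · have : z = (z + r * b0) - r * b0 := by ring
        rw [this]
        exact Ideal.sub_mem _ (Ideal.subset_span (by simp)) (Ideal.mul_mem_left _ _ (Ideal.subset_span (by simp)))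
      · exact Ideal.subset_span (by simp)
  | right g b0 r _ ih =>
    intro a b ha hb H
    apply PRed.right _ _ (τ (C r))
    rw [← map_mul, ← map_add]
    apply ih _ _ ha (by simp [ha, hb])
    intro a' b' h
    apply H
    rw [h]
    apply le_antisymm
    · rw [Ideal.span_le]
      rintro z (rfl | rfl)
      · exact Ideal.subset_span (by simp)
      · exact Ideal.add_mem _ (Ideal.subset_span (by simp)) (Ideal.mul_mem_left _ _ (Ideal.subset_span (by simp)))
    · rw [Ideal.span_le]
      rintro z (rfl | rfl)
      · exact Ideal.subset_span (by simp)
      · have : z = (z + r * g) - r * g := by ring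
        rw [this]
        exact Ideal.sub_mem _ (Ideal.subset_span (by simp)) (Ideal.mul_mem_left _ _ (Ideal.subset_span (by simp)))

theorem PRed.main [IsDomain B] [IsNoetherianRing B] (hP : PRing B) (hX : IsUnit (τ X))
    (hW : ∀ w : B[X], w.coeff 0 = 1 → IsUnit (τ w)) : ∀ a b : B[X], PRed (τ a) (τ b) := by
  have key : ∀ I : Ideal B, ∀ a b : B[X], Ideal.span {a.coeff 0} = I → PRed (τ a) (τ b) := by
    intro I
    induction I using WellFoundedGT.induction with
    | ind I ih =>
    intro a b hI
    by_cases ha : a = 0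
    · rw [ha, map_zero]; exact PRed.zero_left _
    by_cases hg : a.coeff 0 = 0
    · obtain ⟨a1, h1, h2⟩ := exists_eq_pow_rootMultiplicity_mul_and_not_dvd a ha 0
      rw [C_0, sub_zero] at h1 h2
      obtain ⟨u, hu⟩ := hX.pow (rootMultiplicity 0 a)
      have h3 : PRed (τ a1) (τ b) := by
        apply ih _ _ a1 b rfl
        rw [← hI, hg]
        rw [X_dvd_iff] at h2
        refine lt_of_le_of_ne (by simp) ?_
        intro h4
        simp at h4
        exact h2 (Ideal.span_singleton_eq_bot.1 h4.symm)
      have := h3.scale u 1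
      rw [hu, ← map_pow, ← map_mul, ← h1] at this
      simpa using this
    by_cases hb : ∀ m : ℕ, b ∈ Ideal.span {a} ⊔ Ideal.span {X ^ m}
    · -- Krull
      have h1 : (Ideal.Quotient.mk (Ideal.span {a}) b) ∈
          (⨅ i : ℕ, (Ideal.span {(X : B[X])}) ^ i • ⊤ : Submodule B[X] (B[X] ⧸ Ideal.span {a})) := by
        rw [Submodule.mem_iInf]
        intro m
        obtain ⟨y, hy, z, hz, e⟩ := Submodule.mem_sup.1 (hb m)
        obtain ⟨q, rfl⟩ := Ideal.mem_span_singleton.1 hz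
        have : Ideal.Quotient.mk (Ideal.span {a}) b = (X ^ m : B[X]) • Ideal.Quotient.mk (Ideal.span {a}) q := by
          rw [← e, map_add, Ideal.Quotient.eq_zero_iff_mem.2 hy, zero_add, map_mul]; rfl
        rw [this]
        exact Submodule.smul_mem_smul (Ideal.pow_mem_pow (Ideal.mem_span_singleton_self X) m) trivial
      rw [Ideal.mem_iInf_smul_pow_eq_bot_iff] at h1
      obtain ⟨⟨r, hr⟩, h2⟩ := h1
      obtain ⟨q, rfl⟩ := Ideal.mem_span_singleton.1 hr
      have h3 : (1 - X * q) * b ∈ Ideal.span {a} := by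
        rw [← Ideal.Quotient.eq_zero_iff_mem, sub_mul, one_mul, map_sub, sub_eq_zero]
        exact h2.symm
      obtain ⟨z, hz⟩ := Ideal.mem_span_singleton.1 h3
      obtain ⟨u, hu⟩ := hW (1 - X * q) (by simp)
      apply PRed.of_scale 1 u
      rw [hu, ← map_mul, hz]
      apply PRed.of_dvd
      simp
    · push Not at hb
      classical
      have hm := Nat.find_spec hb
      have hmin := fun m => Nat.find_min hb (m := m)
      set M := Nat.find hb
      obtain _ | m := M
      · exact absurd (by rw [pow_zero, Ideal.span_singleton_one]; simp) hm
      · have h1 := hmin m (Nat.lt_succ_self m)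
        push Not at h1
        obtain ⟨y, hy, z, hz, e⟩ := Submodule.mem_sup.1 h1
        obtain ⟨q, rfl⟩ := Ideal.mem_span_singleton.1 hy
        obtain ⟨b', rfl⟩ := Ideal.mem_span_singleton.1 hz
        have h2 : b'.coeff 0 ∉ Ideal.span {a.coeff 0} := by
          intro h3
          obtain ⟨d, hd⟩ := Ideal.mem_span_singleton.1 h3
          apply hm
          have h4 : X ∣ b' - a * C d := by rw [X_dvd_iff]; simp [hd]
          obtain ⟨v, hv⟩ := h4
          have : b = a * (q + X ^ m * C d) + X ^ (m + 1) * v := by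
            rw [← e]; linear_combination X ^ m * hv
          rw [this]
          exact Submodule.add_mem_sup (Ideal.mem_span_singleton.2 ⟨_, rfl⟩) (Ideal.mem_span_singleton.2 ⟨_, rfl⟩)
        apply PRed.right _ _ (τ (-q))
        have e2 : τ b + τ (-q) * τ a = τ (X ^ m) * τ b' := by
          rw [← map_mul, ← map_add, ← map_mul, ← e]; congr 1; ring
        rw [e2]
        obtain ⟨u, hu⟩ := hX.pow m
        rw [map_pow, ← hu]
        have h5 : PRed (τ a) (τ b') := by
          apply PRed.lift τ (hP (a.coeff 0) (b'.coeff 0)) a b' rfl rfl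
          intro a' b'' h6
          apply ih _ _ a' b'' rfl
          rw [h6, ← hI]
          refine lt_of_le_of_ne (Ideal.span_mono (by simp)) ?_
          intro h7
          apply h2
          rw [h7]; exact Ideal.subset_span (by simp)
        simpa using h5.scale 1 u
  exact fun a b => key _ a b rfl

/-- monic polynomials -/
def Mo (B : Type*) [CommRing B] : Submonoid B[X] where
  carrier := {f | f.Monic}
  one_mem' := monic_one
  mul_mem' := fun h h' => h.mul h'

/-- B(X) -/
abbrev BX (B : Type*) [CommRing B] := Localization (Mo B)

theorem Mo_le (B : Type*) [CommRing B] [IsDomain B] : Mo B ≤ nonZeroDivisors B[X] :=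
  fun f hf => mem_nonZeroDivisors_of_ne_zero (Monic.ne_zero hf)

instance BX_dom [IsDomain B] : IsDomain (BX B) := IsLocalization.isDomain_localization (Mo_le B)
instance BX_noeth [IsNoetherianRing B] : IsNoetherianRing (BX B) := IsLocalization.isNoetherianRing (Mo B) _ inferInstance

theorem BX_PRing [IsDomain B] [IsNoetherianRing B] (hP : PRing B) : PRing (BX B) := by
  have hmon : ∀ f : B[X], f.Monic → IsUnit (algebraMap B[X] (BX B) f) := fun f hf =>
    IsLocalization.map_units (BX B) (⟨f, hf⟩ : Mo B)
  obtain ⟨y, hy⟩ := hmon X monic_X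
  set φ : B →+* BX B := (algebraMap B[X] (BX B)).comp C with hφ
  set τ : B[X] →+* BX B := eval₂RingHom φ (y⁻¹ : (BX B)ˣ).val with hτ
  have hev : ∀ f : B[X], eval₂ φ y.val f = algebraMap B[X] (BX B) f := by
    intro f
    have : eval₂RingHom φ y.val = algebraMap B[X] (BX B) := by
      apply Polynomial.ringHom_ext
      · intro a; simp [hφ]
      · simp [hy]
    exact congrArg (fun g => g f) this
  have hX : IsUnit (τ X) := by simp [hτ]
  letI : Invertible y.val := y.invertible
  letI : Invertible (y⁻¹ : (BX B)ˣ).val := (y⁻¹).invertible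
  have hrev1 : ∀ f : B[X], algebraMap B[X] (BX B) f = τ f.reverse * y.val ^ f.natDegree := by
    intro f
    have h := eval₂_reverse_mul_pow φ y.val f
    rw [hev] at h
    rw [← h]
    simp [hτ]
  have hrev2 : ∀ f : B[X], τ f = algebraMap B[X] (BX B) f.reverse * (y⁻¹ : (BX B)ˣ).val ^ f.natDegree := by
    intro f
    have h := eval₂_reverse_mul_pow φ (y⁻¹ : (BX B)ˣ).val f
    rw [← hev]
    rw [hτ, coe_eval₂RingHom, ← h]
    simp
  have hW : ∀ w : B[X], w.coeff 0 = 1 → IsUnit (τ w) := by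
    intro w hw
    rw [hrev2]
    apply IsUnit.mul
    · apply hmon
      rw [Monic, reverse_leadingCoeff, trailingCoeff, natTrailingDegree_eq_zero.2 (Or.inr (by simp [hw])), hw]
    · exact (Units.isUnit _).pow _
  have main := PRed.main τ hP hX hW
  have hform : ∀ z : BX B, ∃ (u : (BX B)ˣ) (p : B[X]), z = u * τ p := by
    intro z
    obtain ⟨⟨f, s⟩, h⟩ := IsLocalization.surj (Mo B) z
    obtain ⟨v, hv⟩ := hmon s.1 s.2
    refine ⟨v⁻¹ * y ^ f.natDegree, f.reverse, ?_⟩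
    simp only at h
    rw [← hv, hrev1 f] at h
    rw [Units.val_mul, mul_assoc, Units.eq_inv_mul_iff_mul_eq, mul_comm, h]
    simp [mul_comm]
  intro a b
  obtain ⟨u, p, rfl⟩ := hform a
  obtain ⟨v, q, rfl⟩ := hform b
  exact (main p q).scale u v

end PR
end CSB

namespace CSB
open Matrix Polynomial
open scoped commutatorElement
set_option linter.all false

section Sus
variable {n : Type} [Fintype n] [DecidableEq n]

theorem mp_det {A B : Type*} [CommRing A] [CommRing B] (f : A →+* B) {g : GL n A} (h : g.val.det = 1) :
    (mp n f g).val.det = 1 := by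
  rw [mp_val]
  have := RingHom.map_det f g.val
  rw [h, map_one] at this
  exact this.symm

theorem SLE_equiv {A B : Type*} [CommRing A] [CommRing B] (e : A ≃+* B) (h : SLE n A) : SLE n B := by
  intro g hg
  have h1 := h _ (mp_det (e.symm : B →+* A) hg)
  have h2 := mp_memU (e : A →+* B) h1
  rw [mp_comp] at h2
  convert h2
  ext1; ext1 i j
  simp [mp_val]

theorem clear_den {A : Type*} [CommRing A] (m : Ideal A) [m.IsPrime] (p : (Localization.AtPrime m)[X]) :
    ∃ s ∉ m, ∃ q : A[X], C (algebraMap A (Localization.AtPrime m) s) * p = q.map (algebraMap A (Localization.AtPrime m)) := by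
  induction p using Polynomial.induction_on' with
  | add p q hp hq =>
    obtain ⟨s, hs, p', e⟩ := hp
    obtain ⟨t, ht, q', e'⟩ := hq
    refine ⟨s * t, fun h => (Ideal.IsPrime.mem_or_mem ‹_› h).elim hs ht, C t * p' + C s * q', ?_⟩
    simp only [Polynomial.map_add, Polynomial.map_mul, ← e, ← e', map_C, map_mul]; ring
  | monomial k a =>
    obtain ⟨⟨b, s⟩, h⟩ := IsLocalization.surj m.primeCompl a
    refine ⟨s.1, s.2, monomial k b, ?_⟩
    rw [C_mul_monomial, map_monomial, ← h, mul_comm]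

theorem Fm_add {A : Type*} [CommRing A] {K : Type*} [Field K] (j : A[X] →+* K) {a b : K} (ha : a ∈ Fm j) (hb : b ∈ Fm j) :
    a + b ∈ Fm j := by
  obtain ⟨f, g, hf, e⟩ := ha
  obtain ⟨f', g', hf', e'⟩ := hb
  exact ⟨f * f', g * f' + f * g', hf.mul hf', by simp only [map_mul, map_add, ← e, ← e']; ring⟩

theorem Fm_mul {A : Type*} [CommRing A] {K : Type*} [Field K] (j : A[X] →+* K) {a b : K} (ha : a ∈ Fm j) (hb : b ∈ Fm j) :
    a * b ∈ Fm j := by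
  obtain ⟨f, g, hf, e⟩ := ha
  obtain ⟨f', g', hf', e'⟩ := hb
  exact ⟨f * f', g * g', hf.mul hf', by simp only [map_mul, ← e, ← e']; ring⟩

theorem Fm_im {A : Type*} [CommRing A] {K : Type*} [Field K] (j : A[X] →+* K) (f : A[X]) : j f ∈ Fm j :=
  ⟨1, f, monic_one, by simp⟩

theorem loc_apply {A Am K0 : Type*} [CommRing A] [CommRing Am] [CommRing K0] (ρ : A →+* Am) (ν : Am →+* K0)
    (c : A →+* K0) (hc : ∀ a, ν (ρ a) = c a) {J : Set K0[X]} {α : GL n A[X]}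
    (h6 : mp n (mapRingHom ρ) α ∈ El n (Set.univ : Set Am[X])) (h : ∀ p : Am[X], p.map ν ∈ J) :
    mp n (mapRingHom c) α ∈ El n J := by
  have h9 := mp_mem (mapRingHom ν) (J := J) (fun p _ => h p) h6
  have h10 : (mapRingHom ν).comp (mapRingHom ρ) = mapRingHom c := by
    rw [mapRingHom_comp]; congr 1; exact RingHom.ext hc
  rw [mp_comp, h10] at h9
  exact h9

theorem suslin_step [Has3 n] {B : Type} [CommRing B] [IsDomain B] (m : ℕ)
    (h1 : SLE n (MvPolynomial (Fin m) B)) (h2 : SLE n (MvPolynomial (Fin m) (BX B))) :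
    SLE n (MvPolynomial (Fin m) B)[X] := by
  intro α hα
  let K0 := FractionRing (MvPolynomial (Fin m) B)
  let c : (MvPolynomial (Fin m) B) →+* K0 := algebraMap (MvPolynomial (Fin m) B) K0
  have hc : Function.Injective c := IsFractionRing.injective (MvPolynomial (Fin m) B) K0
  let K := FractionRing K0[X]
  let J : K0[X] →+* K := algebraMap K0[X] K
  have hJ : Function.Injective J := IsFractionRing.injective K0[X] K
  let j : (MvPolynomial (Fin m) B)[X] →+* K := J.comp (mapRingHom c)
  have hj : Function.Injective j := hJ.comp (Polynomial.map_injective _ hc)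
  -- step 1
  have s1 : mp n j α ∈ El n (Fm j) := by
    let i0 : B[X] →+* K := j.comp (mapRingHom MvPolynomial.C)
    have hi0 : ∀ s : Mo B, IsUnit (i0 s) := by
      intro s
      rw [isUnit_iff_ne_zero]
      have hm : (s.1.map (MvPolynomial.C : B →+* (MvPolynomial (Fin m) B))).Monic := Monic.map _ s.2
      exact (map_ne_zero_iff j hj).2 hm.ne_zero
    let κ : BX B →+* K := IsLocalization.lift (M := Mo B) hi0
    have hκ : ∀ p, κ (algebraMap B[X] (BX B) p) = i0 p := fun p => IsLocalization.lift_eq hi0 p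
    let ψ : MvPolynomial (Fin m) (BX B) →+* K := MvPolynomial.eval₂Hom κ (fun i => j (C (MvPolynomial.X i)))
    let χ : (MvPolynomial (Fin m) B)[X] →+* MvPolynomial (Fin m) (BX B) :=
      eval₂RingHom (MvPolynomial.map ((algebraMap B[X] (BX B)).comp C)) (MvPolynomial.C (algebraMap B[X] (BX B) X))
    have hψχ : ψ.comp χ = j := by
      apply Polynomial.ringHom_ext'
      · apply MvPolynomial.ringHom_ext
        · intro b; simp [ψ, χ, hκ, i0]
        · intro i; simp [ψ, χ]
      · simp [ψ, χ, hκ, i0]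
    have hψ : ∀ p, ψ p ∈ Fm j := by
      intro p
      induction p using MvPolynomial.induction_on with
      | C z =>
        obtain ⟨⟨f, s⟩, h⟩ := IsLocalization.surj (Mo B) z
        refine ⟨s.1.map MvPolynomial.C, f.map MvPolynomial.C, Monic.map _ s.2, ?_⟩
        have h3 := congrArg κ h
        simp only [map_mul, hκ, i0, RingHom.comp_apply, coe_mapRingHom] at h3
        rw [← h3, mul_comm]; simp [ψ]
      | add p q hp hq => rw [map_add]; exact Fm_add j hp hq
      | mul_X p i hp =>
        rw [map_mul]
        refine Fm_mul j hp ?_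
        simp only [ψ, MvPolynomial.coe_eval₂Hom, MvPolynomial.eval₂_X]
        exact Fm_im j _
    have h3 := mp_mem ψ (fun a _ => hψ a) (h2 _ (mp_det χ hα))
    rwa [mp_comp, hψχ] at h3
  have s2 := local_global (α := α) c hc ?_
  · have h3 := h1 _ (mp_det (evalRingHom 0) hα)
    have h4 := mul_mem s2 (mp_memU C h3)
    rwa [inv_mul_cancel_right] at h4
  · intro 𝔪 h𝔪
    have hp := h𝔪.isPrime
    let Am := Localization.AtPrime 𝔪
    have hu : ∀ y : 𝔪.primeCompl, IsUnit (c y) := by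
      intro y
      rw [isUnit_iff_ne_zero, map_ne_zero_iff c hc]
      intro h0
      exact y.2 (by rw [h0]; exact 𝔪.zero_mem)
    let ν : Am →+* K0 := IsLocalization.lift (M := 𝔪.primeCompl) hu
    have hν : ∀ a, ν (algebraMap (MvPolynomial (Fin m) B) Am a) = c a := fun a => IsLocalization.lift_eq hu a
    have hνi : Function.Injective ν := by
      rw [injective_iff_map_eq_zero]
      intro z hz
      obtain ⟨⟨b, s⟩, h⟩ := IsLocalization.surj 𝔪.primeCompl z
      have h3 := congrArg ν h
      simp only [map_mul, hz, zero_mul] at h3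
      erw [hν] at h3
      rw [eq_comm, map_eq_zero_iff c hc] at h3
      simp only [h3, map_zero] at h
      exact (IsUnit.mul_left_eq_zero (IsLocalization.map_units _ s)).1 h
    have hcomp : (mapRingHom ν).comp (mapRingHom (algebraMap (MvPolynomial (Fin m) B) Am)) = mapRingHom c := by
      rw [mapRingHom_comp]; congr 1; exact RingHom.ext hν
    let jm' : Am[X] →+* K := J.comp (mapRingHom ν)
    have hjm : Function.Injective jm' := hJ.comp (Polynomial.map_injective _ hνi)
    have hjj : jm'.comp (mapRingHom (algebraMap (MvPolynomial (Fin m) B) Am)) = j := by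
      simp only [jm', j, RingHom.comp_assoc, hcomp]
    have hF : Fm j ⊆ Fm jm' := by
      rintro a ⟨f, g, hf, e⟩
      refine ⟨f.map (algebraMap (MvPolynomial (Fin m) B) Am), g.map (algebraMap (MvPolynomial (Fin m) B) Am), hf.map _, ?_⟩
      have h5 : ∀ p, jm' (p.map (algebraMap (MvPolynomial (Fin m) B) Am)) = j p := fun p => congrArg (fun h => h p) hjj
      rw [h5, h5, e]
    have h6 : mp n (mapRingHom (algebraMap (MvPolynomial (Fin m) B) Am)) α ∈ El n (Set.univ : Set Am[X]) := by
      apply monic_inversion jm' hjm (mp_det _ hα)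
      rw [mp_comp, hjj]
      exact El_mono hF s1
    refine loc_apply (algebraMap (MvPolynomial (Fin m) B) Am) ν c hν h6 ?_
    intro p
    obtain ⟨s, hs, q, e⟩ := clear_den 𝔪 p
    refine ⟨s, hs, q, ?_⟩
    have h7 := congrArg (Polynomial.map ν) e
    rw [Polynomial.map_mul, map_C, hν, Polynomial.map_map] at h7
    have h8 : ν.comp (algebraMap (MvPolynomial (Fin m) B) Am) = c := RingHom.ext hν
    rw [h8] at h7
    exact h7

theorem suslin [Has3 n] (m : ℕ) : ∀ (B : Type) [CommRing B] [IsDomain B] [IsNoetherianRing B], PRing B →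
    SLE n (MvPolynomial (Fin m) B) := by
  induction m with
  | zero =>
    intro B _ _ _ hP
    exact SLE_equiv (MvPolynomial.isEmptyRingEquiv B (Fin 0)).symm (sle_PRing hP)
  | succ m ih =>
    intro B _ _ _ hP
    exact SLE_equiv (MvPolynomial.finSuccEquiv B m).toRingEquiv.symm
      (suslin_step m (ih B hP) (ih (BX B) (BX_PRing hP)))

end Sus
end CSB

namespace CSB
open Matrix
open scoped commutatorElement
set_option linter.all false

/-- A Steinberg system: a group generated by elements satisfying the Steinberg relations. -/
structure St (n : Type*) (S : Type*) [CommRing S] (G : Type*) [Group G] where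
  x : n → n → S → G
  add : ∀ i j, i ≠ j → ∀ a b, x i j (a + b) = x i j a * x i j b
  comm : ∀ i j k l, i ≠ j → k ≠ l → j ≠ k → i ≠ l → ∀ a b, x i j a * x k l b = x k l b * x i j a
  mul3 : ∀ i j k, i ≠ j → j ≠ k → i ≠ k → ∀ a b, ⁅x i j a, x j k b⁆ = x i k (a * b)
  gen : ∀ H : Subgroup G, (∀ i j, i ≠ j → ∀ a, x i j a ∈ H) → ∀ g, g ∈ H

namespace St
section
variable {n : Type*} [DecidableEq n] {S : Type*} [CommRing S] {G : Type*} [Group G] (X : St n S G)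

theorem zero {i j : n} (h : i ≠ j) : X.x i j 0 = 1 := by
  have := X.add i j h 0 0
  simpa using this

theorem neg {i j : n} (h : i ≠ j) (a : S) : X.x i j (-a) = (X.x i j a)⁻¹ := by
  have := X.add i j h a (-a)
  rw [add_neg_cancel, X.zero h] at this
  exact eq_inv_of_mul_eq_one_right this.symm

/-- conjugation -/
abbrev cj (g : G) : G →* G := (MulAut.conj g).toMonoidHom

theorem cj_apply (g y : G) : cj g y = g * y * g⁻¹ := rfl
theorem cj_mul (g h y : G) : cj (g * h) y = cj g (cj h y) := by
  simp only [cj_apply]; group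
theorem cj_inv (g y z : G) (h : cj g y = z) : cj g⁻¹ z = y := by
  rw [← h]; simp only [cj_apply]; group

theorem cj_fix {i j k l : n} (hij : i ≠ j) (hkl : k ≠ l) (h1 : j ≠ k) (h2 : i ≠ l) (a b : S) :
    cj (X.x i j a) (X.x k l b) = X.x k l b := by
  rw [cj_apply, X.comm i j k l hij hkl h1 h2, mul_inv_cancel_right]

/-- column plane -/
def V (i j k : n) (p q : S) : G := X.x i k p * X.x j k q
/-- row plane -/
def W (i j k : n) (p q : S) : G := X.x k i p * X.x k j q

theorem cj_V1 {i j k : n} (hij : i ≠ j) (hik : i ≠ k) (hjk : j ≠ k) (a p q : S) :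
    cj (X.x i j a) (X.V i j k p q) = X.V i j k (p + a * q) q := by
  unfold V
  rw [map_mul, X.cj_fix hij hik hij.symm hik, cj_apply, X.add i k hik, ← X.mul3 i j k hij hjk hik,
    commutatorElement_def]
  group

theorem V_swap {i j k : n} (hij : i ≠ j) (hik : i ≠ k) (hjk : j ≠ k) (p q : S) :
    X.V i j k p q = X.V j i k q p := X.comm i k j k hik hjk hjk.symm hik _ _

theorem W_swap {i j k : n} (hij : i ≠ j) (hik : i ≠ k) (hjk : j ≠ k) (p q : S) :
    X.W i j k p q = X.W j i k q p := X.comm k i k j hik.symm hjk.symm hik hjk.symm _ _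

theorem cj_V2 {i j k : n} (hij : i ≠ j) (hik : i ≠ k) (hjk : j ≠ k) (a p q : S) :
    cj (X.x j i a) (X.V i j k p q) = X.V i j k p (q + a * p) := by
  rw [X.V_swap hij hik hjk, X.cj_V1 hij.symm hjk hik, X.V_swap hij.symm hjk hik]

theorem cj_W2 {i j k : n} (hij : i ≠ j) (hik : i ≠ k) (hjk : j ≠ k) (a p q : S) :
    cj (X.x j i a) (X.W i j k p q) = X.W i j k (p - q * a) q := by
  unfold W
  rw [map_mul, X.cj_fix hij.symm hik.symm hik hij.symm, sub_eq_add_neg, X.add k i hik.symm, X.neg hik.symm,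
    ← X.mul3 k j i hjk.symm hij.symm hik.symm, cj_apply, commutatorElement_def]
  group

theorem cj_W1 {i j k : n} (hij : i ≠ j) (hik : i ≠ k) (hjk : j ≠ k) (a p q : S) :
    cj (X.x i j a) (X.W i j k p q) = X.W i j k p (q - p * a) := by
  rw [X.W_swap hij hik hjk, X.cj_W2 hij.symm hjk hik, X.W_swap hij.symm hjk hik]

/-- monomial elements -/
def Mon (T : G) (σ : Equiv.Perm n) (χ : n → Sˣ) : Prop :=
  ∀ i j, i ≠ j → ∀ a : S, cj T (X.x i j a) = X.x (σ i) (σ j) ((χ i : S) * a * ((χ j)⁻¹ : Sˣ))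

/-- A plane element acting monomially is Mon. -/
theorem mon_of_plane [Has3 n] {i j : n} (hij : i ≠ j) {T : G} (σ : Equiv.Perm n) (χ : n → Sˣ)
    (hT : T ∈ Subgroup.closure {g | ∃ a, g = X.x i j a ∨ g = X.x j i a})
    (hσ : ∀ k, k ≠ i → k ≠ j → σ k = k) (hχ : ∀ k, k ≠ i → k ≠ j → χ k = 1)
    (h1 : ∀ k, k ≠ i → k ≠ j → ∀ p, cj T (X.x i k p) = X.x (σ i) k (χ i * p))
    (h2 : ∀ k, k ≠ i → k ≠ j → ∀ p, cj T (X.x j k p) = X.x (σ j) k (χ j * p))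
    (h3 : ∀ k, k ≠ i → k ≠ j → ∀ p, cj T (X.x k i p) = X.x k (σ i) (p * ((χ i)⁻¹ : Sˣ)))
    (h4 : ∀ k, k ≠ i → k ≠ j → ∀ p, cj T (X.x k j p) = X.x k (σ j) (p * ((χ j)⁻¹ : Sˣ))) :
    X.Mon T σ χ := by
  have hfix : ∀ k l, k ≠ l → k ≠ i → k ≠ j → l ≠ i → l ≠ j → ∀ a, cj T (X.x k l a) = X.x k l a := by
    intro k l hkl hki hkj hli hlj a
    have : T ∈ Subgroup.centralizer {X.x k l a} := by
      refine (Subgroup.closure_le _).2 ?_ hT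
      rintro g ⟨b, rfl | rfl⟩ <;> rw [SetLike.mem_coe, Subgroup.mem_centralizer_singleton_iff]
      · exact X.comm _ _ _ _ hij hkl hkj.symm hli.symm _ _
      · exact X.comm _ _ _ _ hij.symm hkl hki.symm hlj.symm _ _
    rw [Subgroup.mem_centralizer_singleton_iff] at this
    rw [cj_apply, this, mul_inv_cancel_right]
  have hσi : ∀ k, k ≠ i → k ≠ j → σ i ≠ k := fun k hi hj h => by
    have := hσ k hi hj; rw [← h] at this; exact hi (h ▸ (σ.injective this))
  have hσj : ∀ k, k ≠ i → k ≠ j → σ j ≠ k := fun k hi hj h => by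
    have := hσ k hi hj; rw [← h] at this; exact hj (h ▸ (σ.injective this))
  intro k l hkl a
  by_cases hki : k = i
  · subst hki
    by_cases hlj : l = j
    · subst hlj
      obtain ⟨m, hm1, hm2⟩ := Has3.third k l
      have : X.x k l a = ⁅X.x k m a, X.x m l 1⁆ := by rw [X.mul3 _ _ _ hm1.symm hm2 hkl, mul_one]
      rw [this, map_commutatorElement, h1 m hm1 hm2, h4 m hm1 hm2,
        X.mul3 _ _ _ (hσi m hm1 hm2) (hσj m hm1 hm2).symm (σ.injective.ne hkl), one_mul]
    · rw [h1 l hkl.symm hlj, hχ l hkl.symm hlj, hσ l hkl.symm hlj]; simp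
  by_cases hkj : k = j
  · subst hkj
    by_cases hli : l = i
    · subst hli
      obtain ⟨m, hm1, hm2⟩ := Has3.third l k
      have : X.x k l a = ⁅X.x k m a, X.x m l 1⁆ := by rw [X.mul3 _ _ _ hm2.symm hm1 hkl, mul_one]
      rw [this, map_commutatorElement, h2 m hm1 hm2, h3 m hm1 hm2,
        X.mul3 _ _ _ (hσj m hm1 hm2) (hσi m hm1 hm2).symm (σ.injective.ne hkl), one_mul]
    · rw [h2 l hli hkl.symm, hχ l hli hkl.symm, hσ l hli hkl.symm]; simp
  rw [hσ k hki hkj, hχ k hki hkj]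
  by_cases hli : l = i
  · subst hli; rw [h3 k hki hkj]; simp
  by_cases hlj : l = j
  · subst hlj; rw [h4 k hki hkj]; simp
  rw [hfix k l hkl hki hkj hli hlj, hσ l hli hlj, hχ l hli hlj]; simp

theorem V_left {i j k : n} (hjk : j ≠ k) (p : S) : X.x i k p = X.V i j k p 0 := by
  simp [V, X.zero hjk]
theorem V_right {i j k : n} (hik : i ≠ k) (p : S) : X.x j k p = X.V i j k 0 p := by
  simp [V, X.zero hik]
theorem W_left {i j k : n} (hjk : j ≠ k) (p : S) : X.x k i p = X.W i j k p 0 := by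
  simp [W, X.zero hjk.symm]
theorem W_right {i j k : n} (hik : i ≠ k) (p : S) : X.x k j p = X.W i j k 0 p := by
  simp [W, X.zero hik.symm]

/-- torus character of `H` -/
def tch (i j : n) (u : Sˣ) : n → Sˣ := fun k => if k = i then u else if k = j then u⁻¹ else 1
/-- character of `w` -/
def wch (i j : n) (u : Sˣ) : n → Sˣ := fun k => if k = i then -u⁻¹ else if k = j then u else 1

def H (i j : n) (u : Sˣ) (a b : S) : G :=
  X.x j i (-((u⁻¹ : Sˣ) * b)) * X.x i j a * X.x j i b * X.x i j (-((u⁻¹ : Sˣ) * a))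

def w (i j : n) (u : Sˣ) : G :=
  X.x i j u * X.x j i (-(u⁻¹ : Sˣ)) * X.x i j u

def h (i j : n) (u : Sˣ) : G := X.H i j u (u - 1) 1

def sym (i j : n) (u v : Sˣ) : G := X.h i j (u * v) * (X.h i j u)⁻¹ * (X.h i j v)⁻¹

theorem mon_H [Has3 n] {i j : n} (hij : i ≠ j) {u : Sˣ} {a b : S} (hu : (u : S) = 1 + a * b) :
    X.Mon (X.H i j u a b) 1 (tch i j u) := by
  have e := u.mul_inv
  have mm : ∀ a, X.x i j a ∈ Subgroup.closure {g | ∃ a, g = X.x i j a ∨ g = X.x j i a} :=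
    fun a => Subgroup.subset_closure ⟨a, Or.inl rfl⟩
  have mm' : ∀ a, X.x j i a ∈ Subgroup.closure {g | ∃ a, g = X.x i j a ∨ g = X.x j i a} :=
    fun a => Subgroup.subset_closure ⟨a, Or.inr rfl⟩
  have hV : ∀ k, k ≠ i → k ≠ j → ∀ p q, cj (X.H i j u a b) (X.V i j k p q) = X.V i j k (u * p) ((u⁻¹ : Sˣ) * q) := by
    intro k hki hkj p q
    rw [H, cj_mul, cj_mul, cj_mul, X.cj_V1 hij hki.symm hkj.symm, X.cj_V2 hij hki.symm hkj.symm,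
      X.cj_V1 hij hki.symm hkj.symm, X.cj_V2 hij hki.symm hkj.symm]
    congr 1 <;> grind
  have hW : ∀ k, k ≠ i → k ≠ j → ∀ p q, cj (X.H i j u a b) (X.W i j k p q) = X.W i j k (p * (u⁻¹ : Sˣ)) (q * u) := by
    intro k hki hkj p q
    rw [H, cj_mul, cj_mul, cj_mul, X.cj_W1 hij hki.symm hkj.symm, X.cj_W2 hij hki.symm hkj.symm,
      X.cj_W1 hij hki.symm hkj.symm, X.cj_W2 hij hki.symm hkj.symm]
    congr 1 <;> grind
  refine X.mon_of_plane hij 1 _ (mul_mem (mul_mem (mul_mem (mm' _) (mm _)) (mm' _)) (mm _)) (fun _ _ _ => rfl)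
    (fun k h1 h2 => by simp [tch, h1, h2]) ?_ ?_ ?_ ?_ <;> intro k hki hkj p
  · rw [X.V_left hkj.symm, hV k hki hkj, mul_zero, ← X.V_left hkj.symm]; simp [tch]
  · rw [X.V_right hki.symm, hV k hki hkj, mul_zero, ← X.V_right hki.symm]; simp [tch, hij.symm]
  · rw [X.W_left hkj.symm, hW k hki hkj, zero_mul, ← X.W_left hkj.symm]; simp [tch]
  · rw [X.W_right hki.symm, hW k hki hkj, zero_mul, ← X.W_right hki.symm]; simp [tch, hij.symm]

theorem mon_w [Has3 n] {i j : n} (hij : i ≠ j) (u : Sˣ) :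
    X.Mon (X.w i j u) (Equiv.swap i j) (wch i j u) := by
  have e := u.mul_inv
  have mm : ∀ a, X.x i j a ∈ Subgroup.closure {g | ∃ a, g = X.x i j a ∨ g = X.x j i a} :=
    fun a => Subgroup.subset_closure ⟨a, Or.inl rfl⟩
  have mm' : ∀ a, X.x j i a ∈ Subgroup.closure {g | ∃ a, g = X.x i j a ∨ g = X.x j i a} :=
    fun a => Subgroup.subset_closure ⟨a, Or.inr rfl⟩
  have hV : ∀ k, k ≠ i → k ≠ j → ∀ p q, cj (X.w i j u) (X.V i j k p q) = X.V i j k (u * q) (-(u⁻¹ : Sˣ) * p) := by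
    intro k hki hkj p q
    rw [w, cj_mul, cj_mul, X.cj_V1 hij hki.symm hkj.symm, X.cj_V2 hij hki.symm hkj.symm,
      X.cj_V1 hij hki.symm hkj.symm]
    congr 1 <;> grind
  have hW : ∀ k, k ≠ i → k ≠ j → ∀ p q, cj (X.w i j u) (X.W i j k p q) = X.W i j k (q * (u⁻¹ : Sˣ)) (p * (-u)) := by
    intro k hki hkj p q
    rw [w, cj_mul, cj_mul, X.cj_W1 hij hki.symm hkj.symm, X.cj_W2 hij hki.symm hkj.symm,
      X.cj_W1 hij hki.symm hkj.symm]
    congr 1 <;> grind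
  refine X.mon_of_plane hij _ _ (mul_mem (mul_mem (mm _) (mm' _)) (mm _))
    (fun k h1 h2 => Equiv.swap_apply_of_ne_of_ne h1 h2)
    (fun k h1 h2 => by simp [wch, h1, h2]) ?_ ?_ ?_ ?_ <;> intro k hki hkj p
  · rw [X.V_left hkj.symm, hV k hki hkj, mul_zero, ← X.V_right hki.symm]; simp [wch]
  · rw [X.V_right hki.symm, hV k hki hkj, mul_zero, ← X.V_left hkj.symm]; simp [wch, hij.symm]
  · rw [X.W_left hkj.symm, hW k hki hkj, zero_mul, ← X.W_right hki.symm]; simp [wch]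
  · rw [X.W_right hki.symm, hW k hki hkj, zero_mul, ← X.W_left hkj.symm]; simp [wch, hij.symm]

theorem mon_conj_H {T : G} {σ : Equiv.Perm n} {χ : n → Sˣ} (hT : X.Mon T σ χ) {i j : n} (hij : i ≠ j)
    (u : Sˣ) (a b : S) :
    cj T (X.H i j u a b) = X.H (σ i) (σ j) u (χ i * a * ((χ j)⁻¹ : Sˣ)) (χ j * b * ((χ i)⁻¹ : Sˣ)) := by
  simp only [H, map_mul, hT i j hij, hT j i hij.symm]
  congr 3 <;> ring_nf

theorem H_inv (i j : n) (hij : i ≠ j) (u : Sˣ) (a b : S) : (X.H i j u a b)⁻¹ = X.H j i u (-b) (-a) := by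
  simp only [H, X.neg hij, X.neg hij.symm, mul_neg]
  group

theorem mon_central [Has3 n] {T : G} (hT : X.Mon T 1 1) : ∀ g, T * g = g * T := by
  intro g
  have := X.gen (Subgroup.centralizer {T}) ?_ g
  · exact (Subgroup.mem_centralizer_singleton_iff.1 this).symm
  · intro i j hij a
    rw [Subgroup.mem_centralizer_singleton_iff]
    have := hT i j hij a
    rw [cj_apply] at this
    have h2 : X.x i j a = T * X.x i j a * T⁻¹ := by rw [this]; simp
    have h3 : X.x i j a * T = T * X.x i j a := by
      conv_lhs => rw [h2]
      group
    exact h3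

theorem Mon.mul {T T' : G} {χ χ' : n → Sˣ} (hT : X.Mon T 1 χ) (hT' : X.Mon T' 1 χ') :
    X.Mon (T * T') 1 (χ * χ') := by
  intro i j hij a
  rw [cj_mul, hT' i j hij, Equiv.Perm.one_apply, Equiv.Perm.one_apply, hT i j hij]
  simp only [Pi.mul_apply, Units.val_mul, _root_.mul_inv_rev, Equiv.Perm.one_apply]
  congr 1; ring

theorem Mon.inv {T : G} {χ : n → Sˣ} (hT : X.Mon T 1 χ) : X.Mon T⁻¹ 1 χ⁻¹ := by
  intro i j hij a
  apply cj_inv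
  rw [hT _ _ (by simpa using hij)]
  simp only [Equiv.Perm.one_apply, Pi.inv_apply, inv_inv]
  congr 1
  rw [← mul_assoc, ← mul_assoc, Units.mul_inv, one_mul, mul_assoc, Units.mul_inv, mul_one]

theorem tch_mul (i j : n) (u v : Sˣ) : tch i j (u * v) = tch i j u * tch i j v := by
  funext k; simp only [tch, Pi.mul_apply]; split_ifs <;> simp [mul_comm]

end
end St
end CSB

namespace CSB
open Matrix
open scoped commutatorElement
set_option linter.all false

namespace St
section
variable {n : Type*} [DecidableEq n] {S : Type*} [CommRing S] {G : Type*} [Group G] (X : St n S G)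

theorem rel {i j : n} (hij : i ≠ j) (u : Sˣ) (a b : S) :
    X.x i j a * X.x j i b = X.x j i ((u⁻¹ : Sˣ) * b) * X.H i j u a b * X.x i j ((u⁻¹ : Sˣ) * a) := by
  simp only [H, X.neg hij, X.neg hij.symm]; group

theorem H_add_right [Has3 n] {i j : n} (hij : i ≠ j) {u u' : Sˣ} {a b c : S} (hu : (u : S) = 1 + a * b)
    (hu' : (u' : S) = 1 + a * (u⁻¹ : Sˣ) * c) :
    X.H i j (u * u') a (b + c) = X.H i j u a b * X.H i j u' (a * (u⁻¹ : Sˣ)) c := by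
  have e := u.mul_inv
  have e' := u'.mul_inv
  have h1 := X.rel hij (u * u') a (b + c)
  have h2 := X.rel hij u a b
  have h3 := X.rel hij u' (a * (u⁻¹ : Sˣ)) c
  have h4 := X.mon_H hij hu j i hij.symm ((u'⁻¹ : Sˣ) * c)
  rw [cj_apply, mul_inv_eq_iff_eq_mul] at h4
  simp only [tch, if_neg hij.symm, if_true, Equiv.Perm.one_apply] at h4
  rw [X.add j i hij.symm, ← mul_assoc, h2, mul_assoc (_ * _) (X.x i j _),
    show (u⁻¹ : Sˣ) * a = a * (u⁻¹ : Sˣ) by ring, h3] at h1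
  have e1 : ((u * u')⁻¹ : Sˣ) * a = (u'⁻¹ : Sˣ) * (a * (u⁻¹ : Sˣ)) := by
    rw [_root_.mul_inv_rev, Units.val_mul]; ring
  rw [e1] at h1
  have e2 : (((u * u')⁻¹ : Sˣ) : S) * (b + c) = (u⁻¹ : Sˣ) * b + (u⁻¹ : Sˣ) * ((u'⁻¹ : Sˣ) * c) * (u⁻¹ : Sˣ) := by
    rw [_root_.mul_inv_rev, Units.val_mul]; grind
  rw [e2, X.add j i hij.symm] at h1
  have h5 : X.x j i ((u⁻¹ : Sˣ) * b) * X.H i j u a b * (X.x j i ((u'⁻¹ : Sˣ) * c) * X.H i j u' (a * (u⁻¹ : Sˣ)) c *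
      X.x i j ((u'⁻¹ : Sˣ) * (a * (u⁻¹ : Sˣ)))) = X.x j i ((u⁻¹ : Sˣ) * b) * (X.H i j u a b * X.x j i ((u'⁻¹ : Sˣ) * c)) *
        X.H i j u' (a * (u⁻¹ : Sˣ)) c * X.x i j ((u'⁻¹ : Sˣ) * (a * (u⁻¹ : Sˣ))) := by group
  rw [h5, h4, ← mul_assoc] at h1
  have h6 := mul_right_cancel h1
  rw [mul_assoc (_ * _) (X.H i j u a b)] at h6
  exact (mul_left_cancel h6).symm

theorem H_add_left [Has3 n] {i j : n} (hij : i ≠ j) {u u' : Sˣ} {a a' b : S} (hu : (u : S) = 1 + a * b)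
    (hu' : (u' : S) = 1 + a' * ((u⁻¹ : Sˣ) * b)) :
    X.H i j (u * u') (a + a') b = X.H i j u' a' ((u⁻¹ : Sˣ) * b) * X.H i j u a b := by
  apply inv_injective
  rw [_root_.mul_inv_rev, X.H_inv i j hij, X.H_inv i j hij, X.H_inv i j hij, neg_add,
    X.H_add_right hij.symm (by rw [hu]; ring) (by rw [hu']; ring)]
  congr 2; ring

theorem cen_of_mon [Has3 n] {T T' : G} {χ : n → Sˣ} (h : X.Mon T 1 χ) (h' : X.Mon T' 1 χ) :
    T * T'⁻¹ ∈ Subgroup.center G := by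
  rw [Subgroup.mem_center_iff]
  intro g
  refine (X.mon_central ?_ g).symm
  have := Mon.mul X h (Mon.inv X h')
  rwa [mul_inv_cancel] at this

theorem mon_h [Has3 n] {i j : n} (hij : i ≠ j) (u : Sˣ) : X.Mon (X.h i j u) 1 (tch i j u) :=
  X.mon_H hij (by ring)

theorem sym_cen [Has3 n] {i j : n} (hij : i ≠ j) (u v : Sˣ) : X.sym i j u v ∈ Subgroup.center G := by
  have := X.cen_of_mon (X.mon_h hij (u * v)) (T' := X.h i j v * X.h i j u)
    (by rw [mul_comm u v, tch_mul]; exact Mon.mul X (X.mon_h hij _) (X.mon_h hij _))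
  rwa [_root_.mul_inv_rev, ← mul_assoc] at this

theorem cj_h_H [Has3 n] {i j k : n} (hij : i ≠ j) (hki : k ≠ i) (hkj : k ≠ j) (s u : Sˣ) (a b : S) :
    cj (X.h i k s) (X.H i j u a b) = X.H i j u (s * a) ((s⁻¹ : Sˣ) * b) := by
  rw [X.mon_conj_H (X.mon_h hki.symm s) hij]
  simp [tch, hij.symm, hkj.symm, mul_comm]

theorem h_mul {i j : n} (u v : Sˣ) : X.h i j (u * v) = X.sym i j u v * X.h i j v * X.h i j u := by
  rw [sym]; group

theorem cj_h_h [Has3 n] {i j k : n} (hij : i ≠ j) (hki : k ≠ i) (hkj : k ≠ j) (s u : Sˣ) :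
    cj (X.h i k s) (X.h i j u) = X.sym i j s u * X.h i j u := by
  have e := s.mul_inv
  have h1 : X.h i j (s * u) = cj (X.h i k s) (X.h i j u) * X.h i j s := by
    have h2 : cj (X.h i k s) (X.h i j u) = X.H i j u (s * (u - 1)) ((s⁻¹ : Sˣ) * 1) := X.cj_h_H hij hki hkj s u _ _
    rw [h2, h, h, ← X.H_add_left hij (by ring) (by grind)]
    rw [Units.val_mul]; congr 1; ring
  rw [sym, h1]; group

theorem comm_h [Has3 n] {i j k : n} (hij : i ≠ j) (hki : k ≠ i) (hkj : k ≠ j) (s u : Sˣ) :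
    ⁅X.h i k s, X.h i j u⁆ = X.sym i j s u := by
  have := X.cj_h_h hij hki hkj s u
  rw [commutatorElement_def, ← cj_apply, this, mul_inv_cancel_right]

theorem H_cen [Has3 n] {i j : n} (hij : i ≠ j) {u : Sˣ} {a b : S} (hu : (u : S) = 1 + a * b) :
    ∃ z ∈ Subgroup.center G, X.H i j u a b = z * X.h i j u :=
  ⟨_, X.cen_of_mon (X.mon_H hij hu) (X.mon_h hij u), by group⟩

theorem cj_cen {z T : G} (hz : z ∈ Subgroup.center G) : cj T z = z := by
  rw [cj_apply, Subgroup.mem_center_iff.1 hz, mul_inv_cancel_right]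

/-- scaling of `H` -/
theorem H_scale [Has3 n] {i j : n} (hij : i ≠ j) {u : Sˣ} {a b : S} (hu : (u : S) = 1 + a * b) (s : Sˣ) :
    X.H i j u (s * a) ((s⁻¹ : Sˣ) * b) = X.sym i j s u * X.H i j u a b := by
  obtain ⟨k, hki, hkj⟩ := Has3.third i j
  rw [← X.cj_h_H hij hki hkj]
  obtain ⟨z, hz, e⟩ := X.H_cen hij hu
  rw [e, map_mul, cj_cen hz, X.cj_h_h hij hki hkj, ← mul_assoc, ← mul_assoc,
    Subgroup.mem_center_iff.1 hz]

theorem sym_mul_right [Has3 n] {i j : n} (hij : i ≠ j) (s u v : Sˣ) :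
    X.sym i j s (u * v) = X.sym i j s u * X.sym i j s v := by
  obtain ⟨k, hki, hkj⟩ := Has3.third i j
  have h1 := X.cj_h_h hij hki hkj s (u * v)
  have hs := X.sym_cen hij s u
  rw [X.h_mul u v, map_mul, map_mul, cj_cen (X.sym_cen hij u v), X.cj_h_h hij hki hkj,
    X.cj_h_h hij hki hkj] at h1
  have c1 := fun g => Subgroup.mem_center_iff.1 (X.sym_cen hij u v) g
  have c2 := fun g => Subgroup.mem_center_iff.1 (X.sym_cen hij s u) g
  have c3 := fun g => Subgroup.mem_center_iff.1 (X.sym_cen hij s v) g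
  have h2 : X.sym i j u v * (X.sym i j s v * X.h i j v) * (X.sym i j s u * X.h i j u) =
    (X.sym i j s u * X.sym i j s v) * (X.sym i j u v * X.h i j v * X.h i j u) := by
    rw [← mul_assoc, c2]; simp only [← mul_assoc]
    rw [mul_assoc (X.sym i j s u) (X.sym i j u v), ← c1, ← mul_assoc]
  rw [h2] at h1
  exact (mul_right_cancel h1).symm

theorem sym_idx2 [Has3 n] {i j k : n} (hij : i ≠ j) (hki : k ≠ i) (hkj : k ≠ j) (u v : Sˣ) :
    X.sym i k u v = X.sym i j u v := by
  have hh : ∀ u, cj (X.w k j 1) (X.h i j u) = X.h i k u := by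
    intro u
    rw [h, X.mon_conj_H (X.mon_w hkj 1) hij, Equiv.swap_apply_right,
      Equiv.swap_apply_of_ne_of_ne hki.symm hij, h]
    simp [wch, hki.symm, hij, hkj.symm]
  rw [← cj_cen (X.sym_cen hij u v) (T := X.w k j 1)]
  simp only [sym, map_mul, map_inv, hh]

theorem sym_idx1 [Has3 n] {i j k : n} (hij : i ≠ j) (hki : k ≠ i) (hkj : k ≠ j) (u v : Sˣ) :
    X.sym k j u v = X.sym i j u v := by
  have hh : ∀ u, cj (X.w k i 1) (X.h i j u) = X.h k j u := by
    intro u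
    rw [h, X.mon_conj_H (X.mon_w hki 1) hij, Equiv.swap_apply_right,
      Equiv.swap_apply_of_ne_of_ne hkj.symm hij.symm, h]
    simp [wch, hki.symm, hij.symm, hkj.symm]
  rw [← cj_cen (X.sym_cen hij u v) (T := X.w k i 1)]
  simp only [sym, map_mul, map_inv, hh]

theorem sym_flip [Has3 n] {i j : n} (hij : i ≠ j) (u v : Sˣ) :
    X.sym j i u v = X.sym i j u v := by
  obtain ⟨k, hki, hkj⟩ := Has3.third i j
  rw [← X.sym_idx1 hij hki hkj, ← X.sym_idx2 hkj hki.symm hij, ← X.sym_idx1 hki hkj.symm hij.symm]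

theorem sym_idx [Has3 n] {i j k l : n} (hij : i ≠ j) (hkl : k ≠ l) (u v : Sˣ) :
    X.sym k l u v = X.sym i j u v := by
  have key : ∀ {i j l : n}, i ≠ j → i ≠ l → X.sym i l u v = X.sym i j u v := by
    intro i j l h1 h2
    by_cases h : l = j
    · rw [h]
    · exact X.sym_idx2 h1 h2.symm h u v
  by_cases hk : k = i
  · subst hk; exact key hij hkl
  by_cases hk2 : k = j
  · subst hk2; rw [key hij.symm hkl, X.sym_flip hij]
  rw [key hk2 hkl, X.sym_idx1 hij hk hk2]

theorem sym_anti [Has3 n] {i j : n} (hij : i ≠ j) (u v : Sˣ) :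
    X.sym i j u v = (X.sym i j v u)⁻¹ := by
  obtain ⟨k, hki, hkj⟩ := Has3.third i j
  rw [← X.comm_h hij hki hkj, ← X.sym_idx2 hij hki hkj, ← X.comm_h hki.symm hij.symm hkj.symm,
    commutatorElement_inv]

theorem sym_mul_left [Has3 n] {i j : n} (hij : i ≠ j) (u v s : Sˣ) :
    X.sym i j (u * v) s = X.sym i j u s * X.sym i j v s := by
  rw [X.sym_anti hij (u * v), X.sym_anti hij u, X.sym_anti hij v, X.sym_mul_right hij, _root_.mul_inv_rev]
  exact (Subgroup.mem_center_iff.1 (inv_mem (X.sym_cen hij s u)) _)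

/-- `D(a,b) = H(a,b) H(1,ab)⁻¹` -/
def Dd (i j : n) (u : Sˣ) (a b : S) : G := X.H i j u a b * (X.H i j u 1 (a * b))⁻¹

theorem Dd_cen [Has3 n] {i j : n} (hij : i ≠ j) {u : Sˣ} {a b : S} (hu : (u : S) = 1 + a * b) :
    X.Dd i j u a b ∈ Subgroup.center G :=
  X.cen_of_mon (X.mon_H hij hu) (X.mon_H hij (by rw [hu]; ring))

theorem Dd_one {i j : n} (u : Sˣ) (b : S) : X.Dd i j u 1 b = 1 := by
  rw [Dd, one_mul, mul_inv_cancel]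

theorem Dd_scale [Has3 n] {i j : n} (hij : i ≠ j) {u : Sˣ} {a b : S} (hu : (u : S) = 1 + a * b) (s : Sˣ) :
    X.Dd i j u (s * a) ((s⁻¹ : Sˣ) * b) = X.sym i j s u * X.Dd i j u a b := by
  rw [Dd, X.H_scale hij hu, Dd, mul_assoc]
  have e : (s : S) * a * ((s⁻¹ : Sˣ) * b) = a * b := by
    have := s.mul_inv
    grind
  rw [e]

theorem Dd_add [Has3 n] {i j : n} (hij : i ≠ j) {u u' : Sˣ} {a a' b : S} (hu : (u : S) = 1 + a * b)
    (hu' : (u' : S) = 1 + a' * b) :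
    X.Dd i j (u * u') (a + u * a') b = X.Dd i j u a b * X.Dd i j u' a' b := by
  have e := u.mul_inv
  have h1 : X.H i j (u * u') (a + u * a') b = X.sym i j u u' * X.H i j u' a' b * X.H i j u a b := by
    rw [← X.H_scale hij hu', X.H_add_left hij hu (by grind)]
  have h2 : X.H i j (u * u') 1 ((a + u * a') * b) = X.H i j u 1 (a * b) * ((X.sym i j u u')⁻¹ * X.H i j u' 1 (a' * b)) := by
    have h3 : (X.sym i j u u')⁻¹ = X.sym i j u⁻¹ u' := by
      rw [inv_eq_iff_mul_eq_one, ← X.sym_mul_left hij, mul_inv_cancel]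
      have := X.sym_mul_left hij 1 1 u'
      simpa using this
    rw [h3, ← X.H_scale hij (by rw [hu']; ring), add_mul, X.H_add_right hij (u := u) (u' := u') (by rw [hu]; ring) (by grind)]
    congr 2
    · ring
    · rw [inv_inv]; ring
  -- commutator
  have h3 : cj (X.H i j u' 1 (a' * b)) (X.H i j u a b) = X.sym i j u' u * X.sym i j u' u * X.H i j u a b := by
    rw [X.mon_conj_H (X.mon_H hij (by rw [hu']; ring)) hij, ← X.sym_mul_left hij, ← X.H_scale hij hu]
    simp only [tch, if_neg hij.symm, if_true, Equiv.Perm.one_apply, inv_inv, Units.val_mul, _root_.mul_inv_rev]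
    congr 1 <;> ring
  have h4 : X.H i j u a b = X.Dd i j u a b * X.H i j u 1 (a * b) := by rw [Dd]; group
  have h5 : X.H i j u' a' b = X.Dd i j u' a' b * X.H i j u' 1 (a' * b) := by rw [Dd]; group
  rw [cj_apply, mul_inv_eq_iff_eq_mul] at h3
  rw [Dd, h1, h2, h5]
  have hc := X.sym_cen hij u u'
  have hD := X.Dd_cen hij hu
  have hD' := X.Dd_cen hij hu'
  rw [X.sym_anti hij u' u, h4] at h3
  generalize X.Dd i j u a b = d at *
  generalize X.Dd i j u' a' b = d' at *
  generalize X.sym i j u u' = z at *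
  rw [h4]
  generalize X.H i j u 1 (a * b) = A at *
  generalize X.H i j u' 1 (a' * b) = B at *
  have c1 : ∀ g, z * g = g * z := fun g => (Subgroup.mem_center_iff.1 hc g).symm
  have c2 : ∀ g, d * g = g * d := fun g => (Subgroup.mem_center_iff.1 hD g).symm
  have h6 : z * (d' * B) * (d * A) = z * d' * (z⁻¹ * z⁻¹ * (d * A) * B) := by rw [← h3]; group
  have ci : ∀ g, g * z⁻¹ = z⁻¹ * g := fun g => (Subgroup.mem_center_iff.1 (inv_mem hc) g)
  rw [mul_inv_eq_iff_eq_mul, h6, c1 d', c2 d']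
  have h7 : d' * z * (z⁻¹ * z⁻¹ * (d * A) * B) = d' * (z⁻¹ * d) * A * B := by group
  have h8 : d' * d * (A * (z⁻¹ * B)) = d' * d * (A * z⁻¹) * B := by group
  rw [h7, h8, ci A, ← ci d]
  group

end
end St
end CSB

namespace CSB
open Matrix
open scoped commutatorElement
set_option linter.all false

namespace St
section
variable {n : Type*} [DecidableEq n] {S : Type*} [CommRing S] {G : Type*} [Group G] (X : St n S G)

theorem w_inv_one {i j : n} (hij : i ≠ j) : (X.w i j 1)⁻¹ = X.x i j (-1) * X.x j i 1 * X.x i j (-1) := by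
  simp only [w, inv_one, Units.val_one, X.neg hij, X.neg hij.symm]; group

theorem h_eq_w [Has3 n] {i j : n} (hij : i ≠ j) (u : Sˣ) : X.w i j u * (X.w i j 1)⁻¹ = X.h i j u := by
  have e := u.mul_inv
  have h1 := X.mon_h hij u i j hij (-(u⁻¹ : Sˣ))
  rw [cj_apply, mul_inv_eq_iff_eq_mul] at h1
  simp only [tch, if_neg hij.symm, if_true, Equiv.Perm.one_apply, inv_inv] at h1
  have h2 : X.x i j u * (X.h i j u * X.x i j (-(u⁻¹ : Sˣ))) = X.h i j u := by
    rw [h1, ← mul_assoc, ← X.add i j hij]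
    have : (u : S) + u * -((u⁻¹ : Sˣ) : S) * u = 0 := by grind
    rw [this, X.zero hij, one_mul]
  rw [← h2, X.w_inv_one hij]
  have h3 : (-((u⁻¹ : Sˣ) : S)) = ((u⁻¹ : Sˣ) : S) * (u - 1) + (-1) := by grind
  have h4 : X.h i j u * X.x i j (-((u⁻¹ : Sˣ) : S)) = X.x j i (-(u⁻¹ : Sˣ)) * X.x i j (u + (-1)) * X.x j i 1 * X.x i j (-1) := by
    conv_lhs => rw [h3, X.add i j hij]
    simp only [h, H, X.neg hij, mul_one, sub_eq_add_neg]
    group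
  rw [h4, X.add i j hij]
  simp only [w, mul_assoc]

theorem cj_w_h2 [Has3 n] {i j k : n} (hij : i ≠ j) (hki : k ≠ i) (hkj : k ≠ j) (u : Sˣ) :
    cj (X.w k j 1) (X.h i j u) = X.h i k u := by
  rw [h, X.mon_conj_H (X.mon_w hkj 1) hij, Equiv.swap_apply_right,
    Equiv.swap_apply_of_ne_of_ne hki.symm hij, h]
  simp [wch, hki.symm, hij, hkj.symm]

section triv

theorem t_mul (hs : ∀ i j, i ≠ j → ∀ u v, X.sym i j u v = 1) [Has3 n] {i j : n} (hij : i ≠ j) (u v : Sˣ) : X.h i j (u * v) = X.h i j u * X.h i j v := by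
  rw [mul_comm, X.h_mul, hs i j hij, one_mul]

theorem t_one (hs : ∀ i j, i ≠ j → ∀ u v, X.sym i j u v = 1) [Has3 n] {i j : n} (hij : i ≠ j) : X.h i j 1 = 1 := by
  have := X.t_mul hs hij 1 1
  simpa using this

theorem t_b (hs : ∀ i j, i ≠ j → ∀ u v, X.sym i j u v = 1) [Has3 n] {i j : n} (hij : i ≠ j) {u b : Sˣ} {a : S} (hu : (u : S) = 1 + a * b) :
    X.H i j u a b = X.h i j u := by
  have := X.H_scale hij hu b
  rw [hs i j hij, one_mul, Units.inv_mul] at this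
  rw [← this, h]
  congr 1; rw [hu]; ring

theorem t_flip (hs : ∀ i j, i ≠ j → ∀ u v, X.sym i j u v = 1) [Has3 n] {i j : n} (hij : i ≠ j) (u : Sˣ) : X.h j i u = (X.h i j u)⁻¹ := by
  have h1 : cj (X.w i j 1) (X.h i j u) = X.h j i u := by
    rw [h, X.mon_conj_H (X.mon_w hij 1) hij, Equiv.swap_apply_left, Equiv.swap_apply_right]
    simp only [wch, if_neg hij.symm, if_true, inv_one]
    have := X.t_b hs hij.symm (u := u) (a := -((u : S) - 1)) (b := -1) (by simp)
    rw [← this]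
    congr 1 <;> simp
  have h2 : cj (X.h i j u) (X.w i j 1) = X.w i j (u * u) := by
    have m := X.mon_h hij u
    simp only [w, map_mul, m i j hij, m j i hij.symm, tch, if_neg hij.symm, if_true, Equiv.Perm.one_apply, inv_inv]
    congr 3 <;> simp
  rw [cj_apply] at h1 h2
  have h3 := X.h_eq_w hij (u * u)
  rw [X.t_mul hs hij] at h3
  rw [← h2] at h3
  rw [← h1]
  have h4 : X.h i j u * X.w i j 1 * (X.h i j u)⁻¹ * (X.w i j 1)⁻¹ = X.h i j u * (X.w i j 1 * X.h i j u * (X.w i j 1)⁻¹)⁻¹ := by group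
  rw [h4] at h3
  have h5 := mul_left_cancel h3
  rw [inv_eq_iff_eq_inv] at h5
  exact h5

theorem t_a (hs : ∀ i j, i ≠ j → ∀ u v, X.sym i j u v = 1) [Has3 n] {i j : n} (hij : i ≠ j) {u a : Sˣ} {b : S} (hu : (u : S) = 1 + a * b) :
    X.H i j u a b = X.h i j u := by
  have h1 := X.H_inv i j hij u a b
  have h2 := X.t_b hs hij.symm (u := u) (b := -a) (a := -b) (by rw [hu]; simp; ring)
  rw [Units.val_neg] at h2
  rw [← _root_.inv_inj, h1, h2, X.t_flip hs hij]

theorem t_all (hs : ∀ i j, i ≠ j → ∀ u v, X.sym i j u v = 1) [Has3 n] [IsLocalRing S] {i j : n} (hij : i ≠ j) {u : Sˣ} {a b : S} (hu : (u : S) = 1 + a * b) :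
    X.H i j u a b = X.h i j u := by
  by_cases hb : IsUnit b
  · obtain ⟨b, rfl⟩ := hb; exact X.t_b hs hij hu
  by_cases ha : IsUnit a
  · obtain ⟨a, rfl⟩ := ha; exact X.t_a hs hij hu
  have hc : IsUnit (a - 1) := by
    have := IsLocalRing.isUnit_one_sub_self_of_mem_nonunits a ha
    rw [← neg_sub]; exact this.neg
  have hv : IsUnit (1 + b) := by
    have := IsLocalRing.isUnit_one_sub_self_of_mem_nonunits (-b) (by
      rw [mem_nonunits_iff, IsUnit.neg_iff]; exact hb)
    simpa using this
  obtain ⟨c, hc⟩ := hc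
  obtain ⟨v, hv⟩ := hv
  have e := v.mul_inv
  have hu' : ((v⁻¹ * u : Sˣ) : S) = 1 + c * ((v⁻¹ : Sˣ) * b) := by
    rw [Units.val_mul]; grind
  have h1 := X.H_add_left hij (u := v) (u' := v⁻¹ * u) (a := ((1 : Sˣ) : S)) (a' := c) (b := b) (by simp [hv]) hu'
  rw [mul_inv_cancel_left, X.t_a hs hij hu', X.t_a hs hij (by simp [hv]), ← X.t_mul hs hij] at h1
  rw [show a = ((1 : Sˣ) : S) + c by rw [hc]; simp, h1, mul_comm, mul_inv_cancel_left]

end triv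

/-! subgroup lemmas -/
theorem cj_closure {s : Set G} {K : Subgroup G} {t : G} (h : ∀ y ∈ s, cj t y ∈ K) {y : G}
    (hy : y ∈ Subgroup.closure s) : cj t y ∈ K := by
  have : Subgroup.closure s ≤ K.comap (cj t) := (Subgroup.closure_le _).2 h
  exact this hy

/-- `K` normalizes `H` -/
def Nz (K H : Subgroup G) : Prop := ∀ k ∈ K, ∀ y ∈ H, cj k y ∈ H

theorem nz_closure {s s' : Set G} (h : ∀ t ∈ s', ∀ y ∈ s, cj t y ∈ Subgroup.closure s)
    (h' : ∀ t ∈ s', ∀ y ∈ s, cj t⁻¹ y ∈ Subgroup.closure s) : Nz (Subgroup.closure s') (Subgroup.closure s) := by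
  intro k hk
  induction hk using Subgroup.closure_induction'' with
  | one => intro y hy; simpa [cj_apply] using hy
  | mem t ht => exact fun y hy => cj_closure (h t ht) hy
  | inv_mem t ht => exact fun y hy => cj_closure (h' t ht) hy
  | mul a b _ _ ha hb => intro y hy; rw [cj_mul]; exact ha _ (hb _ hy)

theorem nz_sup {K K' H : Subgroup G} (h : Nz K H) (h' : Nz K' H) : Nz (K ⊔ K') H := by
  intro k hk
  rw [Subgroup.sup_eq_closure] at hk
  induction hk using Subgroup.closure_induction'' with
  | one => intro y hy; simpa [cj_apply] using hy
  | mem t ht => exact ht.elim (h t) (h' t)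
  | inv_mem t ht => exact ht.elim (fun ht => h _ (inv_mem ht)) (fun ht => h' _ (inv_mem ht))
  | mul a b _ _ ha hb => intro y hy; rw [cj_mul]; exact ha _ (hb _ hy)

theorem sup_prod {K H : Subgroup G} (h : Nz K H) {g : G} (hg : g ∈ H ⊔ K) : ∃ y ∈ H, ∃ k ∈ K, g = y * k := by
  rw [Subgroup.sup_eq_closure] at hg
  have key : ∀ k ∈ K, ∀ z ∈ H, ∃ y ∈ H, ∃ k' ∈ K, k * z = y * k' := fun k hk z hz =>
    ⟨_, h k hk z hz, k, hk, by rw [cj_apply]; group⟩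
  have key2 : ∀ a ∈ (H : Set G) ∪ K, ∀ g, (∃ y ∈ H, ∃ k ∈ K, g = y * k) → ∃ y ∈ H, ∃ k ∈ K, a * g = y * k := by
    rintro a (ha | ha) _ ⟨y, hy, k, hk, rfl⟩
    · exact ⟨a * y, mul_mem ha hy, k, hk, by group⟩
    · obtain ⟨y', hy', k', hk', e⟩ := key a ha y hy
      exact ⟨y', hy', k' * k, mul_mem hk' hk, by rw [← mul_assoc, e]; group⟩
  induction hg using Subgroup.closure_induction_left with
  | one => exact ⟨1, one_mem _, 1, one_mem _, by simp⟩
  | mul_left a ha y _ ih => exact key2 a ha y ih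
  | inv_mul_cancel a ha y _ ih => exact key2 _ (ha.imp (fun h => inv_mem h) (fun h => inv_mem h)) y ih

def Eg (B : Finset n) : Set G := {g | ∃ i ∈ B, ∃ j ∈ B, i ≠ j ∧ ∃ a, g = X.x i j a}
def Ug (p : n) (B : Finset n) : Set G := {g | ∃ j ∈ B, p ≠ j ∧ ∃ a, g = X.x p j a}
def Vg (p : n) (B : Finset n) : Set G := {g | ∃ j ∈ B, p ≠ j ∧ ∃ a, g = X.x j p a}
abbrev Es (B : Finset n) : Subgroup G := Subgroup.closure (X.Eg B)
abbrev Us (p : n) (B : Finset n) : Subgroup G := Subgroup.closure (X.Ug p B)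
abbrev Vs (p : n) (B : Finset n) : Subgroup G := Subgroup.closure (X.Vg p B)

variable {p : n} {B : Finset n}
theorem memE {i j : n} (hi : i ∈ B) (hj : j ∈ B) (hij : i ≠ j) (a : S) : X.x i j a ∈ X.Es B :=
  Subgroup.subset_closure ⟨i, hi, j, hj, hij, a, rfl⟩
theorem memU {j : n} (hj : j ∈ B) (hij : p ≠ j) (a : S) : X.x p j a ∈ X.Us p B :=
  Subgroup.subset_closure ⟨j, hj, hij, a, rfl⟩
theorem memV {j : n} (hj : j ∈ B) (hij : p ≠ j) (a : S) : X.x j p a ∈ X.Vs p B :=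
  Subgroup.subset_closure ⟨j, hj, hij, a, rfl⟩

theorem nz_EU (hp : p ∉ B) : Nz (X.Es B) (X.Us p B) := by
  have : ∀ t ∈ X.Eg B, ∀ y ∈ X.Ug p B, cj t y ∈ X.Us p B := by
    rintro _ ⟨i, hi, j, hj, hij, a, rfl⟩ _ ⟨k, hk, hpk, b, rfl⟩
    have hpi : i ≠ p := fun h => hp (h ▸ hi)
    have hpj : j ≠ p := fun h => hp (h ▸ hj)
    by_cases hik : i = k
    · subst hik
      rw [X.W_left hpj, X.cj_W1 hij hpi hpj]
      exact mul_mem (X.memU hi hpi.symm _) (X.memU hj hpj.symm _)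
    · rw [X.cj_fix hij hpk hpj hik]; exact X.memU hk hpk _
  refine nz_closure this ?_
  rintro _ ⟨i, hi, j, hj, hij, a, rfl⟩
  rw [← X.neg hij]
  exact this _ ⟨i, hi, j, hj, hij, _, rfl⟩

theorem nz_EV (hp : p ∉ B) : Nz (X.Es B) (X.Vs p B) := by
  have : ∀ t ∈ X.Eg B, ∀ y ∈ X.Vg p B, cj t y ∈ X.Vs p B := by
    rintro _ ⟨i, hi, j, hj, hij, a, rfl⟩ _ ⟨k, hk, hpk, b, rfl⟩
    have hpi : i ≠ p := fun h => hp (h ▸ hi)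
    have hpj : j ≠ p := fun h => hp (h ▸ hj)
    by_cases hjk : j = k
    · subst hjk
      rw [X.V_right hpi, X.cj_V1 hij hpi hpj]
      exact mul_mem (X.memV hi hpi.symm _) (X.memV hj hpj.symm _)
    · rw [X.cj_fix hij hpk.symm hjk hpi]; exact X.memV hk hpk _
  refine nz_closure this ?_
  rintro _ ⟨i, hi, j, hj, hij, a, rfl⟩
  rw [← X.neg hij]
  exact this _ ⟨i, hi, j, hj, hij, _, rfl⟩

theorem tor_E {T : G} {χ : n → Sˣ} (hT : X.Mon T 1 χ) : ∀ y ∈ X.Es B, cj T y ∈ X.Es B := by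
  intro y hy
  refine cj_closure ?_ hy
  rintro _ ⟨i, hi, j, hj, hij, a, rfl⟩
  rw [hT i j hij]; exact X.memE hi hj hij _
theorem tor_U {T : G} {χ : n → Sˣ} (hT : X.Mon T 1 χ) : ∀ y ∈ X.Us p B, cj T y ∈ X.Us p B := by
  intro y hy
  refine cj_closure ?_ hy
  rintro _ ⟨j, hj, hij, a, rfl⟩
  rw [hT p j hij]; exact X.memU hj hij _
theorem tor_V {T : G} {χ : n → Sˣ} (hT : X.Mon T 1 χ) : ∀ y ∈ X.Vs p B, cj T y ∈ X.Vs p B := by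
  intro y hy
  refine cj_closure ?_ hy
  rintro _ ⟨j, hj, hij, a, rfl⟩
  rw [hT j p hij.symm]; exact X.memV hj hij _

theorem split_U {l : n} (hl : l ∈ B) (hp : p ∉ B) {u : G} (hu : u ∈ X.Us p B) :
    ∃ b, ∃ u' ∈ X.Us p (B.erase l), u = X.x p l b * u' := by
  have hpl : p ≠ l := fun h => hp (h ▸ hl)
  have key : ∀ t ∈ X.Ug p B, ∀ y, (∃ b, ∃ u' ∈ X.Us p (B.erase l), y = X.x p l b * u') →
      ∃ b, ∃ u' ∈ X.Us p (B.erase l), t * y = X.x p l b * u' := by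
    rintro _ ⟨j, hj, hpj, a, rfl⟩ _ ⟨b, u', hu', rfl⟩
    by_cases hjl : j = l
    · subst hjl; exact ⟨a + b, u', hu', by rw [X.add _ _ hpj, mul_assoc]⟩
    · refine ⟨b, X.x p j a * u', mul_mem (X.memU (Finset.mem_erase.2 ⟨hjl, hj⟩) hpj _) hu', ?_⟩
      rw [← mul_assoc, X.comm p j p l hpj hpl hpj.symm hpl, mul_assoc]
  induction hu using Subgroup.closure_induction_left with
  | one => exact ⟨0, 1, one_mem _, by rw [X.zero hpl, one_mul]⟩
  | mul_left a ha y _ ih => exact key a ha y ih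
  | inv_mul_cancel a ha y _ ih =>
    obtain ⟨j, hj, hpj, a, rfl⟩ := ha
    rw [← X.neg hpj]
    exact key _ ⟨j, hj, hpj, _, rfl⟩ y ih

theorem split_V {l : n} (hl : l ∈ B) (hp : p ∉ B) {u : G} (hu : u ∈ X.Vs p B) :
    ∃ b, ∃ u' ∈ X.Vs p (B.erase l), u = X.x l p b * u' := by
  have hpl : p ≠ l := fun h => hp (h ▸ hl)
  have key : ∀ t ∈ X.Vg p B, ∀ y, (∃ b, ∃ u' ∈ X.Vs p (B.erase l), y = X.x l p b * u') →
      ∃ b, ∃ u' ∈ X.Vs p (B.erase l), t * y = X.x l p b * u' := by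
    rintro _ ⟨j, hj, hpj, a, rfl⟩ _ ⟨b, u', hu', rfl⟩
    by_cases hjl : j = l
    · subst hjl; exact ⟨a + b, u', hu', by rw [X.add _ _ hpj.symm, mul_assoc]⟩
    · refine ⟨b, X.x j p a * u', mul_mem (X.memV (Finset.mem_erase.2 ⟨hjl, hj⟩) hpj _) hu', ?_⟩
      rw [← mul_assoc, X.comm j p l p hpj.symm hpl.symm hpl hpj.symm, mul_assoc]
  induction hu using Subgroup.closure_induction_left with
  | one => exact ⟨0, 1, one_mem _, by rw [X.zero hpl.symm, one_mul]⟩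
  | mul_left a ha y _ ih => exact key a ha y ih
  | inv_mul_cancel a ha y _ ih =>
    obtain ⟨j, hj, hpj, a, rfl⟩ := ha
    rw [← X.neg hpj.symm]
    exact key _ ⟨j, hj, hpj, _, rfl⟩ y ih

end
end St
end CSB

namespace CSB
open Matrix
open scoped commutatorElement
set_option linter.all false

section mats
variable {n : Type*} [Fintype n] [DecidableEq n] {S : Type*} [CommRing S]
theorem x_mulVec' {i j : n} (hij : i ≠ j) (a : S) (v : n → S) :
    (x i j a).val *ᵥ v = v + Pi.single i (a * v j) := by
  rw [x_val hij, add_mulVec, one_mulVec]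
  congr 1
  ext k; simp [single_mulVec, Function.update_apply, Pi.single_apply]

theorem x_vecMul {i j : n} (hij : i ≠ j) (a : S) (v : n → S) :
    v ᵥ* (x i j a).val = v + Pi.single j (v i * a) := by
  rw [x_val hij, vecMul_add, vecMul_one]
  congr 1
  ext k; simp [vecMul, dotProduct, Matrix.single_apply, Pi.single_apply]
  by_cases hk : k = j
  · subst hk; simp
  · simp [hk, Ne.symm hk]
end mats

namespace St
section
variable {n : Type*} [Fintype n] [DecidableEq n] {S : Type*} [CommRing S] {G : Type*} [Group G] (X : St n S G)
variable (π : G →* GL n S) (hπ : ∀ i j, i ≠ j → ∀ a, π (X.x i j a) = CSB.x i j a)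

theorem V_shape (hπ : ∀ i j, i ≠ j → ∀ a, π (X.x i j a) = CSB.x i j a) {p : n} {B : Finset n} (hp : p ∉ B) :
    ∀ u ∈ X.Vs p B, ∃ c : n → S, (∀ j ∉ B, c j = 0) ∧ (π u).val *ᵥ Pi.single p 1 = Pi.single p 1 + c ∧ (c = 0 → u = 1) := by
  induction B using Finset.induction_on with
  | empty =>
    intro u hu
    have : u = 1 := by
      have h : X.Vg p ∅ = ∅ := by ext; simp [Vg]
      rw [Vs, h, Subgroup.closure_empty] at hu
      simpa using hu
    subst this
    exact ⟨0, by simp, by simp only [map_one, Units.val_one, one_mulVec, vecMul_one, add_zero], by simp⟩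
  | insert l B hl ih =>
    intro u hu
    obtain ⟨b, u', hu', rfl⟩ := X.split_V (Finset.mem_insert_self l B) hp hu
    rw [Finset.erase_insert hl] at hu'
    rw [Finset.mem_insert, not_or] at hp
    obtain ⟨c, h1, h2, h3⟩ := ih hp.2 u' hu'
    refine ⟨c + Pi.single l b, ?_, ?_, ?_⟩
    · intro j hj
      rw [Finset.mem_insert, not_or] at hj
      simp [h1 j hj.2, hj.1]
    · rw [map_mul, hπ l p (Ne.symm hp.1), Units.val_mul, ← mulVec_mulVec, h2, x_mulVec' (Ne.symm hp.1)]
      simp [h1 p hp.2, add_assoc]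
    · intro h0
      have hb := congrFun h0 l
      simp [h1 l hl] at hb
      subst hb
      rw [X.zero (Ne.symm hp.1), one_mul]
      exact h3 (by simpa using h0)

theorem U_shape (hπ : ∀ i j, i ≠ j → ∀ a, π (X.x i j a) = CSB.x i j a) {p : n} {B : Finset n} (hp : p ∉ B) :
    ∀ u ∈ X.Us p B, ∃ c : n → S, (∀ j ∉ B, c j = 0) ∧ Pi.single p 1 ᵥ* (π u).val = Pi.single p 1 + c ∧ (c = 0 → u = 1) := by
  induction B using Finset.induction_on with
  | empty =>
    intro u hu
    have : u = 1 := by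
      have h : X.Ug p ∅ = ∅ := by ext; simp [Ug]
      rw [Us, h, Subgroup.closure_empty] at hu
      simpa using hu
    subst this
    exact ⟨0, by simp, by simp only [map_one, Units.val_one, one_mulVec, vecMul_one, add_zero], by simp⟩
  | insert l B hl ih =>
    intro u hu
    obtain ⟨b, u', hu', rfl⟩ := X.split_U (Finset.mem_insert_self l B) hp hu
    rw [Finset.erase_insert hl] at hu'
    rw [Finset.mem_insert, not_or] at hp
    obtain ⟨c, h1, h2, h3⟩ := ih hp.2 u' hu'
    have hrow : ∀ y ∈ X.Us p B, Pi.single l b ᵥ* (π y).val = Pi.single l b := by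
      intro y hy
      have hx : ∀ j ∈ B, p ≠ j → ∀ a, Pi.single l b ᵥ* (π (X.x p j a)).val = Pi.single l b := by
        intro j hj hpj a
        rw [hπ p j hpj, x_vecMul hpj]; simp [hp.1]
      induction hy using Subgroup.closure_induction'' with
      | one => simp only [map_one, Units.val_one, one_mulVec, vecMul_one, and_self]
      | mem t ht => obtain ⟨j, hj, hpj, a, rfl⟩ := ht; exact hx j hj hpj a
      | inv_mem t ht => obtain ⟨j, hj, hpj, a, rfl⟩ := ht; rw [← X.neg hpj]; exact hx j hj hpj _
      | mul a b _ _ ha hb => rw [map_mul, Units.val_mul, ← vecMul_vecMul, ha, hb]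
    refine ⟨c + Pi.single l b, ?_, ?_, ?_⟩
    · intro j hj
      rw [Finset.mem_insert, not_or] at hj
      simp [h1 j hj.2, hj.1]
    · rw [map_mul, hπ p l hp.1, Units.val_mul, ← vecMul_vecMul, x_vecMul hp.1, add_vecMul, h2]
      simp [hrow u' hu', add_assoc]
    · intro h0
      have hb := congrFun h0 l
      simp [h1 l hl] at hb
      subst hb
      rw [X.zero hp.1, one_mul]
      exact h3 (by simpa using h0)

theorem U_col (hπ : ∀ i j, i ≠ j → ∀ a, π (X.x i j a) = CSB.x i j a) {p : n} {B : Finset n} :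
    ∀ y ∈ X.Us p B, (π y).val *ᵥ Pi.single p 1 = Pi.single p 1 := by
  intro y hy
  have hx : ∀ j ∈ B, p ≠ j → ∀ a, (π (X.x p j a)).val *ᵥ Pi.single p 1 = Pi.single p 1 := by
    intro j hj hpj a
    rw [hπ p j hpj, x_mulVec' hpj]; simp [hpj.symm]
  induction hy using Subgroup.closure_induction'' with
  | one => simp only [map_one, Units.val_one, one_mulVec, vecMul_one, and_self]
  | mem t ht => obtain ⟨j, hj, hpj, a, rfl⟩ := ht; exact hx j hj hpj a
  | inv_mem t ht => obtain ⟨j, hj, hpj, a, rfl⟩ := ht; rw [← X.neg hpj]; exact hx j hj hpj _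
  | mul a b _ _ ha hb => rw [map_mul, Units.val_mul, ← mulVec_mulVec, hb, ha]

theorem E_col (hπ : ∀ i j, i ≠ j → ∀ a, π (X.x i j a) = CSB.x i j a) {p : n} {B : Finset n} (hp : p ∉ B) :
    ∀ y ∈ X.Es B, (π y).val *ᵥ Pi.single p 1 = Pi.single p 1 ∧ Pi.single p 1 ᵥ* (π y).val = Pi.single p 1 := by
  intro y hy
  have hx : ∀ i ∈ B, ∀ j ∈ B, i ≠ j → ∀ a, (π (X.x i j a)).val *ᵥ Pi.single p 1 = Pi.single p 1 ∧
      Pi.single p 1 ᵥ* (π (X.x i j a)).val = Pi.single p 1 := by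
    intro i hi j hj hij a
    have hpi : i ≠ p := fun h => hp (h ▸ hi)
    have hpj : j ≠ p := fun h => hp (h ▸ hj)
    rw [hπ i j hij, x_mulVec' hij, x_vecMul hij]; simp [hpi, hpj]
  induction hy using Subgroup.closure_induction'' with
  | one => simp only [map_one, Units.val_one, one_mulVec, vecMul_one, and_self]
  | mem t ht => obtain ⟨i, hi, j, hj, hpj, a, rfl⟩ := ht; exact hx i hi j hj hpj a
  | inv_mem t ht => obtain ⟨i, hi, j, hj, hpj, a, rfl⟩ := ht; rw [← X.neg hpj]; exact hx i hi j hj hpj _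
  | mul a b _ _ ha hb =>
    exact ⟨by rw [map_mul, Units.val_mul, ← mulVec_mulVec, hb.1, ha.1], by rw [map_mul, Units.val_mul, ← vecMul_vecMul, ha.2, hb.2]⟩

theorem h_col (hπ : ∀ i j, i ≠ j → ∀ a, π (X.x i j a) = CSB.x i j a) {i j : n} (hij : i ≠ j) (u : Sˣ) :
    (π (X.h i j u)).val *ᵥ Pi.single i 1 = Pi.single i (u : S) := by
  have e := u.mul_inv
  simp only [h, H, map_mul, hπ i j hij, hπ j i hij.symm, Units.val_mul, ← mulVec_mulVec]
  simp only [x_mulVec' hij, x_mulVec' hij.symm]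
  ext k
  simp only [Pi.add_apply, Pi.single_apply]
  grind

theorem triv_step [Has3 n] [IsLocalRing S] (hs : ∀ i j, i ≠ j → ∀ u v, X.sym i j u v = 1)
    {p l0 : n} {B : Finset n} (hp : p ∉ B) (hl0 : l0 ∈ B) :
    ∀ g ∈ X.Es (insert p B), ∃ u ∈ X.Us p B, ∃ ub ∈ X.Vs p B, ∃ u' ∈ X.Us p B, ∃ e ∈ X.Es B, ∃ v,
      g = u * ub * (u' * (e * X.h p l0 v)) := by
  have hpl0 : p ≠ l0 := fun h => hp (h ▸ hl0)
  let hh : Sˣ →* G := ⟨⟨X.h p l0, X.t_one hs hpl0⟩, X.t_mul hs hpl0⟩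
  let Hs : Subgroup G := hh.range
  let L : Subgroup G := X.Es B ⊔ Hs
  let P : Subgroup G := X.Us p B ⊔ L
  have nHE : Nz Hs (X.Es B) := by rintro _ ⟨v, rfl⟩; exact X.tor_E (X.mon_h hpl0 v)
  have nHU : Nz Hs (X.Us p B) := by rintro _ ⟨v, rfl⟩; exact X.tor_U (X.mon_h hpl0 v)
  have nHV : Nz Hs (X.Vs p B) := by rintro _ ⟨v, rfl⟩; exact X.tor_V (X.mon_h hpl0 v)
  have nLU : Nz L (X.Us p B) := nz_sup (X.nz_EU hp) nHU
  have nLV : Nz L (X.Vs p B) := nz_sup (X.nz_EV hp) nHV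
  have UP : X.Us p B ≤ P := le_sup_left
  have LP : L ≤ P := le_sup_right
  have EL : X.Es B ≤ L := le_sup_left
  have HL : Hs ≤ L := le_sup_right
  let Ω : G → Prop := fun g => ∃ u ∈ X.Us p B, ∃ ub ∈ X.Vs p B, ∃ q ∈ P, g = u * ub * q
  have Ωl : ∀ t ∈ P, ∀ g, Ω g → Ω (t * g) := by
    rintro t ht _ ⟨u, hu, ub, hub, q, hq, rfl⟩
    obtain ⟨u1, hu1, l1, hl1, rfl⟩ := sup_prod nLU ht
    exact ⟨u1 * cj l1 u, mul_mem hu1 (nLU l1 hl1 u hu), cj l1 ub, nLV l1 hl1 _ hub, l1 * q,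
      mul_mem (LP hl1) hq, by simp only [cj_apply]; group⟩
  have hP : ∀ l ∈ B, ∀ v, X.h p l v ∈ P := by
    intro l hl v
    have hpl : p ≠ l := fun h => hp (h ▸ hl)
    by_cases h : l = l0
    · subst h; exact LP (HL ⟨v, rfl⟩)
    · rw [← X.cj_w_h2 hpl0 hpl.symm h, cj_apply]
      have hw : X.w l l0 1 ∈ P := LP (EL (mul_mem (mul_mem (X.memE hl hl0 h _) (X.memE hl0 hl (Ne.symm h) _)) (X.memE hl hl0 h _)))
      exact mul_mem (mul_mem hw (LP (HL ⟨v, rfl⟩))) (inv_mem hw)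
  have case1 : ∀ l ∈ B, ∀ a b : S, IsUnit (1 + a * b) → ∀ u ∈ X.Us p (B.erase l), ∀ ub ∈ X.Vs p B, ∀ q ∈ P,
      Ω (X.x l p a * (X.x p l b * u * ub * q)) := by
    rintro l hl a b ⟨v, hv⟩ u hu ub hub q hq
    have hpl : p ≠ l := fun h => hp (h ▸ hl)
    have h1 : X.x l p a * (X.x p l b * u * ub * q) = X.x p l ((v⁻¹ : Sˣ) * b) * (X.H l p v a b *
      (cj (X.x l p ((v⁻¹ : Sˣ) * a)) u * (1 * (X.x l p ((v⁻¹ : Sˣ) * a) * ub) * q))) := by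
      have := X.rel hpl.symm v a b
      have h2 : X.x l p a * (X.x p l b * u * ub * q) = (X.x l p a * X.x p l b) * u * ub * q := by group
      rw [h2, this, cj_apply]; group
    rw [h1, X.t_all hs hpl.symm hv, X.t_flip hs hpl]
    refine Ωl _ (UP (X.memU hl hpl _)) _ (Ωl _ (inv_mem (hP l hl v)) _ (Ωl _ ?_ _ ?_))
    · refine cj_closure ?_ hu
      rintro _ ⟨j, hj, hpj, z, rfl⟩
      have hj' := Finset.mem_erase.1 hj
      rw [X.V_right (i := l) (j := p) hj'.1.symm, X.cj_V1 hpl.symm hj'.1.symm hpj]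
      exact mul_mem (LP (EL (X.memE hl hj'.2 hj'.1.symm _))) (UP (X.memU hj'.2 hpj _))
    · exact ⟨1, one_mem _, _, mul_mem (X.memV hl hpl _) hub, q, hq, rfl⟩
  have case2 : ∀ l ∈ B, ∀ b : Sˣ, ∀ u ∈ X.Us p (B.erase l), ∀ ub ∈ X.Vs p B, ∀ q ∈ P,
      Ω (X.x l p (-(b⁻¹ : Sˣ)) * (X.x p l b * u * ub * q)) := by
    rintro l hl b u hu ub hub q hq
    have hpl : p ≠ l := fun h => hp (h ▸ hl)
    have h1 : X.x l p (-(b⁻¹ : Sˣ)) * (X.x p l b * u * ub * q) = (X.x p l b)⁻¹ *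
      (cj (X.w p l b) u * (cj (X.w p l b) ub * (X.x p l b * X.x l p (-(b⁻¹ : Sˣ)) * (X.x p l b * q)))) := by
      have : X.x p l b * X.x l p (-(b⁻¹ : Sˣ)) * (X.x p l b * q) = X.w p l b * q := by rw [w]; group
      rw [this, cj_apply, cj_apply]
      have h2 : X.x l p (-(b⁻¹ : Sˣ)) = (X.x p l b)⁻¹ * X.w p l b * (X.x p l b)⁻¹ := by rw [w]; group
      rw [h2]; group
    rw [h1]
    refine Ωl _ (inv_mem (UP (X.memU hl hpl _))) _ (Ωl _ ?_ _ (Ωl _ ?_ _ ?_))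
    · refine cj_closure ?_ hu
      rintro _ ⟨j, hj, hpj, z, rfl⟩
      have hj' := Finset.mem_erase.1 hj
      rw [X.mon_w hpl b p j hpj, Equiv.swap_apply_left, Equiv.swap_apply_of_ne_of_ne hpj.symm hj'.1]
      exact LP (EL (X.memE hl hj'.2 hj'.1.symm _))
    · refine cj_closure ?_ hub
      rintro _ ⟨j, hj, hpj, z, rfl⟩
      rw [X.mon_w hpl b j p hpj.symm, Equiv.swap_apply_left]
      by_cases hjl : j = l
      · subst hjl
        rw [Equiv.swap_apply_right]
        exact UP (X.memU hl hpl _)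
      · rw [Equiv.swap_apply_of_ne_of_ne hpj.symm hjl]
        exact LP (EL (X.memE hj hl hjl _))
    · exact ⟨_, X.memU hl hpl _, _, X.memV hl hpl _, _, mul_mem (UP (X.memU hl hpl _)) hq, rfl⟩
  have case3 : ∀ l ∈ B, ∀ a g, Ω g → Ω (X.x l p a * g) := by
    have c1 : ∀ l ∈ B, ∀ a, ¬ IsUnit a → ∀ g, Ω g → Ω (X.x l p a * g) := by
      rintro l hl a ha _ ⟨u, hu, ub, hub, q, hq, rfl⟩
      obtain ⟨b, u', hu', rfl⟩ := X.split_U hl hp hu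
      refine case1 l hl a b ?_ u' hu' ub hub q hq
      have h2 : ¬ IsUnit (-(a * b)) := fun h => ha (isUnit_of_mul_isUnit_left (IsUnit.neg_iff _ |>.1 h))
      have := IsLocalRing.isUnit_one_sub_self_of_mem_nonunits _ h2
      simpa using this
    rintro l hl a _ ⟨u, hu, ub, hub, q, hq, rfl⟩
    have hpl : p ≠ l := fun h => hp (h ▸ hl)
    obtain ⟨b, u', hu', rfl⟩ := X.split_U hl hp hu
    by_cases hab : IsUnit (1 + a * b)
    · exact case1 l hl a b hab u' hu' ub hub q hq
    have hb : IsUnit b := by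
      have := IsLocalRing.isUnit_one_sub_self_of_mem_nonunits _ hab
      have h3 : IsUnit (a * b) := by
        have h4 : a * b = -(1 - (1 + a * b)) := by ring
        rw [h4]; exact this.neg
      exact isUnit_of_mul_isUnit_right h3
    obtain ⟨b, rfl⟩ := hb
    have e := b.mul_inv
    have h5 : a = (1 + a * b) * (b⁻¹ : Sˣ) + (-(b⁻¹ : Sˣ)) := by grind
    rw [h5, X.add l p hpl.symm, mul_assoc]
    refine c1 l hl _ ?_ _ (case2 l hl b u' hu' ub hub q hq)
    exact fun h => hab (isUnit_of_mul_isUnit_left h)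
  have key : ∀ t ∈ X.Eg (insert p B), ∀ g, Ω g → Ω (t * g) := by
    rintro _ ⟨i, hi, j, hj, hij, a, rfl⟩
    rw [Finset.mem_insert] at hi hj
    by_cases hip : i = p
    · subst hip
      exact Ωl _ (UP (X.memU (hj.resolve_left hij.symm) hij _))
    by_cases hjp : j = p
    · subst hjp
      exact case3 i (hi.resolve_left hij) a
    exact Ωl _ (LP (EL (X.memE (hi.resolve_left hip) (hj.resolve_left hjp) hij _)))
  intro g hg
  have hΩ : Ω g := by
    induction hg using Subgroup.closure_induction_left with
    | one => exact ⟨1, one_mem _, 1, one_mem _, 1, one_mem _, by simp⟩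
    | mul_left a ha y _ ih => exact key a ha y ih
    | inv_mul_cancel a ha y _ ih =>
      obtain ⟨i, hi, j, hj, hij, a, rfl⟩ := ha
      rw [← X.neg hij]
      exact key _ ⟨i, hi, j, hj, hij, _, rfl⟩ y ih
  obtain ⟨u, hu, ub, hub, q, hq, rfl⟩ := hΩ
  obtain ⟨u', hu', m, hm, rfl⟩ := sup_prod nLU hq
  obtain ⟨e, he, _, ⟨v, rfl⟩, rfl⟩ := sup_prod nHE hm
  exact ⟨u, hu, ub, hub, u', hu', e, he, v, rfl⟩

theorem triv_inj_B [Has3 n] [IsLocalRing S] (hs : ∀ i j, i ≠ j → ∀ u v, X.sym i j u v = 1)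
    (hπ : ∀ i j, i ≠ j → ∀ a, π (X.x i j a) = CSB.x i j a) (B : Finset n) :
    ∀ g ∈ X.Es B, π g = 1 → g = 1 := by
  induction B using Finset.induction_on with
  | empty =>
    intro u hu _
    have h : X.Eg ∅ = ∅ := by ext; simp [Eg]
    rw [Es, h, Subgroup.closure_empty] at hu
    simpa using hu
  | insert p B hp ih =>
    intro g hg h1
    rcases B.eq_empty_or_nonempty with rfl | ⟨l0, hl0⟩
    · have h : X.Eg (insert p ∅) = ∅ := by ext; simp [Eg]
      rw [Es, h, Subgroup.closure_empty] at hg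
      simpa using hg
    have hpl0 : p ≠ l0 := fun h => hp (h ▸ hl0)
    obtain ⟨u, hu, ub, hub, u', hu', e, he, v, rfl⟩ := X.triv_step hs hp hl0 g hg
    have hub1 : ub = 1 := by
      obtain ⟨c, hc1, hc2, hc3⟩ := X.V_shape π hπ hp ub hub
      apply hc3
      -- π ub * (π (u' e h) * π u) = 1
      have h2 : π ub * (π u' * (π e * π (X.h p l0 v))) = π u⁻¹ := by
        simp only [map_mul] at h1
        rw [map_inv, ← mul_left_inj (π u)⁻¹]
        rw [mul_assoc] at h1
        have := eq_inv_of_mul_eq_one_right h1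
        rw [this]
      have h3 := congrArg (fun M : GL n S => M.val *ᵥ Pi.single p 1) h2
      simp only [Units.val_mul, ← mulVec_mulVec] at h3
      rw [X.h_col π hπ hpl0, X.U_col π hπ _ (inv_mem hu)] at h3
      have hsc : ∀ M : Matrix n n S, M *ᵥ Pi.single p (v : S) = (v : S) • (M *ᵥ Pi.single p 1) := by
        intro M
        rw [← mulVec_smul]; congr 1; ext k; simp [Pi.single_apply]
      rw [hsc, (X.E_col π hπ hp e he).1, mulVec_smul, X.U_col π hπ _ hu', mulVec_smul, hc2] at h3
      ext j
      by_cases hj : j = p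
      · rw [hj, hc1 p hp]; rfl
      · have h4 := congrFun h3 j
        simp [hj] at h4
        simpa using h4
    subst hub1
    have hv : v = 1 := by
      simp only [map_mul, map_one, mul_one] at h1
      have h3 := congrArg (fun M : GL n S => M.val *ᵥ Pi.single p 1) h1
      simp only [Units.val_mul, ← mulVec_mulVec] at h3
      rw [X.h_col π hπ hpl0] at h3
      have hsc : ∀ M : Matrix n n S, M *ᵥ Pi.single p (v : S) = (v : S) • (M *ᵥ Pi.single p 1) := by
        intro M
        rw [← mulVec_smul]; congr 1; ext k; simp [Pi.single_apply]
      rw [hsc, (X.E_col π hπ hp e he).1, mulVec_smul, X.U_col π hπ _ hu', mulVec_smul, X.U_col π hπ _ hu] at h3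
      have h4 := congrFun h3 p
      simp at h4
      exact h4
    subst hv
    rw [X.t_one hs hpl0] at h1 ⊢
    have h5 : u * 1 * (u' * (e * 1)) = (u * u') * e := by group
    rw [h5] at h1 ⊢
    have huu : u * u' = 1 := by
      obtain ⟨c, hc1, hc2, hc3⟩ := X.U_shape π hπ hp _ (mul_mem hu hu')
      apply hc3
      rw [map_mul] at h1
      have := eq_inv_of_mul_eq_one_left h1
      rw [this, ← map_inv, (X.E_col π hπ hp _ (inv_mem he)).2] at hc2
      simpa using hc2
    rw [huu, one_mul] at h1 ⊢
    exact ih e he h1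

theorem triv_inj [Has3 n] [IsLocalRing S] (hs : ∀ i j, i ≠ j → ∀ u v, X.sym i j u v = 1)
    (hπ : ∀ i j, i ≠ j → ∀ a, π (X.x i j a) = CSB.x i j a) (g : G) (hg : π g = 1) : g = 1 :=
  X.triv_inj_B π hs hπ Finset.univ g
    (X.gen _ (fun i j hij a => X.memE (Finset.mem_univ i) (Finset.mem_univ j) hij a) g) hg

end
end St
end CSB

namespace CSB
open Matrix
open scoped commutatorElement
set_option linter.all false

section comm
variable {S : Type*} [CommRing S] {Γ : Type*} [CommGroup Γ]

/-- Axioms for an abstract symbol. -/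
structure Sy (c : Sˣ → Sˣ → Γ) (D : S → S → Γ) (Y : Subgroup Sˣ) (M : Ideal S) (q : ℕ) : Prop where
  ml : ∀ u v s, c (u * v) s = c u s * c v s
  mr : ∀ s u v, c s (u * v) = c s u * c s v
  anti : ∀ u v, c u v = (c v u)⁻¹
  P2 : ∀ (s u : Sˣ) (b : S), (u : S) = 1 + s * b → D s b = c s u
  P3 : ∀ (u u' : Sˣ) (a a' b : S), (u : S) = 1 + a * b → (u' : S) = 1 + a' * b →
    D (a + u * a') b = D a b * D a' b
  P4 : ∀ (s u : Sˣ) (a b : S), (u : S) = 1 + a * b → D (s * a) ((s⁻¹ : Sˣ) * b) = c s u * D a b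
  hY : ∀ y ∈ Y, ∀ u, c y u = 1
  hneg : -1 ∈ Y
  hun : ∀ p ∈ M, IsUnit (1 + p)
  hq : (q : S) ∈ M
  hz : ∀ z : Sˣ, (z : S) ^ q - z ∈ M
  hcl : ∀ a : S, a ∈ AddSubmonoid.closure {s : S | ∃ y ∈ Y, (y : S) = s}
  hdec : ∀ u : Sˣ, ∃ y ∈ Y, ∃ p ∈ M, (u : S) = y * (1 + p)

variable {c : Sˣ → Sˣ → Γ} {D : S → S → Γ} {Y : Subgroup Sˣ} {M : Ideal S} {q : ℕ}

theorem Sy.step (h : Sy c D Y M q) {I I' : Ideal S} (hIM : I ≤ M) (hMI : ∀ a ∈ M, ∀ b ∈ I, a * b ∈ I')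
    (hI' : I' ≤ I) (F : ∀ a, ∀ b ∈ I', D a b = 1) : ∀ a, ∀ b ∈ I, D a b = 1 := by
  have c1l : ∀ s, c 1 s = 1 := fun s => by have := h.ml 1 1 s; simpa using this
  have c1r : ∀ s, c s 1 = 1 := fun s => by have := h.mr s 1 1; simpa using this
  have hYr : ∀ y ∈ Y, ∀ u, c u y = 1 := fun y hy u => by rw [h.anti, h.hY y hy, inv_one]
  have cinv : ∀ u s, c u⁻¹ s = (c u s)⁻¹ := fun u s => by
    have := h.ml u⁻¹ u s
    rw [inv_mul_cancel, c1l] at this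
    exact eq_inv_of_mul_eq_one_left this.symm
  have ca : ∀ u v : Sˣ, (v : S) - 1 ∈ I' → c u v = 1 := by
    intro u v hv
    rw [← h.P2 u v ((u⁻¹ : Sˣ) * (v - 1)) (by have := u.mul_inv; grind)]
    exact F _ _ (I'.mul_mem_left _ hv)
  have congr : ∀ u v w : Sˣ, (u : S) - w ∈ I' → c v u = c v w := by
    intro u v w huw
    have h1 : u = w * (w⁻¹ * u) := by group
    rw [h1, h.mr, ca v (w⁻¹ * u), mul_one]
    have : ((w⁻¹ * u : Sˣ) : S) - 1 = (w⁻¹ : Sˣ) * (u - w) := by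
      have := w.mul_inv; push_cast; grind
    rw [this]; exact I'.mul_mem_left _ huw
  have congl : ∀ u v w : Sˣ, (u : S) - w ∈ I' → c u v = c w v := by
    intro u v w huw
    rw [h.anti, congr u v w huw, ← h.anti]
  have hex : ∀ p : S, ∃ u : Sˣ, p ∈ M → (u : S) = 1 + p := by
    intro p
    by_cases hp : p ∈ M
    · obtain ⟨u, hu⟩ := h.hun p hp; exact ⟨u, fun _ => hu⟩
    · exact ⟨1, fun h => absurd h hp⟩
  choose e he0 using hex
  have he : ∀ p ∈ I, (e p : S) = 1 + p := fun p hp => he0 p (hIM hp)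
  have hII : ∀ a ∈ I, ∀ b ∈ I, a * b ∈ I' := fun a ha b hb => hMI a (hIM ha) b hb
  have ψl : ∀ p ∈ I, ∀ p' ∈ I, ∀ r, c (e (p + p')) r = c (e p) r * c (e p') r := by
    intro p hp p' hp' r
    rw [← h.ml]
    apply congl
    push_cast
    rw [he p hp, he p' hp', he _ (add_mem hp hp')]
    have : 1 + (p + p') - (1 + p) * (1 + p') = - (p * p') := by ring
    rw [this]; exact neg_mem (hII p hp p' hp')
  have ψr : ∀ p ∈ I, ∀ p' ∈ I, ∀ r, c r (e (p + p')) = c r (e p) * c r (e p') := by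
    intro p hp p' hp' r
    rw [h.anti, ψl p hp p' hp', h.anti r (e p), h.anti r (e p')]
    group
    exact mul_comm _ _
  have ψz : ∀ p ∈ I', ∀ r, c (e p) r = 1 := by
    intro p hp r
    rw [h.anti, ca, inv_one]
    rw [he p (hI' hp)]; simpa using hp
  have ψz' : ∀ p ∈ I', ∀ r, c r (e p) = 1 := by
    intro p hp r
    rw [h.anti, ψz p hp, inv_one]
  have ψn : ∀ p ∈ I, ∀ r, c r (e (-p)) = (c r (e p))⁻¹ := by
    intro p hp r
    have := ψr p hp (-p) (neg_mem hp) r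
    rw [add_neg_cancel, ψz' 0 (zero_mem _)] at this
    exact eq_inv_of_mul_eq_one_right this.symm
  have D0 : ∀ b, D 0 b = 1 := by
    intro b
    have := h.P3 1 1 0 0 b (by simp) (by simp)
    simpa using this
  have D1 : ∀ b ∈ I, D 1 b = 1 := by
    intro b hb
    have := h.P2 1 (e b) b (by rw [he b hb]; simp)
    rwa [c1l, Units.val_one] at this
  have Dc : ∀ a, ∀ y ∈ Y, ∀ b ∈ I, D (a + (y : S)) b = D a b * (c (e (a * b)) (e (y * b)))⁻¹ := by
    intro a y hy b hb
    have hab : a * b ∈ I := I.mul_mem_left _ hb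
    have hyb : (y : S) * b ∈ I := I.mul_mem_left _ hb
    obtain ⟨u, hu⟩ : ∃ u, u = e (a * b) := ⟨_, rfl⟩
    have hu1 : (u : S) = 1 + a * b := by rw [hu, he _ hab]
    have hub : ((u⁻¹ : Sˣ) : S) * y * b ∈ I := I.mul_mem_left _ hb
    obtain ⟨u', hu'⟩ : ∃ u', u' = e (((u⁻¹ : Sˣ) : S) * y * b) := ⟨_, rfl⟩
    have hu'1 : (u' : S) = 1 + ((u⁻¹ : Sˣ) : S) * y * b := by rw [hu', he _ hub]
    have h1 := h.P3 u u' a ((u⁻¹ : Sˣ) * y) b hu1 hu'1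
    rw [← mul_assoc, Units.mul_inv, one_mul] at h1
    rw [h1, ← hu]
    congr 1
    have h2 := h.P2 (u⁻¹ * y) u' b (by push_cast; exact hu'1)
    push_cast at h2
    rw [h2, h.ml, h.hY y hy, mul_one, cinv]
    congr 1
    apply congr
    rw [hu'1, he _ hyb]
    have : 1 + ((u⁻¹ : Sˣ) : S) * y * b - (1 + y * b) = (a * b) * (-(((u⁻¹ : Sˣ) : S) * y * b)) := by
      have := u.mul_inv; grind
    rw [this]
    exact hII _ hab _ (neg_mem hub)
  have alt : ∀ b ∈ I, c (e b) (e b) = 1 := by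
    intro b hb
    have := Dc 1 (-1) h.hneg b hb
    have h2 : (1 : S) + ((-1 : Sˣ) : S) = 0 := by simp
    rw [h2, D0, D1 b hb, one_mul, one_mul] at this
    have h3 : ((-1 : Sˣ) : S) * b = -b := by simp
    rw [h3, ψn b hb, inv_inv] at this
    exact this.symm
  have Dψ : ∀ p ∈ I, ∀ r ∈ I, D p r = c (e p) (e r) := by
    intro p hp r hr
    have h1 := Dc p 1 (one_mem _) r hr
    rw [ψz _ (hII p hp r hr), inv_one, mul_one] at h1
    have hpr : r + p * r ∈ I := add_mem hr (I.mul_mem_left _ hr)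
    have h2 := h.P2 (e p) (e (r + p * r)) r (by rw [he _ hpr, he p hp]; ring)
    rw [← h1, Units.val_one, add_comm p, ← he p hp, h2]
    rw [ψr r hr _ (hI' (hII p hp r hr)), ψz' _ (hII p hp r hr), mul_one]
  have sh : ∀ z ∈ Y, ∀ p ∈ I, ∀ r ∈ I, c (e (z * p)) (e r) = c (e p) (e (z * r)) := by
    intro z hz p hp r hr
    have hzr : (z : S) * r ∈ I := I.mul_mem_left _ hr
    have h1 := h.P4 z (e (p * (z * r))) p (z * r) (he _ (I.mul_mem_left _ hzr))
    rw [h.hY z hz, one_mul, Dψ p hp _ hzr, ← mul_assoc, Units.inv_mul, one_mul,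
      Dψ _ (I.mul_mem_left _ hp) r hr] at h1
    exact h1
  have alt2 : ∀ z ∈ Y, ∀ p ∈ I, c (e p) (e (z * p)) = 1 := by
    intro z hz p hp
    have hzp : (z : S) * p ∈ I := I.mul_mem_left _ hp
    rcases Nat.even_or_odd' q with ⟨t, ht | ht⟩
    · have h1 : (z : S) * p = ((z ^ t * z ^ t : Sˣ) : S) * p + (-((z : S) ^ q - z) * p) := by
        rw [ht]; push_cast; ring
      rw [h1, ψr _ (I.mul_mem_left _ hp) _ (I.mul_mem_left _ hp), ψz' _ (hMI _ (neg_mem (h.hz z)) p hp), mul_one]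
      push_cast
      have h2 : ((z : S) ^ t) = ((z ^ t : Sˣ) : S) := by push_cast; rfl
      rw [mul_assoc, h2, ← sh _ (pow_mem hz t) _ hp _ (I.mul_mem_left _ hp)]
      exact alt _ (I.mul_mem_left _ hp)
    · have h1 : ∀ m : ℕ, c (e p) (e (m * ((z : S) * p))) = c (e p) (e (z * p)) ^ m := by
        intro m
        induction m with
        | zero => rw [Nat.cast_zero, zero_mul, ψz' 0 (zero_mem _), pow_zero]
        | succ m ih => rw [Nat.cast_succ, add_mul, one_mul, ψr _ (I.mul_mem_left _ hzp) _ hzp, ih, pow_succ]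
      have h2 := h1 q
      rw [ψz' _ (hMI _ h.hq _ hzp)] at h2
      have h3 : c (e p) (e (z * p)) ^ 2 = 1 := by
        have := h.anti (e p) (e (z * p))
        rw [sh z hz p hp p hp] at this
        rw [pow_two]; nth_rewrite 1 [this]; simp
      rw [ht, pow_succ, pow_mul, h3, one_pow, one_mul] at h2
      exact h2.symm
  have key : ∀ y ∈ Y, ∀ b ∈ I, ∀ a, c (e (a * b)) (e (y * b)) = 1 := by
    intro y hy b hb a
    have hyb : (y : S) * b ∈ I := I.mul_mem_left _ hb
    induction h.hcl a using AddSubmonoid.closure_induction with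
    | mem a ha =>
      obtain ⟨z, hz, rfl⟩ := ha
      rw [sh z hz b hb _ hyb, ← mul_assoc, ← Units.val_mul]
      exact alt2 _ (mul_mem hz hy) b hb
    | zero => rw [zero_mul, ψz 0 (zero_mem _)]
    | add a a' _ _ h1 h2 =>
      rw [add_mul, ψl _ (I.mul_mem_left _ hb) _ (I.mul_mem_left _ hb), h1, h2, one_mul]
  intro a b hb
  induction h.hcl a using AddSubmonoid.closure_induction_right with
  | zero => exact D0 b
  | add_right a _ y hy ih =>
    obtain ⟨y, hy, rfl⟩ := hy
    rw [Dc a y hy b hb, key y hy b hb, ih]; simp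

theorem Sy.triv (h : Sy c D Y M q) {N : ℕ} (hN : M ^ N = ⊥) (u v : Sˣ) : c u v = 1 := by
  have c1r : ∀ s, c s 1 = 1 := fun s => by have := h.mr s 1 1; simpa using this
  have D00 : ∀ a, D a 0 = 1 := by
    intro a
    induction h.hcl a using AddSubmonoid.closure_induction with
    | mem a ha =>
      obtain ⟨z, hz, rfl⟩ := ha
      rw [h.P2 z 1 0 (by simp), c1r]
    | zero =>
      have := h.P3 1 1 0 0 0 (by simp) (by simp)
      simpa using this
    | add a a' _ _ h1 h2 =>
      have := h.P3 1 1 a a' 0 (by simp) (by simp)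
      simpa [h1, h2] using this
  have F : ∀ m, m ≤ N → ∀ a, ∀ b ∈ M ^ (N - m + 1), D a b = 1 := by
    intro m
    induction m with
    | zero =>
      intro _ a b hb
      have : b ∈ M ^ N := Ideal.pow_le_pow_right (by omega) hb
      rw [hN] at this
      rw [(Ideal.mem_bot).1 this, D00]
    | succ m ih =>
      intro hm
      have e1 : N - m = N - (m + 1) + 1 := by omega
      refine h.step (I := M ^ (N - (m + 1) + 1)) (I' := M ^ (N - m + 1)) ?_ ?_ ?_ (ih (by omega))
      · exact Ideal.pow_le_self (by omega)
      · intro a ha b hb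
        rw [e1, pow_succ', ]
        exact Ideal.mul_mem_mul ha hb
      · exact Ideal.pow_le_pow_right (by omega)
  have F1 := F N le_rfl
  rw [Nat.sub_self, zero_add, pow_one] at F1
  obtain ⟨y, hy, p, hp, hv⟩ := h.hdec v
  obtain ⟨w, hw⟩ := h.hun p hp
  have : v = y * w := by ext; push_cast; rw [hv, hw]
  rw [this, h.mr, h.anti, h.hY y hy, inv_one, one_mul, ← h.P2 u w ((u⁻¹ : Sˣ) * p)]
  · exact F1 _ _ (M.mul_mem_left _ hp)
  · rw [hw, ← mul_assoc, Units.mul_inv, one_mul]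

end comm
end CSB

namespace CSB
open Matrix
open scoped commutatorElement IsMulCommutative
set_option linter.all false

namespace St
section
variable {n : Type*} [DecidableEq n] {S : Type*} [CommRing S] {G : Type*} [Group G] (X : St n S G)
  {G' : Type*} [Group G']

/-- image system -/
def map (f : G →* G') (hf : Function.Surjective f) : St n S G' where
  x i j a := f (X.x i j a)
  add i j h a b := by rw [X.add i j h, map_mul]
  comm i j k l h1 h2 h3 h4 a b := by rw [← map_mul, X.comm i j k l h1 h2 h3 h4, map_mul]
  mul3 i j k h1 h2 h3 a b := by rw [← map_commutatorElement, X.mul3 i j k h1 h2 h3]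
  gen H hH g := by
    obtain ⟨g, rfl⟩ := hf g
    exact X.gen (H.comap f) (fun i j hij a => hH i j hij a) g

theorem map_sym (f : G →* G') (hf : Function.Surjective f) (i j : n) (u v : Sˣ) :
    (X.map f hf).sym i j u v = f (X.sym i j u v) := by
  simp only [sym, h, H, map, map_mul, map_inv]

variable [Fintype n]
theorem pi_h (π : G →* GL n S) (hπ : ∀ i j, i ≠ j → ∀ a, π (X.x i j a) = CSB.x i j a) {i j : n} (hij : i ≠ j)
    (u : Sˣ) (v : n → S) : (π (X.h i j u)).val *ᵥ v = fun k => (tch i j u k : S) * v k := by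
  have e := u.mul_inv
  simp only [h, H, map_mul, hπ i j hij, hπ j i hij.symm, Units.val_mul, ← mulVec_mulVec]
  simp only [x_mulVec' hij, x_mulVec' hij.symm]
  ext k
  simp only [Pi.add_apply, Pi.single_apply, tch]
  by_cases h1 : k = i
  · subst h1; simp [hij, hij.symm]; grind
  by_cases h2 : k = j
  · subst h2; simp [hij, hij.symm]; grind
  simp [h1, h2]

theorem pi_sym (π : G →* GL n S) (hπ : ∀ i j, i ≠ j → ∀ a, π (X.x i j a) = CSB.x i j a) {i j : n} (hij : i ≠ j)
    (u v : Sˣ) : π (X.sym i j u v) = 1 := by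
  have : π (X.h i j (u * v)) = π (X.h i j v) * π (X.h i j u) := by
    apply Units.ext
    apply Matrix.ext_of_mulVec_single
    intro k
    rw [Units.val_mul, ← mulVec_mulVec, X.pi_h π hπ hij, X.pi_h π hπ hij, X.pi_h π hπ hij]
    ext l
    simp only [tch]
    split_ifs <;> simp <;> ring
  rw [sym, map_mul, map_mul, map_inv, map_inv, this]; group

theorem triv_of_Sy [Has3 n] {i j : n} (hij : i ≠ j) (Y : Subgroup Sˣ) (M : Ideal S) (q N : ℕ) (hN : M ^ N = ⊥)
    (hY : ∀ y ∈ Y, ∀ u, X.sym i j y u = 1) (hneg : -1 ∈ Y) (hun : ∀ p ∈ M, IsUnit (1 + p)) (hq : (q : S) ∈ M)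
    (hz : ∀ z : Sˣ, (z : S) ^ q - z ∈ M)
    (hcl : ∀ a : S, a ∈ AddSubmonoid.closure {s : S | ∃ y ∈ Y, (y : S) = s})
    (hdec : ∀ u : Sˣ, ∃ y ∈ Y, ∃ p ∈ M, (u : S) = y * (1 + p)) (u v : Sˣ) : X.sym i j u v = 1 := by
  classical
  let c : Sˣ → Sˣ → Subgroup.center G := fun u v => ⟨X.sym i j u v, X.sym_cen hij u v⟩
  have hD : ∀ a b : S, ∃ z : Subgroup.center G, ∀ u : Sˣ, (u : S) = 1 + a * b → (z : G) = X.Dd i j u a b := by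
    intro a b
    by_cases h : IsUnit (1 + a * b)
    · obtain ⟨u, hu⟩ := h
      refine ⟨⟨_, X.Dd_cen hij hu⟩, fun u' hu' => ?_⟩
      have : u' = u := by ext; rw [hu, hu']
      rw [this]
    · exact ⟨1, fun u hu => absurd ⟨u, hu⟩ h⟩
  choose D hD using hD
  have : Sy c D Y M q :=
    { ml := fun u v s => Subtype.ext (X.sym_mul_left hij u v s)
      mr := fun s u v => Subtype.ext (X.sym_mul_right hij s u v)
      anti := fun u v => Subtype.ext (X.sym_anti hij u v)
      P2 := fun s u b hu => by
        apply Subtype.ext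
        have := X.Dd_scale hij (u := u) (a := 1) (b := s * b) (by rw [hu, one_mul]) s
        rw [mul_one, ← mul_assoc, Units.inv_mul, one_mul, X.Dd_one, mul_one] at this
        rw [hD _ _ u hu, this]
      P3 := fun u u' a a' b hu hu' => by
        apply Subtype.ext
        have := X.Dd_add hij hu hu'
        rw [Subgroup.coe_mul, hD _ _ u hu, hD _ _ u' hu', ← this]
        apply hD
        push_cast; rw [hu']; grind
      P4 := fun s u a b hu => by
        apply Subtype.ext
        rw [Subgroup.coe_mul, hD _ _ u hu, ← X.Dd_scale hij hu]
        apply hD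
        have := s.mul_inv
        grind
      hY := fun y hy u => Subtype.ext (hY y hy u)
      hneg := hneg, hun := hun, hq := hq, hz := hz, hcl := hcl, hdec := hdec }
  exact congrArg Subtype.val (this.triv hN u v)

theorem loc_main [Has3 n] [IsLocalRing S] (π : G →* GL n S) (hπ : ∀ i j, i ≠ j → ∀ a, π (X.x i j a) = CSB.x i j a)
    {i j : n} (hij : i ≠ j) {K : ℕ} (y : Fin K → Sˣ) (Y : Subgroup Sˣ) (hYy : Y = Subgroup.closure (Set.range y))
    (M : Ideal S) (q N : ℕ) (hN : M ^ N = ⊥)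
    (hneg : -1 ∈ Y) (hun : ∀ p ∈ M, IsUnit (1 + p)) (hq : (q : S) ∈ M)
    (hz : ∀ z : Sˣ, (z : S) ^ q - z ∈ M)
    (hcl : ∀ a : S, a ∈ AddSubmonoid.closure {s : S | ∃ y ∈ Y, (y : S) = s})
    (hdec : ∀ u : Sˣ, ∃ y ∈ Y, ∃ p ∈ M, (u : S) = y * (1 + p)) (g : G) (hg : π g = 1) :
    ∃ v : Fin K → Sˣ, g = (List.ofFn fun l => X.sym i j (y l) (v l)).prod := by
  classical
  let c : Sˣ → Sˣ → Subgroup.center G := fun u v => ⟨X.sym i j u v, X.sym_cen hij u v⟩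
  have mr : ∀ s u v, c s (u * v) = c s u * c s v := fun s u v => Subtype.ext (X.sym_mul_right hij s u v)
  have c1r : ∀ s, c s 1 = 1 := fun s => by have := mr s 1 1; simpa using this
  let Φ : (Fin K → Sˣ) →* Subgroup.center G :=
    { toFun := fun v => ∏ l, c (y l) (v l)
      map_one' := by simp [c1r]
      map_mul' := fun v w => by simp only [Pi.mul_apply, mr, Finset.prod_mul_distrib] }
  have hΦ1 : ∀ v, Φ v = ∏ l, c (y l) (v l) := fun v => rfl
  have hΦs : ∀ l u, Φ (Pi.mulSingle l u) = c (y l) u := by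
    intro l u
    rw [hΦ1, Finset.prod_eq_single l]
    · rw [Pi.mulSingle_eq_same]
    · intro b _ hb; rw [Pi.mulSingle_eq_of_ne hb, c1r]
    · intro h; exact absurd (Finset.mem_univ l) h
  clear_value Φ
  have hΦ : ∀ v, (Φ v : G) = (List.ofFn fun l => X.sym i j (y l) (v l)).prod := by
    intro v
    have : Φ v = (List.ofFn fun l => c (y l) (v l)).prod := by rw [List.prod_ofFn]; exact hΦ1 v
    rw [this, ← Subgroup.coe_subtype, map_list_prod, List.map_ofFn]; rfl
  let Z : Subgroup G := Φ.range.map (Subgroup.center G).subtype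
  have hZc : ∀ z ∈ Z, z ∈ Subgroup.center G := by
    rintro _ ⟨z, _, rfl⟩; exact z.2
  have hZn : Z.Normal := ⟨fun z hz g => by
    rw [(Subgroup.mem_center_iff.1 (hZc z hz)) g, mul_inv_cancel_right]; exact hz⟩
  have hZπ : Z ≤ π.ker := by
    rintro _ ⟨_, ⟨v, rfl⟩, rfl⟩
    rw [MonoidHom.mem_ker, Subgroup.coe_subtype, hΦ, map_list_prod, List.map_ofFn]
    apply List.prod_eq_one
    intro t ht
    rw [List.mem_ofFn] at ht
    obtain ⟨l, rfl⟩ := ht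
    exact X.pi_sym π hπ hij _ _
  let X' := X.map (QuotientGroup.mk' Z) (QuotientGroup.mk'_surjective Z)
  have hsy : ∀ l u, X'.sym i j (y l) u = 1 := by
    intro l u
    rw [map_sym, QuotientGroup.mk'_apply, QuotientGroup.eq_one_iff]
    refine ⟨_, ⟨Pi.mulSingle l u, rfl⟩, ?_⟩
    rw [Subgroup.coe_subtype]
    rw [hΦs]
  have hY : ∀ y ∈ Y, ∀ u, X'.sym i j y u = 1 := by
    intro t ht u
    rw [hYy] at ht
    induction ht using Subgroup.closure_induction with
    | mem t ht => obtain ⟨l, rfl⟩ := ht; exact hsy l u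
    | one => have := X'.sym_mul_left hij 1 1 u; simpa using this
    | mul a b _ _ ha hb => rw [X'.sym_mul_left hij, ha, hb, one_mul]
    | inv a _ ha =>
      have := X'.sym_mul_left hij a⁻¹ a u
      rw [inv_mul_cancel, ha, mul_one] at this
      rw [← this]
      have := X'.sym_mul_left hij 1 1 u; simpa using this
  have hs : ∀ i' j', i' ≠ j' → ∀ u v, X'.sym i' j' u v = 1 := by
    intro i' j' h u v
    rw [X'.sym_idx hij h]
    exact X'.triv_of_Sy hij Y M q N hN hY hneg hun hq hz hcl hdec u v
  let π' : G ⧸ Z →* GL n S := QuotientGroup.lift Z π hZπ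
  have := X'.triv_inj π' hs (fun i j hij a => hπ i j hij a) (QuotientGroup.mk' Z g) hg
  rw [QuotientGroup.mk'_apply, QuotientGroup.eq_one_iff] at this
  obtain ⟨_, ⟨v, rfl⟩, h⟩ := this
  exact ⟨v, by rw [← hΦ]; exact h.symm⟩

end
end St
end CSB

namespace CSB
open Matrix
open scoped commutatorElement
set_option linter.all false

/-- kernel of the projection consists of products of `K` symbols -/
def KerSym (n : Type) [Fintype n] [DecidableEq n] (S : Type) [CommRing S] (K : ℕ) : Prop :=
  ∀ (G : Type) [Group G] (X : St n S G) (π : G →* GL n S) (hπ : ∀ i j, i ≠ j → ∀ a, π (X.x i j a) = CSB.x i j a)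
    (i j : n) (hij : i ≠ j) (g : G), π g = 1 →
    ∃ y v : Fin K → Sˣ, g = (List.ofFn fun l => X.sym i j (y l) (v l)).prod

theorem ker_local {n : Type} [Fintype n] [DecidableEq n] [Has3 n] {S : Type} [CommRing S] [Finite S] [IsLocalRing S]
    {k : ℕ} (f : MvPolynomial (Fin k) ℤ →+* S) (hf : Function.Surjective f) : KerSym n S (k + 2) := by
  classical
  intro G _ X π hπ i j hij g hg
  let κ := IsLocalRing.ResidueField S
  have : Finite κ := Finite.of_surjective _ (IsLocalRing.residue_surjective (R := S))
  have : Fintype κ := Fintype.ofFinite κ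
  obtain ⟨z, hz⟩ := IsCyclic.exists_generator (α := κˣ)
  obtain ⟨ζ', hζ'⟩ := IsLocalRing.residue_surjective (z : κ)
  have hζu : IsUnit ζ' := by
    by_contra h
    have h1 : ζ' ∈ IsLocalRing.maximalIdeal S := h
    rw [← IsLocalRing.residue_eq_zero_iff, hζ'] at h1
    exact z.ne_zero h1
  obtain ⟨ζ, rfl⟩ := hζu
  have ht : ∀ l : Fin k, ∃ u : Sˣ, (u : S) = f (MvPolynomial.X l) ∨ (u : S) = f (MvPolynomial.X l) + 1 := by
    intro l
    by_cases h : IsUnit (f (MvPolynomial.X l))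
    · obtain ⟨u, hu⟩ := h; exact ⟨u, Or.inl hu⟩
    · have h2 : ¬ IsUnit (-(f (MvPolynomial.X l))) := fun h' => h (IsUnit.neg_iff _ |>.1 h')
      obtain ⟨u, hu⟩ := IsLocalRing.isUnit_one_sub_self_of_mem_nonunits _ h2
      exact ⟨u, Or.inr (by rw [hu]; ring)⟩
  choose t ht using ht
  obtain ⟨N, hN⟩ := (isArtinianRing_iff_isNilpotent_maximalIdeal S).1 inferInstance
  let y : Fin (k + 2) → Sˣ := Fin.cons (-1) (Fin.cons ζ t)
  obtain ⟨Y, hY⟩ : ∃ Y, Y = Subgroup.closure (Set.range y) := ⟨_, rfl⟩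
  have yY : ∀ l, y l ∈ Y := fun l => hY ▸ Subgroup.subset_closure ⟨l, rfl⟩
  have nY : -1 ∈ Y := yY 0
  have zY : ζ ∈ Y := yY 1
  have tY : ∀ l, t l ∈ Y := fun l => yY l.succ.succ
  refine (fun hmain => ?_) (X.loc_main π hπ hij y Y hY (IsLocalRing.maximalIdeal S) (Fintype.card κ) N hN nY ?_ ?_ ?_ ?_ ?_ g hg)
  · obtain ⟨v, hv⟩ := hmain
    exact ⟨y, v, hv⟩
  · intro p hp
    have h2 : -p ∈ nonunits S := (IsLocalRing.maximalIdeal S).neg_mem hp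
    have := IsLocalRing.isUnit_one_sub_self_of_mem_nonunits _ h2
    simpa using this
  · rw [← IsLocalRing.residue_eq_zero_iff, map_natCast]
    exact FiniteField.cast_card_eq_zero κ
  · intro z
    rw [← IsLocalRing.residue_eq_zero_iff, map_sub, map_pow]
    exact sub_eq_zero.2 (FiniteField.pow_card _)
  · obtain ⟨T, hT⟩ : ∃ T, T = AddSubmonoid.closure {s : S | ∃ y ∈ Y, (y : S) = s} := ⟨_, rfl⟩
    rw [← hT]
    have hYT : ∀ y ∈ Y, (y : S) ∈ T := fun y hy => hT ▸ AddSubmonoid.subset_closure ⟨y, hy, rfl⟩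
    have hmul : ∀ a ∈ T, ∀ b ∈ T, a * b ∈ T := by
      intro a ha b hb
      rw [hT] at ha hb
      induction ha, hb using AddSubmonoid.closure_induction₂ with
      | mem a b ha hb =>
        obtain ⟨a, ha, rfl⟩ := ha
        obtain ⟨b, hb, rfl⟩ := hb
        rw [← Units.val_mul]; exact hYT _ (mul_mem ha hb)
      | zero_left a _ => rw [zero_mul]; exact zero_mem _
      | zero_right a _ => rw [mul_zero]; exact zero_mem _
      | add_left a b c _ _ _ h1 h2 => rw [add_mul]; exact add_mem h1 h2
      | add_right a b c _ _ _ h1 h2 => rw [mul_add]; exact add_mem h1 h2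
    have h1 : (1 : S) ∈ T := hYT 1 (one_mem _)
    have hn1 : (-1 : S) ∈ T := by have := hYT _ nY; simpa using this
    have hnat : ∀ m : ℕ, (m : S) ∈ T := by
      intro m
      induction m with
      | zero => rw [Nat.cast_zero]; exact zero_mem _
      | succ m ih => rw [Nat.cast_succ]; exact add_mem ih h1
    intro a
    obtain ⟨P, rfl⟩ := hf a
    induction P using MvPolynomial.induction_on with
    | C m =>
      have : f (MvPolynomial.C m) = (m : S) := by
        have := map_intCast (f.comp MvPolynomial.C) m
        simpa using this
      rw [this]
      rcases Int.eq_nat_or_neg m with ⟨m, rfl | rfl⟩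
      · simpa using hnat m
      · have := hmul _ hn1 _ (hnat m)
        simpa using this
    | add p r hp hr => rw [map_add]; exact add_mem hp hr
    | mul_X p l hp =>
      rw [map_mul]
      refine hmul _ hp _ ?_
      rcases ht l with h | h
      · rw [← h]; exact hYT _ (tY l)
      · have : f (MvPolynomial.X l) = t l + (-1) := by rw [h]; ring
        rw [this]; exact add_mem (hYT _ (tY l)) hn1
  · intro u
    obtain ⟨m, hm⟩ := hz (Units.map (IsLocalRing.residue S).toMonoidHom u)
    refine ⟨ζ ^ m, zpow_mem zY m, ((ζ ^ m)⁻¹ * u : Sˣ) - 1, ?_, ?_⟩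
    · have hzz : z = Units.map (IsLocalRing.residue S).toMonoidHom ζ := Units.ext hζ'.symm
      rw [hzz] at hm
      have hm' : Units.map (IsLocalRing.residue S).toMonoidHom (ζ ^ m) = Units.map (IsLocalRing.residue S).toMonoidHom u := by
        rw [map_zpow]; exact hm
      have h3 : Units.map (IsLocalRing.residue S).toMonoidHom ((ζ ^ m)⁻¹ * u) = 1 := by
        rw [map_mul, map_inv, hm', inv_mul_cancel]
      rw [← IsLocalRing.residue_eq_zero_iff, map_sub, map_one, sub_eq_zero]
      exact congrArg Units.val h3
    · have e := (ζ ^ m).mul_inv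
      push_cast
      push_cast at e
      grind

end CSB

namespace CSB
open Matrix
open scoped commutatorElement
set_option linter.all false

/-- change of coefficients along an isomorphism -/
def St.equiv {n : Type} {S T : Type} [CommRing S] [CommRing T] (e : S ≃+* T) {G : Type} [Group G] (X : St n S G) :
    St n T G where
  x i j a := X.x i j (e.symm a)
  add i j h a b := by rw [map_add, X.add i j h]
  comm i j k l h1 h2 h3 h4 a b := X.comm i j k l h1 h2 h3 h4 _ _
  mul3 i j k h1 h2 h3 a b := by rw [X.mul3 i j k h1 h2 h3, map_mul]
  gen H hH g := X.gen H (fun i j hij a => by have := hH i j hij (e a); rwa [e.symm_apply_apply] at this) g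

theorem KerSym.equiv {n : Type} [Fintype n] [DecidableEq n] {S T : Type} [CommRing S] [CommRing T] (e : S ≃+* T)
    {K : ℕ} (h : KerSym n T K) : KerSym n S K := by
  intro G _ X π hπ i j hij g hg
  obtain ⟨y, v, h⟩ := h G (X.equiv e) ((mp n e.toRingHom).comp π) (fun i j hij a => by
    rw [MonoidHom.comp_apply]
    show mp n _ (π (X.x i j (e.symm a))) = _
    rw [hπ i j hij, mp_x]
    simp) i j hij g (by rw [MonoidHom.comp_apply, hg, map_one])
  refine ⟨fun l => Units.map e.symm.toRingHom.toMonoidHom (y l), fun l => Units.map e.symm.toRingHom.toMonoidHom (v l), ?_⟩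
  rw [h]
  congr 2
  ext l
  simp [St.sym, St.h, St.H, St.equiv]

section prod
variable {n : Type} [Fintype n] [DecidableEq n] [Has3 n] {A B : Type} [CommRing A] [CommRing B]
  {G : Type} [Group G]

theorem St.comm_orth (X : St n (A × B) G) {i j k l : n} (hij : i ≠ j) (hkl : k ≠ l) (a : A) (b : B) :
    Commute (X.x i j (a, 0)) (X.x k l (0, b)) := by
  have c1 : ∀ i j k l, i ≠ j → k ≠ l → (j ≠ k ∨ i ≠ l) → ∀ (a : A) (b : B), Commute (X.x i j (a, 0)) (X.x k l (0, b)) := by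
    intro i j k l hij hkl h a b
    by_cases hjk : j = k
    · subst hjk
      have hil : i ≠ l := h.resolve_left (fun h => h rfl)
      have := X.mul3 i j l hij hkl hil (a, 0) (0, b)
      rw [Prod.mk_mul_mk, mul_zero, zero_mul, ← Prod.zero_eq_mk, X.zero hil] at this
      exact commutatorElement_eq_one_iff_commute.1 this
    by_cases hil : i = l
    · subst hil
      have := X.mul3 k i j hkl hij (Ne.symm hjk) (0, b) (a, 0)
      rw [Prod.mk_mul_mk, mul_zero, zero_mul, ← Prod.zero_eq_mk, X.zero (Ne.symm hjk)] at this
      exact (commutatorElement_eq_one_iff_commute.1 this).symm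
    exact X.comm i j k l hij hkl hjk hil _ _
  by_cases h : j ≠ k ∨ i ≠ l
  · exact c1 i j k l hij hkl h a b
  push Not at h
  obtain ⟨rfl, rfl⟩ := h
  obtain ⟨m, hm1, hm2⟩ := Has3.third i j
  have e : X.x i j (a, 0) = ⁅X.x i m (a, 0), X.x m j (1, 0)⁆ := by
    rw [X.mul3 i m j hm1.symm hm2 hij]; simp
  rw [e, commutatorElement_def]
  have d1 := c1 i m j i hm1.symm hkl (Or.inl hm2) a b
  have d2 := c1 m j j i hm2 hkl (Or.inr hm1) 1 b
  exact ((d1.mul_left d2).mul_left d1.inv_left).mul_left d2.inv_left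

/-- first factor subgroup -/
def St.G1 (X : St n (A × B) G) : Subgroup G := Subgroup.closure {g | ∃ i j, i ≠ j ∧ ∃ a, g = X.x i j (a, 0)}
/-- second factor subgroup -/
def St.G2 (X : St n (A × B) G) : Subgroup G := Subgroup.closure {g | ∃ i j, i ≠ j ∧ ∃ a, g = X.x i j (0, a)}

theorem St.comm12 (X : St n (A × B) G) (g : G) (hg : g ∈ X.G1) (h : G) (hh : h ∈ X.G2) : Commute g h := by
  induction hg using Subgroup.closure_induction with
  | mem g hg =>
    obtain ⟨i, j, hij, a, rfl⟩ := hg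
    induction hh using Subgroup.closure_induction with
    | mem h hh => obtain ⟨k, l, hkl, b, rfl⟩ := hh; exact X.comm_orth hij hkl a b
    | one => exact Commute.one_right _
    | mul x y _ _ h1 h2 => exact h1.mul_right h2
    | inv x _ h1 => exact h1.inv_right
  | one => exact Commute.one_left _
  | mul x y _ _ h1 h2 => exact h1.mul_left h2
  | inv x _ h1 => exact h1.inv_left

open Classical in
/-- first factor system -/
noncomputable def St.X1 (X : St n (A × B) G) : St n A X.G1 where
  x i j a := if h : i ≠ j then ⟨X.x i j (a, 0), Subgroup.subset_closure ⟨i, j, h, a, rfl⟩⟩ else 1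
  add i j h a b := by
    simp only [h, ne_eq, not_false_eq_true, dite_true]
    apply Subtype.ext
    simp only [Subgroup.coe_mul]
    rw [← X.add i j h]; simp
  comm i j k l h1 h2 h3 h4 a b := by
    simp only [h1, h2, ne_eq, not_false_eq_true, dite_true]
    apply Subtype.ext
    simp only [Subgroup.coe_mul]
    exact X.comm i j k l h1 h2 h3 h4 _ _
  mul3 i j k h1 h2 h3 a b := by
    simp only [h1, h2, h3, ne_eq, not_false_eq_true, dite_true]
    apply Subtype.ext
    have := X.mul3 i j k h1 h2 h3 (a, 0) (b, 0)
    rw [Prod.mk_mul_mk, mul_zero] at this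
    exact this
  gen H hH g := by
    obtain ⟨g, hg⟩ := g
    have : X.G1 ≤ H.map X.G1.subtype := by
      refine (Subgroup.closure_le _).2 ?_
      rintro _ ⟨i, j, hij, a, rfl⟩
      have := hH i j hij a
      simp only [hij, ne_eq, not_false_eq_true, dite_true] at this
      exact ⟨_, this, rfl⟩
    obtain ⟨g', h1, h2⟩ := this hg
    have : g' = ⟨g, hg⟩ := Subtype.ext h2
    exact this ▸ h1

open Classical in
/-- second factor system -/
noncomputable def St.X2 (X : St n (A × B) G) : St n B X.G2 where
  x i j a := if h : i ≠ j then ⟨X.x i j (0, a), Subgroup.subset_closure ⟨i, j, h, a, rfl⟩⟩ else 1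
  add i j h a b := by
    simp only [h, ne_eq, not_false_eq_true, dite_true]
    apply Subtype.ext
    simp only [Subgroup.coe_mul]
    rw [← X.add i j h]; simp
  comm i j k l h1 h2 h3 h4 a b := by
    simp only [h1, h2, ne_eq, not_false_eq_true, dite_true]
    apply Subtype.ext
    simp only [Subgroup.coe_mul]
    exact X.comm i j k l h1 h2 h3 h4 _ _
  mul3 i j k h1 h2 h3 a b := by
    simp only [h1, h2, h3, ne_eq, not_false_eq_true, dite_true]
    apply Subtype.ext
    have := X.mul3 i j k h1 h2 h3 (0, a) (0, b)
    rw [Prod.mk_mul_mk, mul_zero] at this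
    exact this
  gen H hH g := by
    obtain ⟨g, hg⟩ := g
    have : X.G2 ≤ H.map X.G2.subtype := by
      refine (Subgroup.closure_le _).2 ?_
      rintro _ ⟨i, j, hij, a, rfl⟩
      have := hH i j hij a
      simp only [hij, ne_eq, not_false_eq_true, dite_true] at this
      exact ⟨_, this, rfl⟩
    obtain ⟨g', h1, h2⟩ := this hg
    have : g' = ⟨g, hg⟩ := Subtype.ext h2
    exact this ▸ h1

theorem St.X1_x (X : St n (A × B) G) {i j : n} (h : i ≠ j) (a : A) : (X.X1.x i j a : G) = X.x i j (a, 0) := by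
  simp [St.X1, h]
theorem St.X2_x (X : St n (A × B) G) {i j : n} (h : i ≠ j) (a : B) : (X.X2.x i j a : G) = X.x i j (0, a) := by
  simp [St.X2, h]

theorem KerSym.prod {K : ℕ} (hA : KerSym n A K) (hB : KerSym n B K) : KerSym n (A × B) K := by
  intro G _ X π hπ i0 j0 hij0 g hg
  let φ : X.G1 × X.G2 →* G := MonoidHom.noncommCoprod X.G1.subtype X.G2.subtype
    (fun a b => X.comm12 a a.2 b b.2)
  have hφ : ∀ a b, φ (a, b) = a * b := fun a b => rfl
  have hx : ∀ i j, i ≠ j → ∀ s : A × B, X.x i j s = φ (X.X1.x i j s.1, X.X2.x i j s.2) := by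
    intro i j hij s
    rw [hφ, X.X1_x hij, X.X2_x hij, ← X.add i j hij]; simp
  obtain ⟨⟨g1, g2⟩, rfl⟩ : ∃ p, φ p = g := X.gen φ.range (fun i j hij a => ⟨_, (hx i j hij a).symm⟩) g
  have k1 : ∀ g ∈ X.G1, mp n (RingHom.snd A B) (π g) = 1 := by
    intro g hg
    induction hg using Subgroup.closure_induction with
    | mem g hg => obtain ⟨i, j, hij, a, rfl⟩ := hg; rw [hπ i j hij, mp_x]; exact x_zero _ _
    | one => rw [map_one, map_one]
    | mul x y _ _ h1 h2 => rw [map_mul, map_mul, h1, h2, one_mul]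
    | inv x _ h1 => rw [map_inv, map_inv, h1, inv_one]
  have k2 : ∀ g ∈ X.G2, mp n (RingHom.fst A B) (π g) = 1 := by
    intro g hg
    induction hg using Subgroup.closure_induction with
    | mem g hg => obtain ⟨i, j, hij, a, rfl⟩ := hg; rw [hπ i j hij, mp_x]; exact x_zero _ _
    | one => rw [map_one, map_one]
    | mul x y _ _ h1 h2 => rw [map_mul, map_mul, h1, h2, one_mul]
    | inv x _ h1 => rw [map_inv, map_inv, h1, inv_one]
  rw [hφ, map_mul] at hg
  have e1 := congrArg (mp n (RingHom.fst A B)) hg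
  have e2 := congrArg (mp n (RingHom.snd A B)) hg
  rw [map_mul, k2 _ g2.2, mul_one, map_one] at e1
  rw [map_mul, k1 _ g1.2, one_mul, map_one] at e2
  obtain ⟨y1, v1, h1⟩ := hA X.G1 X.X1 (((mp n (RingHom.fst A B)).comp π).comp X.G1.subtype) (fun i j hij a => by
    simp only [MonoidHom.comp_apply, Subgroup.coe_subtype]
    rw [X.X1_x hij, hπ i j hij, mp_x]; rfl) i0 j0 hij0 g1 e1
  obtain ⟨y2, v2, h2⟩ := hB X.G2 X.X2 (((mp n (RingHom.snd A B)).comp π).comp X.G2.subtype) (fun i j hij a => by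
    simp only [MonoidHom.comp_apply, Subgroup.coe_subtype]
    rw [X.X2_x hij, hπ i j hij, mp_x]; rfl) i0 j0 hij0 g2 e2
  have hsym : ∀ (u1 v1 : Aˣ) (u2 v2 : Bˣ), X.sym i0 j0 (MulEquiv.prodUnits.symm (u1, u2)) (MulEquiv.prodUnits.symm (v1, v2)) =
      φ (X.X1.sym i0 j0 u1 v1, X.X2.sym i0 j0 u2 v2) := by
    intro u1 v1 u2 v2
    simp only [St.sym, St.h, St.H, hx i0 j0 hij0, hx j0 i0 hij0.symm, ← map_mul, ← map_inv]
    rfl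
  refine ⟨fun l => MulEquiv.prodUnits.symm (y1 l, y2 l), fun l => MulEquiv.prodUnits.symm (v1 l, v2 l), ?_⟩
  simp only [hsym]
  have hpair : (g1, g2) = (List.ofFn fun l => ((X.X1.sym i0 j0 (y1 l) (v1 l), X.X2.sym i0 j0 (y2 l) (v2 l)) : X.G1 × X.G2)).prod := by
    refine Prod.ext ?_ ?_
    · rw [← MonoidHom.coe_fst, map_list_prod, List.map_ofFn]; exact h1
    · rw [← MonoidHom.coe_snd, map_list_prod, List.map_ofFn]; exact h2
  rw [hpair, map_list_prod, List.map_ofFn]; rfl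

end prod

theorem exists_idem {S : Type} [CommRing S] [Finite S] (a : S) : ∃ m : ℕ, 0 < m ∧ a ^ m * a ^ m = a ^ m := by
  obtain ⟨p, r, hpr, h⟩ := Finite.exists_ne_map_eq_of_infinite (fun m : ℕ => a ^ (m + 1))
  wlog hlt : p < r generalizing p r
  · exact this r p hpr.symm h.symm (by omega)
  obtain ⟨t, rfl⟩ := Nat.exists_eq_add_of_lt hlt
  have h1 : ∀ s, a ^ (p + 1 + s * (t + 1)) = a ^ (p + 1) := by
    intro s
    induction s with
    | zero => simp
    | succ s ih =>
      have : p + 1 + (s + 1) * (t + 1) = (p + t + 1 + 1) + s * (t + 1) := by ring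
      rw [this, pow_add, ← h, ← pow_add, ih]
  refine ⟨(p + 1) * (t + 1), by positivity, ?_⟩
  rw [← pow_add]
  have h2 : (p + 1) * (t + 1) + (p + 1) * (t + 1) = (p + 1 + (p + 1) * (t + 1)) + (p + 1) * t := by ring
  rw [h2, pow_add, h1, ← pow_add]
  congr 1; ring

theorem ker_finite {n : Type} [Fintype n] [DecidableEq n] [Has3 n] {k : ℕ} (N : ℕ) :
    ∀ (S : Type) [CommRing S] [Finite S], Nat.card S ≤ N → ∀ (f : MvPolynomial (Fin k) ℤ →+* S),
      Function.Surjective f → KerSym n S (k + 2) := by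
  induction N with
  | zero =>
    intro S _ _ h
    have := Nat.card_pos (α := S)
    omega
  | succ N ih =>
    intro S _ _ hS f hf
    rcases subsingleton_or_nontrivial S with hsub | hnt
    · intro G _ X π hπ i j hij g hg
      have : ∀ g : G, g = 1 := fun g => by
        have := X.gen ⊥ (fun i j hij a => by
          rw [Subsingleton.elim a 0, X.zero hij]; exact one_mem _) g
        simpa using this
      exact ⟨1, 1, by rw [this g]; exact (this _).symm⟩
    by_cases hid : ∀ e : S, IsIdempotentElem e → e = 0 ∨ e = 1
    · have : IsLocalRing S := by
        refine IsLocalRing.of_isUnit_or_isUnit_one_sub_self fun a => ?_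
        obtain ⟨m, hm, h⟩ := exists_idem a
        rcases hid _ h with h | h
        · exact Or.inr (IsNilpotent.isUnit_one_sub ⟨m, h⟩)
        · exact Or.inl (IsUnit.of_pow_eq_one h hm.ne')
      exact ker_local f hf
    push Not at hid
    obtain ⟨e, he, h0, h1⟩ := hid
    have card : ∀ e : S, e ≠ 0 → Nat.card (S ⧸ Ideal.span {e}) ≤ N := by
      intro e h0
      have : Nat.card (S ⧸ Ideal.span {e}) < Nat.card S := by
        refine lt_of_le_of_ne (Nat.card_le_card_of_surjective _ Ideal.Quotient.mk_surjective) fun h => ?_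
        have := ((Nat.bijective_iff_surjective_and_card _).2 ⟨Ideal.Quotient.mk_surjective, h.symm⟩).1
          (a₁ := e) (a₂ := 0) (by rw [map_zero, Ideal.Quotient.eq_zero_iff_mem]; exact Ideal.mem_span_singleton_self e)
        exact h0 this
      omega
    have q : ∀ e : S, e ≠ 0 → KerSym n (S ⧸ Ideal.span {e}) (k + 2) := fun e h => by
      have : Finite (S ⧸ Ideal.span {e}) := Finite.of_surjective _ Ideal.Quotient.mk_surjective
      exact ih (S ⧸ Ideal.span {e}) (card e h) ((Ideal.Quotient.mk _).comp f) (Ideal.Quotient.mk_surjective.comp hf)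
    have eqv := AlgEquiv.prodQuotientOfIsIdempotentElem ℤ he he.one_sub (by ring) (by rw [mul_sub, mul_one, he.eq, sub_self])
    exact KerSym.equiv eqv.toRingEquiv ((q e h0).prod (q (1 - e) (fun h => h1 (sub_eq_zero.1 h).symm)))

end CSB

namespace CSB
open Matrix
open scoped commutatorElement
set_option linter.all false

section final
variable {d : ℕ} {R : Type} [CommRing R]

theorem elem_toGL (i j : Fin d) (h : i ≠ j) (r : R) : SpecialLinearGroup.toGL (elem i j h r) = x i j r := by
  apply Units.ext
  rw [x_val h]
  rfl

theorem elem_add (i j : Fin d) (h : i ≠ j) (a b : R) : elem i j h (a + b) = elem i j h a * elem i j h b := by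
  apply SpecialLinearGroup.toGL_injective
  rw [map_mul, elem_toGL, elem_toGL, elem_toGL, x_add]

theorem elem_inv (i j : Fin d) (h : i ≠ j) (a : R) : (elem i j h a)⁻¹ = elem i j h (-a) := by
  apply SpecialLinearGroup.toGL_injective
  rw [map_inv, elem_toGL, elem_toGL, x_neg]

instance EL_normal (U : Ideal R) : (EL d U).Normal := Subgroup.normalClosure_normal

theorem elem_EL (U : Ideal R) {i j : Fin d} (h : i ≠ j) {a b : R}
    (hab : Ideal.Quotient.mk U a = Ideal.Quotient.mk U b) :
    (QuotientGroup.mk (elem i j h a) : SpecialLinearGroup (Fin d) R ⧸ EL d U) = QuotientGroup.mk (elem i j h b) := by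
  rw [QuotientGroup.eq, elem_inv, ← elem_add]
  refine Subgroup.subset_normalClosure ⟨i, j, h, _, ?_, rfl⟩
  rw [Ideal.Quotient.eq] at hab
  have := U.neg_mem hab
  have e : -a + b = -(a - b) := by ring
  rw [e]; exact this

/-- generators of the quotient -/
noncomputable def qx (U : Ideal R) (i j : Fin d) (s : R ⧸ U) : SpecialLinearGroup (Fin d) R ⧸ EL d U :=
  if h : i ≠ j then QuotientGroup.mk (elem i j h (Function.surjInv (Ideal.Quotient.mk_surjective (I := U)) s)) else 1

theorem qx_mk (U : Ideal R) {i j : Fin d} (h : i ≠ j) (r : R) :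
    qx U i j (Ideal.Quotient.mk U r) = QuotientGroup.mk (elem i j h r) := by
  rw [qx, dif_pos h]
  exact elem_EL U h (Function.surjInv_eq _ _)

/-- the Steinberg system of the quotient -/
noncomputable def QS (hS : SLE (Fin d) R) (U : Ideal R) : St (Fin d) (R ⧸ U) (SpecialLinearGroup (Fin d) R ⧸ EL d U) where
  x := qx U
  add i j h a b := by
    obtain ⟨a, rfl⟩ := Ideal.Quotient.mk_surjective a
    obtain ⟨b, rfl⟩ := Ideal.Quotient.mk_surjective b
    rw [← map_add, qx_mk U h, qx_mk U h, qx_mk U h, elem_add, QuotientGroup.mk_mul]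
  comm i j k l h1 h2 h3 h4 a b := by
    obtain ⟨a, rfl⟩ := Ideal.Quotient.mk_surjective a
    obtain ⟨b, rfl⟩ := Ideal.Quotient.mk_surjective b
    rw [qx_mk U h1, qx_mk U h2, ← QuotientGroup.mk_mul, ← QuotientGroup.mk_mul]
    congr 1
    apply SpecialLinearGroup.toGL_injective
    rw [map_mul, map_mul, elem_toGL, elem_toGL, x_comm h1 h2 h3 h4]
  mul3 i j k h1 h2 h3 a b := by
    obtain ⟨a, rfl⟩ := Ideal.Quotient.mk_surjective a
    obtain ⟨b, rfl⟩ := Ideal.Quotient.mk_surjective b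
    rw [← map_mul, qx_mk U h1, qx_mk U h2, qx_mk U h3]
    have : elem i k h3 (a * b) = ⁅elem i j h1 a, elem j k h2 b⁆ := by
      apply SpecialLinearGroup.toGL_injective
      rw [map_commutatorElement, elem_toGL, elem_toGL, elem_toGL, x_comm3 h1 h2 h3]
    rw [this]; rfl
  gen H hH g := by
    obtain ⟨g, rfl⟩ := QuotientGroup.mk_surjective g
    have h1 := hS (SpecialLinearGroup.toGL g) g.2
    have h2 : El (Fin d) (Set.univ : Set R) ≤ (H.comap (QuotientGroup.mk' (EL d U))).map SpecialLinearGroup.toGL := by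
      refine El_le fun i j hij a _ => ?_
      refine ⟨elem i j hij a, ?_, elem_toGL i j hij a⟩
      show QuotientGroup.mk (elem i j hij a) ∈ H
      rw [← qx_mk U hij]; exact hH i j hij _
    obtain ⟨g', h3, h4⟩ := h2 h1
    rw [SpecialLinearGroup.toGL_injective h4] at h3
    exact h3

theorem map_elem {S : Type} [CommRing S] (f : R →+* S) (i j : Fin d) (h : i ≠ j) (r : R) :
    SpecialLinearGroup.toGL (SpecialLinearGroup.map f (elem i j h r)) = x i j (f r) := by
  rw [← mp_x, ← elem_toGL i j h]
  ext a b; rfl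

/-- the projection -/
noncomputable def Qπ (U : Ideal R) : (SpecialLinearGroup (Fin d) R ⧸ EL d U) →* GL (Fin d) (R ⧸ U) :=
  QuotientGroup.lift (EL d U) (SpecialLinearGroup.toGL.comp (SpecialLinearGroup.map (Ideal.Quotient.mk U))) (by
    refine Subgroup.normalClosure_le_normal ?_
    rintro _ ⟨i, j, h, u, hu, rfl⟩
    rw [SetLike.mem_coe, MonoidHom.mem_ker, MonoidHom.comp_apply, map_elem, Ideal.Quotient.eq_zero_iff_mem.2 hu, x_zero])

/-- being a product of `m` elementary matrices in the quotient -/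
def EP (U : Ideal R) (m : ℕ) (t : SpecialLinearGroup (Fin d) R ⧸ EL d U) : Prop :=
  ∃ L : List (SpecialLinearGroup (Fin d) R), L.length = m ∧ (∀ e ∈ L, IsElementary e) ∧ t = QuotientGroup.mk L.prod

theorem EP.mul {U : Ideal R} {m m' : ℕ} {t t' : SpecialLinearGroup (Fin d) R ⧸ EL d U} (h : EP U m t) (h' : EP U m' t') :
    EP U (m + m') (t * t') := by
  obtain ⟨L, h1, h2, rfl⟩ := h
  obtain ⟨L', h1', h2', rfl⟩ := h'
  refine ⟨L ++ L', by rw [List.length_append, h1, h1'], ?_, by rw [List.prod_append, QuotientGroup.mk_mul]⟩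
  intro e he
  rcases List.mem_append.1 he with he | he
  · exact h2 e he
  · exact h2' e he

theorem EP.inv {U : Ideal R} {m : ℕ} {t : SpecialLinearGroup (Fin d) R ⧸ EL d U} (h : EP U m t) : EP U m t⁻¹ := by
  obtain ⟨L, h1, h2, rfl⟩ := h
  refine ⟨(L.map (·⁻¹)).reverse, by simpa using h1, ?_, by rw [← QuotientGroup.mk_inv, List.prod_inv_reverse]⟩
  intro e he
  rw [List.mem_reverse, List.mem_map] at he
  obtain ⟨e, he, rfl⟩ := he
  obtain ⟨i, j, h, r, rfl⟩ := h2 e he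
  exact ⟨i, j, h, -r, elem_inv i j h r⟩

theorem EP.x {U : Ideal R} {i j : Fin d} (h : i ≠ j) (s : R ⧸ U) : EP U 1 (qx U i j s) := by
  obtain ⟨r, rfl⟩ := Ideal.Quotient.mk_surjective s
  refine ⟨[elem i j h r], rfl, ?_, by rw [qx_mk U h, List.prod_singleton]⟩
  intro e he
  rw [List.mem_singleton] at he
  exact ⟨i, j, h, r, he⟩

theorem EP.sym (hS : SLE (Fin d) R) {U : Ideal R} {i j : Fin d} (h : i ≠ j) (u v : (R ⧸ U)ˣ) :
    EP U 12 ((QS hS U).sym i j u v) := by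
  have hh : ∀ u, EP U 4 ((QS hS U).h i j u) := fun u =>
    (((EP.x h.symm _).mul (EP.x h _)).mul (EP.x h.symm _)).mul (EP.x h _)
  exact ((hh _).mul (hh _).inv).mul (hh _).inv

theorem EP.list {U : Ideal R} {K : ℕ} : ∀ (l : List (SpecialLinearGroup (Fin d) R ⧸ EL d U)), (∀ t ∈ l, EP U 12 t) →
    EP U (12 * l.length) l.prod := by
  intro l
  induction l with
  | nil => intro _; exact ⟨[], rfl, by simp, by simp⟩
  | cons a l ih =>
    intro h
    rw [List.prod_cons, List.length_cons]
    have := (h a (by simp)).mul (ih fun t ht => h t (by simp [ht]))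
    rwa [show 12 * (l.length + 1) = 12 + 12 * l.length by ring]

end final
end CSB

/-- For `d ≥ 3`, `R = ℤ[x₁,…,x_k]` and an ideal `U` of finite index in `R`, every
`g ∈ SL_d(R)` congruent to the identity modulo `U` is a product `h · u₁ ⋯ u_m` with
`h ∈ EL(d;U)`, each `u_s` an elementary matrix, and `m ≤ 18(k+2)`. -/
theorem congruence_subgroup_bounded_elementary (d k : ℕ) (hd : 3 ≤ d)
    (U : Ideal (MvPolynomial (Fin k) ℤ)) (hU : Finite (MvPolynomial (Fin k) ℤ ⧸ U))
    (g : Matrix.SpecialLinearGroup (Fin d) (MvPolynomial (Fin k) ℤ))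
    (hg : Matrix.SpecialLinearGroup.map (Ideal.Quotient.mk U) g = 1) :
    ∃ m : ℕ, m ≤ 18 * (k + 2) ∧
      ∃ h ∈ EL d U, ∃ f : Fin m → Matrix.SpecialLinearGroup (Fin d) (MvPolynomial (Fin k) ℤ),
        (∀ s, IsElementary (f s)) ∧ g = h * (List.ofFn f).prod := by
  classical
  have : CSB.Has3 (Fin d) := ⟨fun i j => by
    obtain ⟨k, hk⟩ : ∃ k, k ∉ ({i, j} : Finset (Fin d)) := by
      by_contra h
      push Not at h
      have h1 : (Finset.univ : Finset (Fin d)) ⊆ {i, j} := fun k _ => h k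
      have h2 := Finset.card_le_card h1
      have h3 := Finset.card_le_two (a := i) (b := j)
      rw [Finset.card_univ, Fintype.card_fin] at h2
      omega
    simp only [Finset.mem_insert, Finset.mem_singleton, not_or] at hk
    exact ⟨k, hk⟩⟩
  have hS : CSB.SLE (Fin d) (MvPolynomial (Fin k) ℤ) := CSB.suslin k ℤ CSB.PRing_int
  have hij : (⟨0, by omega⟩ : Fin d) ≠ ⟨1, by omega⟩ := by simp
  obtain ⟨y, v, h⟩ := CSB.ker_finite (n := Fin d) (k := k) _ (MvPolynomial (Fin k) ℤ ⧸ U) le_rfl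
    (Ideal.Quotient.mk U) Ideal.Quotient.mk_surjective _ (CSB.QS hS U) (CSB.Qπ U)
    (fun i j hij a => by
      obtain ⟨a, rfl⟩ := Ideal.Quotient.mk_surjective a
      show CSB.Qπ U (CSB.qx U i j _) = _
      rw [CSB.qx_mk U hij]
      exact CSB.map_elem _ i j hij a) _ _ hij (QuotientGroup.mk g)
    (by
      show Matrix.SpecialLinearGroup.toGL (Matrix.SpecialLinearGroup.map (Ideal.Quotient.mk U) g) = 1
      rw [hg, map_one])
  have h2 := CSB.EP.list (U := U) (K := 0) (List.ofFn fun l => (CSB.QS hS U).sym ⟨0, by omega⟩ ⟨1, by omega⟩ (y l) (v l)) (by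
    intro t ht
    rw [List.mem_ofFn] at ht
    obtain ⟨l, rfl⟩ := ht
    exact CSB.EP.sym hS hij _ _)
  rw [← h, List.length_ofFn] at h2
  obtain ⟨L, h3, h4, h5⟩ := h2
  refine ⟨L.length, by omega, g * L.prod⁻¹, ?_, L.get, fun s => h4 _ (List.get_mem L s), ?_⟩
  · have h6 : (QuotientGroup.mk (g * L.prod⁻¹) : Matrix.SpecialLinearGroup (Fin d) (MvPolynomial (Fin k) ℤ) ⧸ EL d U) = 1 := by
      rw [QuotientGroup.mk_mul, QuotientGroup.mk_inv, h5, mul_inv_cancel]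
    exact (QuotientGroup.eq_one_iff _).1 h6
  · rw [List.ofFn_get, inv_mul_cancel_right]
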